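/- For every smooth solution (v,p) of the incompressible Euler equations on (−2,2)×𝕋³ (i.e., ∂_t v + (v·∇)v + ∇p = 0 and div v = 0 pointwise on (−2,2)×𝕋³), there exist α > 0 and a weak solution (v̄,p̄) of the incompressible Euler equations on ℝ×𝕋³, with v̄ and p̄ Hölder continuous of exponent α jointly in time and space, such that (v̄,p̄) = (v,p) on (−1,1)×𝕋³ and there exist constants c ∈ ℝ³ and c₀ ∈ ℝ with v̄(t,x) = c and p̄(t,x) = c₀ for all |t| ≥ 3/2. -/

import Mathlib

noncomputable section

open MeasureTheory

/-- Points of space; functions on the torus 𝕋³ = ℝ³/ℤ³ are identified with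
ℤ³-periodic functions on ℝ³. -/
abbrev Spc : Type := Fin 3 → ℝ

/-- The fundamental domain [0,1)³ of the torus. -/
def Tdom : Set Spc := Set.univ.pi fun _ => Set.Ico (0 : ℝ) 1

/-- ℤ³-periodicity of a function on ℝ³. -/
def Per {α : Type*} (f : Spc → α) : Prop :=
  ∀ (x : Spc) (k : Fin 3 → ℤ), f (fun i => x i + (k i : ℝ)) = f x

/-- Spatial partial derivative in direction `j`. -/
def pd {E : Type*} [NormedAddCommGroup E] [NormedSpace ℝ E]
    (j : Fin 3) (f : Spc → E) (x : Spc) : E :=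
  fderiv ℝ f x (Pi.single j 1)

/-- Time derivative. -/
def pt {E : Type*} [NormedAddCommGroup E] [NormedSpace ℝ E]
    (f : ℝ → Spc → E) (t : ℝ) (x : Spc) : E :=
  deriv (fun s => f s x) t

/-- Smooth test function on ℝ×𝕋³: smooth, ℤ³-periodic in space and
compactly supported in time. -/
def IsTest {E : Type*} [NormedAddCommGroup E] [NormedSpace ℝ E]
    (φ : ℝ → Spc → E) : Prop :=
  ContDiff ℝ (⊤ : ℕ∞) (fun q : ℝ × Spc => φ q.1 q.2) ∧ (∀ t, Per (φ t)) ∧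
    ∃ T : ℝ, ∀ t : ℝ, T < |t| → ∀ x, φ t x = 0

/-- Weak solution of the incompressible Euler equations on ℝ×𝕋³. -/
def IsWeakEuler (v : ℝ → Spc → Spc) (p : ℝ → Spc → ℝ) : Prop :=
  (∀ φ : ℝ → Spc → Spc, IsTest φ →
    (∫ t : ℝ, ∫ x in Tdom,
      ((∑ l, v t x l * pt (fun s y => φ s y l) t x) +
        (∑ j, ∑ l, v t x j * v t x l * pd j (fun y => φ t y l) x) +
        p t x * ∑ j, pd j (fun y => φ t y j) x)) = 0) ∧
  (∀ ψ : ℝ → Spc → ℝ, IsTest ψ →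
    (∫ t : ℝ, ∫ x in Tdom, ∑ j, v t x j * pd j (ψ t) x) = 0)

/-- Hölder continuity of exponent `α`, jointly in time and space. -/
def HolderTS {E : Type*} [NormedAddCommGroup E] (α : ℝ) (f : ℝ → Spc → E) : Prop :=
  ∃ C : ℝ, ∀ (t t' : ℝ) (x x' : Spc),
    ‖f t x - f t' x'‖ ≤ C * dist ((t, x) : ℝ × Spc) ((t', x') : ℝ × Spc) ^ α

/-- The classical (pointwise) incompressible Euler equations on `S × 𝕋³`. -/
def IsClassicalEulerOn (S : Set ℝ) (v : ℝ → Spc → Spc) (p : ℝ → Spc → ℝ) : Prop :=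
  ∀ t ∈ S, ∀ x : Spc,
    (∀ l, pt (fun s y => v s y l) t x
        + (∑ j, v t x j * pd j (fun y => v t y l) x)
        + pd l (p t) x = 0) ∧
    (∑ j, pd j (fun y => v t y j) x = 0)

namespace CI
open scoped ContDiff Topology

/-- smooth scalar functions on `ℝⁿ` -/
abbrev Sm {n : ℕ} (f : (Fin n → ℝ) → ℝ) : Prop := ContDiff ℝ ∞ f

/-- standard basis vector -/
abbrev ee {n : ℕ} (i : Fin n) : Fin n → ℝ := Pi.single i 1

/-- partial derivative -/
def pD {n : ℕ} (i : Fin n) (f : (Fin n → ℝ) → ℝ) : (Fin n → ℝ) → ℝ :=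
  fun z => fderiv ℝ f z (ee i)

section basic
variable {n : ℕ} {f g : (Fin n → ℝ) → ℝ} {i j : Fin n}

lemma Sm.diff (hf : Sm f) : Differentiable ℝ f := hf.differentiable (by simp)

lemma Sm.da (hf : Sm f) (z) : DifferentiableAt ℝ f z := hf.diff z

lemma Sm.pD (hf : Sm f) (i : Fin n) : Sm (pD i f) := by
  have h : ContDiff ℝ ∞ (fderiv ℝ f) := hf.fderiv_right (by simp)
  exact h.clm_apply contDiff_const

lemma Sm.add (hf : Sm f) (hg : Sm g) : Sm (fun z => f z + g z) := ContDiff.add hf hg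
lemma Sm.sub (hf : Sm f) (hg : Sm g) : Sm (fun z => f z - g z) := ContDiff.sub hf hg
lemma Sm.mul (hf : Sm f) (hg : Sm g) : Sm (fun z => f z * g z) := ContDiff.mul hf hg
lemma Sm.neg (hf : Sm f) : Sm (fun z => - f z) := ContDiff.neg hf
lemma Sm.cmul (c : ℝ) (hf : Sm f) : Sm (fun z => c * f z) := contDiff_const.mul hf
lemma Sm.const (c : ℝ) : Sm (fun _ : Fin n → ℝ => c) := contDiff_const
lemma Sm.sum {ι : Type*} {s : Finset ι} {F : ι → (Fin n → ℝ) → ℝ}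
    (h : ∀ a ∈ s, Sm (F a)) : Sm (fun z => ∑ a ∈ s, F a z) := ContDiff.sum h

lemma pD_add (hf : Sm f) (hg : Sm g) :
    pD i (fun z => f z + g z) = fun z => pD i f z + pD i g z := by
  funext z; unfold pD
  rw [fderiv_fun_add (hf.da z) (hg.da z)]; rfl

lemma pD_sub (hf : Sm f) (hg : Sm g) :
    pD i (fun z => f z - g z) = fun z => pD i f z - pD i g z := by
  funext z; unfold pD
  rw [fderiv_fun_sub (hf.da z) (hg.da z)]; rfl

lemma pD_neg : pD i (fun z => - f z) = fun z => - pD i f z := by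
  funext z; unfold pD
  rw [fderiv_fun_neg]; rfl

lemma pD_mul (hf : Sm f) (hg : Sm g) :
    pD i (fun z => f z * g z) = fun z => pD i f z * g z + f z * pD i g z := by
  funext z; unfold pD
  rw [fderiv_fun_mul (hf.da z) (hg.da z)]
  simp; ring

lemma pD_cmul (c : ℝ) (hf : Sm f) : pD i (fun z => c * f z) = fun z => c * pD i f z := by
  funext z; unfold pD
  rw [fderiv_const_mul (hf.da z)]; rfl

lemma pD_const (c : ℝ) : pD i (fun _ : Fin n → ℝ => c) = fun _ => 0 := by
  funext z; unfold pD; simp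

lemma pD_sum {ι : Type*} {s : Finset ι} {F : ι → (Fin n → ℝ) → ℝ}
    (h : ∀ a ∈ s, Sm (F a)) :
    pD i (fun z => ∑ a ∈ s, F a z) = fun z => ∑ a ∈ s, pD i (F a) z := by
  funext z; unfold pD
  rw [fderiv_fun_sum (fun a ha => (h a ha).da z)]; simp

lemma pD_comm (hf : Sm f) : pD i (pD j f) = pD j (pD i f) := by
  funext z
  have h : ContDiff ℝ ∞ (fderiv ℝ f) := hf.fderiv_right (by simp)
  have hd : DifferentiableAt ℝ (fderiv ℝ f) z := h.differentiable (by simp) z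
  have hs : IsSymmSndFDerivAt ℝ f z :=
    (hf.contDiffAt (x := z)).isSymmSndFDerivAt (by simp; exact WithTop.coe_le_coe.2 le_top)
  have key : ∀ a b : Fin n, pD a (pD b f) z = fderiv ℝ (fderiv ℝ f) z (ee a) (ee b) := by
    intro a b
    show fderiv ℝ (fun y => fderiv ℝ f y (ee b)) z (ee a) = _
    rw [fderiv_clm_apply hd (differentiableAt_const _)]
    simp
  rw [key, key, hs]

/-- chain rule for a curve in direction `e` -/
lemma hasDerivAt_line (hf : Sm f) (z e : Fin n → ℝ) (s : ℝ) :
    HasDerivAt (fun s : ℝ => f (z + s • e)) (fderiv ℝ f (z + s • e) e) s := by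
  have h1 : HasFDerivAt f (fderiv ℝ f (z + s • e)) (z + s • e) := (hf.da _).hasFDerivAt
  have h2 : HasDerivAt (fun s : ℝ => z + s • e) e s := by
    simpa using ((hasDerivAt_id s).smul_const e).const_add z
  exact h1.comp_hasDerivAt s h2

lemma fderiv_eq_sum (hf : Sm f) (z e : Fin n → ℝ) : fderiv ℝ f z e = ∑ i, e i * pD i f z := by
  conv_lhs => rw [show e = ∑ i, e i • (ee i : Fin n → ℝ) by
    funext k; simp [Finset.sum_apply, Pi.single_apply]]
  rw [map_sum]; simp [pD]

/-- chain rule -/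
lemma pD_comp {m : ℕ} {φ : Fin m → (Fin n → ℝ) → ℝ} {G : (Fin m → ℝ) → ℝ} (hG : Sm G)
    (hφ : ∀ a, Sm (φ a)) :
    pD i (fun z => G (fun a => φ a z)) = fun z => ∑ a, pD a G (fun a => φ a z) * pD i (φ a) z := by
  funext z
  have h1 : HasFDerivAt (fun z => fun a => φ a z)
      (ContinuousLinearMap.pi fun a => fderiv ℝ (φ a) z) z :=
    hasFDerivAt_pi.2 fun a => ((hφ a).da z).hasFDerivAt
  have h2 := (hG.da (fun a => φ a z)).hasFDerivAt.comp z h1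
  show fderiv ℝ (G ∘ fun z => fun a => φ a z) z (ee i) = _
  rw [h2.fderiv]
  simp only [ContinuousLinearMap.comp_apply]
  rw [fderiv_eq_sum hG]
  refine Finset.sum_congr rfl fun a _ => ?_
  simp [pD, mul_comm]

lemma Sm.comp' {m : ℕ} {φ : Fin m → (Fin n → ℝ) → ℝ} {G : (Fin m → ℝ) → ℝ} (hG : Sm G)
    (hφ : ∀ a, Sm (φ a)) : Sm (fun z => G (fun a => φ a z)) :=
  ContDiff.comp hG (contDiff_pi.2 hφ)

lemma pD_comp1 {φ : (Fin n → ℝ) → ℝ} {g : ℝ → ℝ} (hg : ContDiff ℝ ∞ g) (hφ : Sm φ) :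
    pD i (fun z => g (φ z)) = fun z => deriv g (φ z) * pD i φ z := by
  funext z
  have h2 := (hg.differentiable (by simp) (φ z)).hasDerivAt.comp_hasFDerivAt z (hφ.da z).hasFDerivAt
  show fderiv ℝ (g ∘ φ) z (ee i) = _
  rw [h2.fderiv]; simp [pD]

lemma Sm.coord (i : Fin n) : Sm (fun z : Fin n → ℝ => z i) := contDiff_apply ℝ ℝ i

lemma pD_coord (i j : Fin n) : pD i (fun z : Fin n → ℝ => z j) = fun _ => if i = j then 1 else 0 := by
  funext z; unfold pD
  rw [show (fun z : Fin n → ℝ => z j) = (ContinuousLinearMap.proj j : (Fin n → ℝ) →L[ℝ] ℝ) from rfl,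
    ContinuousLinearMap.fderiv]
  simp [Pi.single_apply, eq_comm]

lemma pD_congr {z : Fin n → ℝ} (h : f =ᶠ[𝓝 z] g) : pD i f z = pD i g z := by
  unfold pD; rw [h.fderiv_eq]

lemma pD_zero_of_open {U : Set (Fin n → ℝ)} (hU : IsOpen U) (h : ∀ z ∈ U, f z = 0) :
    ∀ z ∈ U, pD i f z = 0 := by
  intro z hz
  have : f =ᶠ[𝓝 z] fun _ => 0 := Filter.eventually_of_mem (hU.mem_nhds hz) h
  rw [pD_congr this, pD_const]

lemma pD_shift (hf : Sm f) (e : Fin n → ℝ) : pD i (fun z => f (z + e)) = fun z => pD i f (z + e) := by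
  funext z; unfold pD
  rw [fderiv_comp_add_right]

lemma Sm.shift (hf : Sm f) (e : Fin n → ℝ) : Sm (fun z => f (z + e)) :=
  ContDiff.comp hf (contDiff_id.add contDiff_const)

end basic

section kop
variable {n : ℕ}

lemma kop_aux {F : Type} [NormedAddCommGroup F] [NormedSpace ℝ F] [CompleteSpace F]
    {w : ℝ → ℝ} (hw : Continuous w) {e : Fin n → ℝ} {f : (Fin n → ℝ) → F} (hf : ContDiff ℝ ∞ f)
    (z₀ : Fin n → ℝ) :
    HasFDerivAt (fun z => ∫ s in (0:ℝ)..1, w s • f (z + s • e))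
      (∫ s in (0:ℝ)..1, w s • fderiv ℝ f (z₀ + s • e)) z₀ := by
  have hfc : Continuous f := hf.continuous
  have hf' : Continuous (fderiv ℝ f) := hf.continuous_fderiv (by simp)
  have hc : Continuous (fun q : (Fin n → ℝ) × ℝ => w q.2 • fderiv ℝ f (q.1 + q.2 • e)) := by
    fun_prop
  obtain ⟨C, hC⟩ := ((isCompact_closedBall z₀ 1).prod (isCompact_Icc (a := (0:ℝ)) (b := 1))).exists_bound_of_continuousOn
    hc.continuousOn
  refine intervalIntegral.hasFDerivAt_integral_of_dominated_of_fderiv_le (bound := fun _ => C)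
    (F' := fun z s => w s • fderiv ℝ f (z + s • e))
    (s := Metric.closedBall z₀ 1) (Metric.closedBall_mem_nhds _ one_pos) ?_ ?_ ?_ ?_ ?_ ?_
  · refine Filter.Eventually.of_forall fun z => ?_
    exact Continuous.aestronglyMeasurable (by fun_prop)
  · exact Continuous.intervalIntegrable (by fun_prop) _ _
  · exact Continuous.aestronglyMeasurable (by fun_prop)
  · refine Filter.Eventually.of_forall fun t ht z hz => ?_
    rw [Set.uIoc_of_le zero_le_one] at ht
    exact hC (z, t) ⟨hz, ⟨ht.1.le, ht.2⟩⟩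
  · simp
  · refine Filter.Eventually.of_forall fun t ht z hz => ?_
    refine HasFDerivAt.const_smul ?_ _
    have h1 : HasFDerivAt f (fderiv ℝ f (z + t • e)) (z + t • e) :=
      (hf.differentiable (by simp) _).hasFDerivAt
    exact (hasFDerivAt_comp_add_right _).2 h1

lemma kop_contDiff {w : ℝ → ℝ} (hw : Continuous w) {e : Fin n → ℝ} (m : ℕ) :
    ∀ {F : Type} [NormedAddCommGroup F] [NormedSpace ℝ F] [CompleteSpace F]
      {f : (Fin n → ℝ) → F} (_ : ContDiff ℝ ∞ f),
      ContDiff ℝ m (fun z => ∫ s in (0:ℝ)..1, w s • f (z + s • e)) := by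
  induction m with
  | zero =>
    intro F _ _ _ f hf
    have h : Differentiable ℝ (fun z => ∫ s in (0:ℝ)..1, w s • f (z + s • e)) :=
      fun z => (kop_aux hw hf z).differentiableAt
    simpa using h.continuous
  | succ m ih =>
    intro F _ _ _ f hf
    have h : Differentiable ℝ (fun z => ∫ s in (0:ℝ)..1, w s • f (z + s • e)) :=
      fun z => (kop_aux hw hf z).differentiableAt
    have e1 : fderiv ℝ (fun z => ∫ s in (0:ℝ)..1, w s • f (z + s • e)) =
        fun z => ∫ s in (0:ℝ)..1, w s • fderiv ℝ f (z + s • e) :=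
      funext fun z => (kop_aux hw hf z).fderiv
    rw [show ((m + 1 : ℕ) : WithTop ℕ∞) = (m : WithTop ℕ∞) + 1 by push_cast; rfl,
      contDiff_succ_iff_fderiv]
    refine ⟨h, by simp, ?_⟩
    rw [e1]
    exact ih (hf.fderiv_right (by simp))

/-- weighted averaging operator along a segment -/
def Kop (w : ℝ → ℝ) (e : Fin n → ℝ) (f : (Fin n → ℝ) → ℝ) : (Fin n → ℝ) → ℝ :=
  fun z => ∫ s in (0:ℝ)..1, w s * f (z + s • e)

variable {w w' : ℝ → ℝ} {e e' : Fin n → ℝ} {f g : (Fin n → ℝ) → ℝ}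

lemma Sm.Kop (hf : Sm f) (hw : Continuous w) (e : Fin n → ℝ) : Sm (Kop w e f) := by
  rw [Sm, contDiff_infty]
  intro m
  exact kop_contDiff hw m hf

lemma Sm.cont (hf : Sm f) : Continuous f := hf.continuous

lemma Sm.ii (hf : Sm f) (hw : Continuous w) (z e : Fin n → ℝ) :
    IntervalIntegrable (fun s => w s * f (z + s • e)) volume 0 1 := by
  have := hf.cont
  exact Continuous.intervalIntegrable (by fun_prop) _ _

lemma pD_Kop (hf : Sm f) (hw : Continuous w) (e : Fin n → ℝ) (i : Fin n) :
    pD i (Kop w e f) = Kop w e (pD i f) := by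
  funext z
  show fderiv ℝ (fun z => ∫ s in (0:ℝ)..1, w s • f (z + s • e)) z (ee i) = _
  have hf' : Continuous (fderiv ℝ f) := hf.continuous_fderiv (by simp)
  rw [(kop_aux hw hf z).fderiv, ContinuousLinearMap.intervalIntegral_apply]
  · simp [Kop, pD]
  · exact Continuous.intervalIntegrable (by fun_prop) _ _

lemma Kop_bound {B : ℝ} (hw : ∀ s ∈ Set.Icc (0:ℝ) 1, |w s| ≤ 1) (hB : ∀ z, |f z| ≤ B)
    (z : Fin n → ℝ) : |Kop w e f z| ≤ B := by
  have := intervalIntegral.norm_integral_le_of_norm_le_const (a := (0:ℝ)) (b := 1) (C := B)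
    (f := fun s => w s * f (z + s • e)) ?_
  · simpa [Kop] using this
  · intro s hs
    rw [Set.uIoc_of_le zero_le_one] at hs
    rw [Real.norm_eq_abs, abs_mul]
    calc |w s| * |f (z + s • e)| ≤ 1 * B :=
          mul_le_mul (hw s ⟨hs.1.le, hs.2⟩) (hB _) (abs_nonneg _) zero_le_one
      _ = B := one_mul _

lemma Kop_add (hf : Sm f) (hg : Sm g) (hw : Continuous w) :
    Kop w e (fun z => f z + g z) = fun z => Kop w e f z + Kop w e g z := by
  funext z; unfold Kop
  rw [← intervalIntegral.integral_add (hf.ii hw z e) (hg.ii hw z e)]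
  simp [mul_add]

lemma Kop_sub (hf : Sm f) (hg : Sm g) (hw : Continuous w) :
    Kop w e (fun z => f z - g z) = fun z => Kop w e f z - Kop w e g z := by
  funext z; unfold Kop
  rw [← intervalIntegral.integral_sub (hf.ii hw z e) (hg.ii hw z e)]
  simp [mul_sub]

lemma Kop_cmul (c : ℝ) : Kop w e (fun z => c * f z) = fun z => c * Kop w e f z := by
  funext z; unfold Kop
  rw [← intervalIntegral.integral_const_mul]
  congr 1; funext s; ring

lemma Kop_neg : Kop w e (fun z => - f z) = fun z => - Kop w e f z := by
  funext z; unfold Kop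
  rw [← intervalIntegral.integral_neg]
  congr 1; funext s; ring

lemma Kop_sum {ι : Type*} {s : Finset ι} {F : ι → (Fin n → ℝ) → ℝ}
    (h : ∀ a ∈ s, Sm (F a)) (hw : Continuous w) :
    Kop w e (fun z => ∑ a ∈ s, F a z) = fun z => ∑ a ∈ s, Kop w e (F a) z := by
  funext z; unfold Kop
  rw [← intervalIntegral.integral_finsetSum (fun a ha => (h a ha).ii hw z e)]
  simp [Finset.mul_sum]

/-- multiplication by a function constant along `e` -/
lemma Kop_mul_const (hg : ∀ (z : Fin n → ℝ) (s : ℝ), g (z + s • e) = g z) :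
    Kop w e (fun z => g z * f z) = fun z => g z * Kop w e f z := by
  funext z; unfold Kop
  rw [← intervalIntegral.integral_const_mul]
  congr 1; funext s; beta_reduce; rw [hg]; ring

lemma Kop_const_fun (hg : ∀ (z : Fin n → ℝ) (s : ℝ), g (z + s • e) = g z) :
    Kop w e g = fun z => (∫ s in (0:ℝ)..1, w s) * g z := by
  funext z; unfold Kop
  rw [← intervalIntegral.integral_mul_const]
  congr 1; funext s; rw [hg]

lemma Kop_periodic {p : Fin n → ℝ} (h : ∀ z, f (z + p) = f z) (z : Fin n → ℝ) :
    Kop w e f (z + p) = Kop w e f z := by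
  unfold Kop
  congr 1; funext s
  rw [show z + p + s • e = z + s • e + p by abel, h]

lemma Kop_vanish {U : Set (Fin n → ℝ)} (hU : ∀ z ∈ U, ∀ s : ℝ, z + s • e ∈ U)
    (h : ∀ z ∈ U, f z = 0) : ∀ z ∈ U, Kop w e f z = 0 := by
  intro z hz; unfold Kop
  simp [h _ (hU z hz _)]

lemma Kop_comm (hf : Sm f) (hw : Continuous w) (hw' : Continuous w') :
    Kop w e (Kop w' e' f) = Kop w' e' (Kop w e f) := by
  funext z; unfold Kop
  have hfc := hf.cont
  simp_rw [← intervalIntegral.integral_const_mul]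
  rw [intervalIntegral_intervalIntegral_swap]
  · congr 1; funext s; congr 1; funext t
    rw [show z + t • e + s • e' = z + s • e' + t • e by abel]; ring
  · have : Continuous (Function.uncurry fun s t => w s * (w' t * f (z + s • e + t • e'))) := by
      unfold Function.uncurry; fun_prop
    have h2 : IntegrableOn (Function.uncurry fun s t => w s * (w' t * f (z + s • e + t • e')))
        (Set.uIoc (0:ℝ) 1 ×ˢ Set.uIoc (0:ℝ) 1) (volume.prod volume) :=
      (this.continuousOn.integrableOn_compact
        ((isCompact_uIcc (a := (0:ℝ)) (b := 1)).prod (isCompact_uIcc (a := (0:ℝ)) (b := 1)))).mono_set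
        (Set.prod_mono Set.uIoc_subset_uIcc Set.uIoc_subset_uIcc)
    exact h2

/-- FTC for the Steklov average -/
lemma Kop_fderiv (hf : Sm f) (z : Fin n → ℝ) :
    ∫ s in (0:ℝ)..1, fderiv ℝ f (z + s • e) e = f (z + e) - f z := by
  have hf' : Continuous (fderiv ℝ f) := hf.continuous_fderiv (by simp)
  rw [intervalIntegral.integral_eq_sub_of_hasDerivAt (f := fun s : ℝ => f (z + s • e))
    (fun s _ => hasDerivAt_line hf z e s)]
  · simp
  · exact Continuous.intervalIntegrable (by fun_prop) _ _

/-- average along coordinate direction -/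
def Pav (j : Fin n) (f : (Fin n → ℝ) → ℝ) := Kop (fun _ => 1) (ee j) f
/-- mean free antiderivative in a coordinate direction -/
def Ian (j : Fin n) (f : (Fin n → ℝ) → ℝ) := Kop (fun s => s - 1/2) (ee j) f

variable {i j : Fin n}

lemma Sm.Pav (hf : Sm f) (j : Fin n) : Sm (Pav j f) := hf.Kop continuous_const _
lemma Sm.Ian (hf : Sm f) (j : Fin n) : Sm (Ian j f) := hf.Kop (by fun_prop) _
lemma pD_Pav (hf : Sm f) : pD i (Pav j f) = Pav j (pD i f) := pD_Kop hf continuous_const _ _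
lemma pD_Ian (hf : Sm f) : pD i (Ian j f) = Ian j (pD i f) := pD_Kop hf (by fun_prop) _ _

lemma Pav_pD (hf : Sm f) (hp : ∀ z, f (z + ee j) = f z) : Pav j (pD j f) = fun _ => 0 := by
  funext z
  have := Kop_fderiv (e := ee j) hf z
  simp only [Pav, Kop, one_mul, pD]
  rw [this, hp]; ring

lemma const_of_fderiv (hf : Sm f) (h : ∀ z, fderiv ℝ f z e = 0) (z : Fin n → ℝ) (s : ℝ) :
    f (z + s • e) = f z := by
  have := is_const_of_deriv_eq_zero (f := fun s : ℝ => f (z + s • e))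
    (fun s => (hasDerivAt_line hf z e s).differentiableAt)
    (fun s => by rw [(hasDerivAt_line hf z e s).deriv, h])
  simpa using this s 0

lemma Pav_const (hf : Sm f) (hp : ∀ z, f (z + ee j) = f z) (z : Fin n → ℝ) (s : ℝ) :
    Pav j f (z + s • ee j) = Pav j f z := by
  refine const_of_fderiv (hf.Pav j) (fun z => ?_) z s
  have := congrFun (pD_Pav (i := j) (j := j) hf) z
  rw [Pav_pD hf hp] at this
  exact this

lemma Ian_Pav (hf : Sm f) (hp : ∀ z, f (z + ee j) = f z) : Ian j (Pav j f) = fun _ => 0 := by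
  unfold Ian
  rw [Kop_const_fun (Pav_const hf hp)]
  funext z
  rw [intervalIntegral.integral_sub (by simp) (by simp)]
  simp

lemma Pav_Ian (hf : Sm f) (hp : ∀ z, f (z + ee j) = f z) : Pav j (Ian j f) = fun _ => 0 := by
  have h := Ian_Pav hf hp
  unfold Ian Pav at *
  rw [Kop_comm hf continuous_const (by fun_prop), h]

lemma pD_Ian_self (hf : Sm f) (hp : ∀ z, f (z + ee j) = f z) :
    pD j (Ian j f) = fun z => f z - Pav j f z := by
  rw [pD_Ian hf]
  funext z
  have hf' : Continuous (fderiv ℝ f) := hf.continuous_fderiv (by simp)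
  have hfc := hf.cont
  have key := intervalIntegral.integral_mul_deriv_eq_deriv_mul (a := (0:ℝ)) (b := 1)
    (u := fun s => s - 1/2) (v := fun s => f (z + s • ee j)) (u' := fun _ => 1)
    (v' := fun s => fderiv ℝ f (z + s • ee j) (ee j))
    (fun s _ => by simpa using (hasDerivAt_id s).sub_const (1/2:ℝ))
    (fun s _ => hasDerivAt_line hf z (ee j) s) (by simp)
    (Continuous.intervalIntegrable (by fun_prop) _ _)
  have : Ian j (pD j f) z = ∫ s in (0:ℝ)..1, (s - 1/2) * fderiv ℝ f (z + s • ee j) (ee j) := rfl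
  rw [this, key]
  simp only [one_smul, zero_smul, add_zero, hp, Pav, Kop]
  ring

lemma Pav_bound {B : ℝ} (hB : ∀ z, |f z| ≤ B) (z : Fin n → ℝ) : |Pav j f z| ≤ B :=
  Kop_bound (by simp) hB z
lemma Ian_bound {B : ℝ} (hB : ∀ z, |f z| ≤ B) (z : Fin n → ℝ) : |Ian j f z| ≤ B :=
  Kop_bound (by intro s hs; rw [abs_le]; constructor <;> linarith [hs.1, hs.2]) hB z

end kop

end CI

namespace CI
open scoped ContDiff Topology

/-- `|f| ≤ A` and each partial derivative `∂ᵢ` costs a factor `L i`, up to order `N`. -/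
def Bd {n : ℕ} : ℕ → ℝ → (Fin n → ℝ) → ((Fin n → ℝ) → ℝ) → Prop
  | 0, A, _, f => ∀ z, |f z| ≤ A
  | N+1, A, L, f => (∀ z, |f z| ≤ A) ∧ ∀ i, Bd N (A * L i) L (pD i f)

section bd
variable {n : ℕ} {f g : (Fin n → ℝ) → ℝ} {A B : ℝ} {L L' : Fin n → ℝ} {N M : ℕ}

lemma Bd.le (h : Bd N A L f) (z) : |f z| ≤ A := by
  cases N with
  | zero => exact h z
  | succ N => exact h.1 z

lemma Bd.nonneg (h : Bd N A L f) : 0 ≤ A := (abs_nonneg _).trans (h.le 0)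

lemma Bd.pD (h : Bd (N+1) A L f) (i : Fin n) : Bd N (A * L i) L (pD i f) := h.2 i

lemma Bd.down (h : Bd (N+1) A L f) : Bd N A L f := by
  induction N generalizing A f with
  | zero => exact h.1
  | succ N ih => exact ⟨h.1, fun i => ih (h.2 i)⟩

lemma Bd.ord (h : Bd N A L f) (hM : M ≤ N) : Bd M A L f := by
  induction N with
  | zero => obtain rfl : M = 0 := by omega
            exact h
  | succ N ih =>
    rcases Nat.lt_or_ge M (N+1) with h1 | h1
    · exact ih h.down (by omega)
    · obtain rfl : M = N + 1 := by omega
      exact h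

lemma Bd.mono (h : Bd N A L f) (hA : A ≤ B) (hL : ∀ i, 0 ≤ L i) (hLL : ∀ i, L i ≤ L' i) :
    Bd N B L' f := by
  induction N generalizing A B f with
  | zero => exact fun z => (h z).trans hA
  | succ N ih =>
    have h0 := h.nonneg
    refine ⟨fun z => (h.1 z).trans hA, fun i => ih (h.2 i) ?_⟩
    exact mul_le_mul hA (hLL i) (hL i) (h0.trans hA)

lemma Bd.monoA (h : Bd N A L f) (hA : A ≤ B) (hL : ∀ i, 0 ≤ L i) : Bd N B L f :=
  h.mono hA hL fun _ => le_rfl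

lemma Bd.zero (hA : 0 ≤ A) (hL : ∀ i, 0 ≤ L i) : Bd N A L (fun _ => 0) := by
  induction N generalizing A with
  | zero => intro z; simpa using hA
  | succ N ih =>
    refine ⟨fun z => by simpa using hA, fun i => ?_⟩
    rw [pD_const]; exact ih (mul_nonneg hA (hL i))

lemma Bd.const {c : ℝ} (hA : |c| ≤ A) (hL : ∀ i, 0 ≤ L i) : Bd N A L (fun _ => c) := by
  have h0 : 0 ≤ A := (abs_nonneg _).trans hA
  cases N with
  | zero => exact fun z => hA
  | succ N =>
    refine ⟨fun z => hA, fun i => ?_⟩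
    rw [pD_const]; exact Bd.zero (mul_nonneg h0 (hL i)) hL

lemma Bd.add (hf : Bd N A L f) (hg : Bd N B L g) (sf : Sm f) (sg : Sm g) :
    Bd N (A + B) L (fun z => f z + g z) := by
  have key : ∀ z, |f z + g z| ≤ A + B := fun z =>
    (abs_add_le _ _).trans (add_le_add (hf.le z) (hg.le z))
  induction N generalizing A B f g with
  | zero => exact key
  | succ N ih =>
    refine ⟨key, fun i => ?_⟩
    rw [pD_add sf sg, add_mul]
    exact ih (hf.2 i) (hg.2 i) (sf.pD i) (sg.pD i) (fun z =>
      (abs_add_le _ _).trans (add_le_add ((hf.2 i).le z) ((hg.2 i).le z)))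

lemma Bd.cmul (c : ℝ) (hf : Bd N A L f) (sf : Sm f) :
    Bd N (|c| * A) L (fun z => c * f z) := by
  induction N generalizing A f with
  | zero => intro z; rw [abs_mul]; exact mul_le_mul_of_nonneg_left (hf z) (abs_nonneg _)
  | succ N ih =>
    refine ⟨fun z => ?_, fun i => ?_⟩
    · rw [abs_mul]; exact mul_le_mul_of_nonneg_left (hf.le z) (abs_nonneg _)
    · rw [pD_cmul c sf, mul_assoc]
      exact ih (hf.2 i) (sf.pD i)

lemma Bd.neg (hf : Bd N A L f) (sf : Sm f) : Bd N A L (fun z => - f z) := by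
  simpa using hf.cmul (-1) sf

lemma Bd.sub (hf : Bd N A L f) (hg : Bd N B L g) (sf : Sm f) (sg : Sm g) :
    Bd N (A + B) L (fun z => f z - g z) := by
  simpa [sub_eq_add_neg] using hf.add (hg.neg sg) sf sg.neg

lemma Bd.sum {ι : Type*} {s : Finset ι} {F : ι → (Fin n → ℝ) → ℝ} {A : ι → ℝ}
    (h : ∀ a ∈ s, Bd N (A a) L (F a)) (hs : ∀ a ∈ s, Sm (F a)) (hL : ∀ i, 0 ≤ L i) :
    Bd N (∑ a ∈ s, A a) L (fun z => ∑ a ∈ s, F a z) := by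
  classical
  induction s using Finset.induction_on with
  | empty => simpa using Bd.zero le_rfl hL
  | insert a s ha ih =>
    simp only [Finset.sum_insert ha]
    exact (h a (by simp)).add (ih (fun b hb => h b (by simp [hb])) fun b hb => hs b (by simp [hb]))
      (hs a (by simp)) (Sm.sum fun b hb => hs b (by simp [hb]))

lemma Bd.mul (hf : Bd N A L f) (hg : Bd N B L g) (sf : Sm f) (sg : Sm g) (hL : ∀ i, 0 ≤ L i) :
    Bd N (A * B) (fun i => 2 * L i) (fun z => f z * g z) := by
  have key : ∀ z, |f z * g z| ≤ A * B := fun z => by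
    rw [abs_mul]; exact mul_le_mul (hf.le z) (hg.le z) (abs_nonneg _) hf.nonneg
  induction N generalizing A B f g with
  | zero => exact key
  | succ N ih =>
    refine ⟨key, fun i => ?_⟩
    rw [pD_mul sf sg]
    have h1 := ih (hf.2 i) hg.down (sf.pD i) sg (fun z => by
      rw [abs_mul]; exact mul_le_mul ((hf.2 i).le z) (hg.le z) (abs_nonneg _) (hf.2 i).nonneg)
    have h2 := ih hf.down (hg.2 i) sf (sg.pD i) (fun z => by
      rw [abs_mul]; exact mul_le_mul (hf.le z) ((hg.2 i).le z) (abs_nonneg _) hf.nonneg)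
    have h3 := h1.add h2 ((sf.pD i).mul sg) (sf.mul (sg.pD i))
    rwa [show A * L i * B + A * (B * L i) = A * B * (2 * L i) by ring] at h3

lemma Bd.Kop {w : ℝ → ℝ} (hw : Continuous w) (hw1 : ∀ s ∈ Set.Icc (0:ℝ) 1, |w s| ≤ 1)
    (hf : Bd N A L f) (sf : Sm f) (e : Fin n → ℝ) : Bd N A L (Kop w e f) := by
  induction N generalizing A f with
  | zero => exact Kop_bound hw1 hf
  | succ N ih =>
    refine ⟨Kop_bound hw1 hf.1, fun i => ?_⟩
    rw [pD_Kop sf hw]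
    exact ih (hf.2 i) (sf.pD i)

lemma Bd.Pav (hf : Bd N A L f) (sf : Sm f) (j : Fin n) : Bd N A L (Pav j f) :=
  hf.Kop continuous_const (by simp) sf _

lemma Bd.Ian (hf : Bd N A L f) (sf : Sm f) (j : Fin n) : Bd N A L (Ian j f) :=
  hf.Kop (by fun_prop) (by intro s hs; rw [abs_le]; constructor <;> linarith [hs.1, hs.2]) sf _

lemma Bd.comp {m : ℕ} {φ : Fin m → (Fin n → ℝ) → ℝ} {G : (Fin m → ℝ) → ℝ}
    {C : ℝ} {W : Fin m → ℝ} {H : Fin m → Fin n → ℝ}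
    (hG : Bd N C W G) (sG : Sm G) (sφ : ∀ a, Sm (φ a)) (hW : ∀ a, 0 ≤ W a)
    (hφ : ∀ a i, Bd N (H a i) L (CI.pD i (φ a)))
    (hH : ∀ i, ∑ a, W a * H a i ≤ L i) (hL : ∀ i, 0 ≤ L i) :
    Bd N C (fun i => 2 ^ N * L i) (fun z => G (fun a => φ a z)) := by
  induction N generalizing C G with
  | zero => exact fun z => hG _
  | succ N ih =>
    refine ⟨fun z => hG.1 _, fun i => ?_⟩
    rw [pD_comp sG sφ]
    have hC := hG.nonneg
    have hL' : ∀ i, 0 ≤ (2:ℝ) ^ N * L i := fun i => mul_nonneg (by positivity) (hL i)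
    have h1 : ∀ a ∈ (Finset.univ : Finset (Fin m)), Bd N (C * W a * H a i)
        (fun i => 2 * (2 ^ N * L i))
        (fun z => CI.pD a G (fun a => φ a z) * CI.pD i (φ a) z) := by
      intro a _
      refine Bd.mul (ih (hG.2 a) (sG.pD a) fun a i => (hφ a i).down) ?_
        ((sG.pD a).comp' sφ) ((sφ a).pD i) hL'
      refine (hφ a i).down.mono le_rfl hL fun i => ?_
      have : (1:ℝ) ≤ 2 ^ N := one_le_pow₀ (by norm_num)
      nlinarith [hL i]
    have h2 := Bd.sum h1 (fun a _ => ((sG.pD a).comp' sφ).mul ((sφ a).pD i))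
      (fun i => by have := hL' i; positivity)
    have h3 : ∑ a, C * W a * H a i ≤ C * (2 ^ (N+1) * L i) := by
      simp_rw [mul_assoc]
      rw [← Finset.mul_sum]
      refine mul_le_mul_of_nonneg_left ?_ hC
      have : (1:ℝ) ≤ 2 ^ (N+1) := one_le_pow₀ (by norm_num)
      nlinarith [hL i, hH i]
    refine h2.mono h3 (fun i => by have := hL' i; positivity) fun i => le_of_eq (by ring)

lemma Bd.comp1 {φ : (Fin n → ℝ) → ℝ} {g : ℝ → ℝ} {C : ℝ}
    (hg : ∀ m ≤ N, ∀ s, |iteratedDeriv m g s| ≤ C) (sg : ContDiff ℝ ∞ g) (sφ : Sm φ)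
    (hφ : ∀ i, Bd N (L i) L (CI.pD i φ)) (hL : ∀ i, 0 ≤ L i) :
    Bd N C (fun i => 2 ^ N * L i) (fun z => g (φ z)) := by
  induction N generalizing g with
  | zero => intro z; simpa using hg 0 le_rfl (φ z)
  | succ N ih =>
    refine ⟨fun z => by simpa using hg 0 (by omega) (φ z), fun i => ?_⟩
    rw [pD_comp1 sg sφ]
    have sg' : ContDiff ℝ ∞ (deriv g) := by
      have := (contDiff_infty_iff_deriv (𝕜 := ℝ)).1 sg; exact this.2
    have hL' : ∀ i, 0 ≤ (2:ℝ) ^ N * L i := fun i => mul_nonneg (by positivity) (hL i)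
    have h1 := ih (g := deriv g) (fun m hm s => by
      rw [← iteratedDeriv_succ']; exact hg (m+1) (by omega) s) sg' (fun i => (hφ i).down)
    have h2 : Bd N (L i) (fun i => 2 ^ N * L i) (CI.pD i φ) := by
      refine (hφ i).down.mono le_rfl hL fun i => ?_
      have : (1:ℝ) ≤ 2 ^ N := one_le_pow₀ (by norm_num)
      nlinarith [hL i]
    have hC := h1.nonneg
    refine (h1.mul h2 (sg'.comp sφ) (sφ.pD i) hL').mono ?_
      (fun i => by have := hL' i; positivity) fun i => le_of_eq (by ring)
    refine mul_le_mul_of_nonneg_left ?_ hC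
    have : (1:ℝ) ≤ 2 ^ (N+1) := one_le_pow₀ (by norm_num)
    nlinarith [hL i]

lemma Bd.of_local (h : ∀ z, ∃ F, F =ᶠ[𝓝 z] f ∧ Bd N A L F) : Bd N A L f := by
  have key : ∀ z, |f z| ≤ A := fun z => by
    obtain ⟨F, h1, h2⟩ := h z
    rw [← h1.eq_of_nhds]; exact h2.le z
  induction N generalizing A f with
  | zero => exact key
  | succ N ih =>
    have h' : ∀ i z, ∃ F, F =ᶠ[𝓝 z] CI.pD i f ∧ Bd N (A * L i) L F := by
      intro i z
      obtain ⟨F, h1, h2⟩ := h z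
      refine ⟨CI.pD i F, ?_, h2.2 i⟩
      exact h1.eventuallyEq_nhds.mono fun y hy => pD_congr hy
    refine ⟨key, fun i => ih (h' i) fun z => ?_⟩
    obtain ⟨F, h1, h2⟩ := h' i z
    rw [← h1.eq_of_nhds]; exact h2.le z

/-- functions of a linear form -/
lemma pD_lin (c : Fin n → ℝ) (d : ℝ) (i : Fin n) :
    CI.pD i (fun z => ∑ a, c a * z a + d) = fun _ => c i := by
  rw [pD_add (Sm.sum fun a _ => (Sm.coord a).cmul _) (Sm.const d), pD_const,
    pD_sum fun a _ => (Sm.coord a).cmul _]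
  funext z
  simp only [pD_cmul _ (Sm.coord _), pD_coord]
  simp

lemma Sm.lin (c : Fin n → ℝ) (d : ℝ) : Sm (fun z => ∑ a, c a * z a + d) :=
  (Sm.sum fun a _ => (Sm.coord a).cmul _).add (Sm.const d)

lemma Bd.lin {g : ℝ → ℝ} {C : ℝ} (hg : ∀ m ≤ N, ∀ s, |iteratedDeriv m g s| ≤ C)
    (sg : ContDiff ℝ ∞ g) (c : Fin n → ℝ) (d : ℝ) (hc : ∀ i, |c i| ≤ L i) :
    Bd N C L (fun z => g (∑ a, c a * z a + d)) := by
  have hL : ∀ i, 0 ≤ L i := fun i => (abs_nonneg _).trans (hc i)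
  induction N generalizing g C with
  | zero => intro z; simpa using hg 0 le_rfl _
  | succ N ih =>
    refine ⟨fun z => by simpa using hg 0 (by omega) _, fun i => ?_⟩
    rw [pD_comp1 sg (Sm.lin c d), pD_lin]
    have sg' : ContDiff ℝ ∞ (deriv g) := by
      have := (contDiff_infty_iff_deriv (𝕜 := ℝ)).1 sg; exact this.2
    have h1 := ih (g := deriv g) (C := C) (fun m hm s => by
      rw [← iteratedDeriv_succ']; exact hg (m+1) (by omega) s) sg'
    have h2 := h1.cmul (c i) (sg'.comp (Sm.lin c d))
    refine (by simpa [mul_comm] using h2 : Bd N (|c i| * C) L _).monoA ?_ hL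
    rw [mul_comm]
    exact mul_le_mul_of_nonneg_left (hc i) h1.nonneg

end bd

/-- bounded derivatives for compactly supported smooth functions of one variable -/
lemma bdd_of_compact {g : ℝ → ℝ} (sg : ContDiff ℝ ∞ g) (hg : HasCompactSupport g) (N : ℕ) :
    ∃ C, 0 ≤ C ∧ ∀ m ≤ N, ∀ s, |iteratedDeriv m g s| ≤ C := by
  have h1 : ∀ m : ℕ, ∃ C, ∀ s, |iteratedDeriv m g s| ≤ C := by
    intro m
    have hc : Continuous (iteratedDeriv m g) :=
      sg.continuous_iteratedDeriv m (by exact_mod_cast le_top)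
    have hs : HasCompactSupport (iteratedDeriv m g) := by
      induction m with
      | zero => simpa using hg
      | succ m ih =>
        rw [iteratedDeriv_succ]
        exact (ih (sg.continuous_iteratedDeriv m (by exact_mod_cast le_top))).deriv
    obtain ⟨C, hC⟩ := hs.exists_bound_of_continuous hc
    exact ⟨C, hC⟩
  choose C hC using h1
  refine ⟨∑ m ∈ Finset.range (N+1), |C m|, Finset.sum_nonneg fun _ _ => abs_nonneg _, fun m hm s => ?_⟩
  exact ((hC m s).trans (le_abs_self _)).trans
    (Finset.single_le_sum (f := fun m => |C m|) (fun _ _ => abs_nonneg _) (by simp; omega))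

/-- smooth, periodic with respect to `P`, vanishing on `U` -/
structure Gd {n : ℕ} (P : Set (Fin n → ℝ)) (U : Set (Fin n → ℝ)) (f : (Fin n → ℝ) → ℝ) : Prop where
  sm : Sm f
  per : ∀ p ∈ P, ∀ z, f (z + p) = f z
  van : ∀ z ∈ U, f z = 0

section gd
variable {n : ℕ} {f g : (Fin n → ℝ) → ℝ} {P U : Set (Fin n → ℝ)}

lemma Gd.add (hf : Gd P U f) (hg : Gd P U g) : Gd P U (fun z => f z + g z) :=
  ⟨hf.sm.add hg.sm, fun p hp z => by rw [hf.per p hp, hg.per p hp],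
    fun z hz => by rw [hf.van z hz, hg.van z hz, add_zero]⟩
lemma Gd.sub (hf : Gd P U f) (hg : Gd P U g) : Gd P U (fun z => f z - g z) :=
  ⟨hf.sm.sub hg.sm, fun p hp z => by rw [hf.per p hp, hg.per p hp],
    fun z hz => by rw [hf.van z hz, hg.van z hz, sub_zero]⟩
lemma Gd.neg (hf : Gd P U f) : Gd P U (fun z => - f z) :=
  ⟨hf.sm.neg, fun p hp z => by rw [hf.per p hp],
    fun z hz => by rw [hf.van z hz, neg_zero]⟩
lemma Gd.cmul (c : ℝ) (hf : Gd P U f) : Gd P U (fun z => c * f z) :=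
  ⟨hf.sm.cmul c, fun p hp z => by rw [hf.per p hp],
    fun z hz => by rw [hf.van z hz, mul_zero]⟩
lemma Gd.mulL (hf : Gd P U f) (hg : Gd P ∅ g) : Gd P U (fun z => f z * g z) :=
  ⟨hf.sm.mul hg.sm, fun p hp z => by rw [hf.per p hp, hg.per p hp],
    fun z hz => by rw [hf.van z hz, zero_mul]⟩
lemma Gd.mulR (hf : Gd P ∅ f) (hg : Gd P U g) : Gd P U (fun z => f z * g z) :=
  ⟨hf.sm.mul hg.sm, fun p hp z => by rw [hf.per p hp, hg.per p hp],
    fun z hz => by rw [hg.van z hz, mul_zero]⟩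
lemma Gd.e (hf : Gd P U f) : Gd P ∅ f := ⟨hf.sm, hf.per, fun _ h => h.elim⟩
lemma Gd.zero : Gd P U (fun _ => 0) := ⟨Sm.const 0, fun _ _ _ => rfl, fun _ _ => rfl⟩
lemma Gd.const (c : ℝ) : Gd P ∅ (fun _ => c) := ⟨Sm.const c, fun _ _ _ => rfl, fun _ h => h.elim⟩
lemma Gd.sum {ι : Type*} {s : Finset ι} {F : ι → (Fin n → ℝ) → ℝ}
    (h : ∀ a ∈ s, Gd P U (F a)) : Gd P U (fun z => ∑ a ∈ s, F a z) :=
  ⟨Sm.sum fun a ha => (h a ha).sm,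
   fun p hp z => Finset.sum_congr rfl fun a ha => (h a ha).per p hp z,
   fun z hz => Finset.sum_eq_zero fun a ha => (h a ha).van z hz⟩
lemma Gd.pD (hf : Gd P U f) (hU : IsOpen U) (i : Fin n) : Gd P U (pD i f) :=
  ⟨hf.sm.pD i, fun p hp z => by
    rw [← congrFun (pD_shift hf.sm p) z]; congr 1; funext y; exact hf.per p hp y,
   pD_zero_of_open hU hf.van⟩
lemma Gd.Kop (hf : Gd P U f) {w : ℝ → ℝ} (hw : Continuous w) {e : Fin n → ℝ}
    (hU : ∀ z ∈ U, ∀ s : ℝ, z + s • e ∈ U) : Gd P U (Kop w e f) :=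
  ⟨hf.sm.Kop hw e, fun p hp z => Kop_periodic (hf.per p hp) z, Kop_vanish hU hf.van⟩
lemma Gd.Pav (hf : Gd P U f) {j : Fin n} (hU : ∀ z ∈ U, ∀ s : ℝ, z + s • ee j ∈ U) :
    Gd P U (Pav j f) := hf.Kop continuous_const hU
lemma Gd.Ian (hf : Gd P U f) {j : Fin n} (hU : ∀ z ∈ U, ∀ s : ℝ, z + s • ee j ∈ U) :
    Gd P U (Ian j f) := hf.Kop (by fun_prop) hU
end gd

end CI

namespace CI
open scoped ContDiff Topology

/-- space-time functions; index `0` is time, `j.succ` the `j`-th space coordinate -/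
abbrev ZF : Type := (Fin 4 → ℝ) → ℝ

def PZ : Set (Fin 4 → ℝ) := Set.range fun j : Fin 3 => ee j.succ
def US (S : Set ℝ) : Set (Fin 4 → ℝ) := {z | z 0 ∈ S}

/-- smooth, `ℤ³`-periodic and vanishing for times in `S` -/
abbrev GZ (S : Set ℝ) (f : ZF) : Prop := Gd PZ (US S) f

lemma US_open {S : Set ℝ} (hS : IsOpen S) : IsOpen (US S) := hS.preimage (continuous_apply 0)
lemma US_inv {S : Set ℝ} (j : Fin 3) : ∀ z ∈ US S, ∀ s : ℝ, z + s • ee j.succ ∈ US S := by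
  intro z hz s
  simpa [US] using hz

section zz
variable {S : Set ℝ} {f g : ZF}

lemma Gd.pr (h : GZ S f) (j : Fin 3) (z) : f (z + ee j.succ) = f z := h.per _ ⟨j, rfl⟩ z
lemma GZ.Px (h : GZ S f) (j : Fin 3) : GZ S (Pav j.succ f) := Gd.Pav h (US_inv j)
lemma GZ.Ix (h : GZ S f) (j : Fin 3) : GZ S (Ian j.succ f) := Gd.Ian h (US_inv j)

def mn (f : ZF) : ZF := Pav (Fin.succ (2 : Fin 3)) (Pav (Fin.succ (1 : Fin 3)) (Pav (Fin.succ (0 : Fin 3)) f))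

lemma Sm.mn (hf : Sm f) : Sm (mn f) := ((hf.Pav _).Pav _).Pav _

lemma mn_pD (hf : Sm f) (i : Fin 4) : mn (pD i f) = pD i (mn f) := by
  unfold CI.mn
  rw [pD_Pav ((hf.Pav _).Pav _), pD_Pav (hf.Pav _), pD_Pav hf]

lemma mn_add (hf : Sm f) (hg : Sm g) : mn (fun z => f z + g z) = fun z => mn f z + mn g z := by
  unfold CI.mn Pav
  have c : Continuous (fun _ : ℝ => (1 : ℝ)) := continuous_const
  rw [Kop_add hf hg c, Kop_add (hf.Kop c _) (hg.Kop c _) c,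
    Kop_add ((hf.Kop c _).Kop c _) ((hg.Kop c _).Kop c _) c]

lemma mn_cmul (c : ℝ) : mn (fun z => c * f z) = fun z => c * mn f z := by
  unfold CI.mn Pav
  rw [Kop_cmul, Kop_cmul, Kop_cmul]

lemma mn_neg : mn (fun z => - f z) = fun z => - mn f z := by
  unfold CI.mn Pav
  rw [Kop_neg, Kop_neg, Kop_neg]

lemma mn_zero : mn (fun _ => 0) = fun _ => 0 := by
  have := mn_cmul (f := fun _ => 0) 0
  simpa using this

lemma mn_sum {ι : Type*} {s : Finset ι} {F : ι → ZF}
    (h : ∀ a ∈ s, Sm (F a)) : mn (fun z => ∑ a ∈ s, F a z) = fun z => ∑ a ∈ s, mn (F a) z := by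
  unfold CI.mn Pav
  have c : Continuous (fun _ : ℝ => (1 : ℝ)) := continuous_const
  rw [Kop_sum h c, Kop_sum (fun a ha => (h a ha).Kop c _) c,
    Kop_sum (fun a ha => ((h a ha).Kop c _).Kop c _) c]

lemma Pav_comm {i j : Fin 4} (hf : Sm f) : Pav i (Pav j f) = Pav j (Pav i f) :=
  Kop_comm hf continuous_const continuous_const

lemma Pav_zero {n : ℕ} (j : Fin n) : Pav j (fun _ => 0) = fun _ => 0 := by
  have := Kop_cmul (w := fun _ => 1) (e := ee j) (f := fun _ => 0) 0
  simpa [Pav] using this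

lemma mn_pDx (hf : GZ S f) (j : Fin 3) : mn (pD j.succ f) = fun _ => 0 := by
  have h0 : Pav j.succ (pD j.succ f) = fun _ => 0 := Pav_pD hf.sm (hf.pr j)
  have hs := hf.sm.pD j.succ
  unfold CI.mn
  fin_cases j <;> simp only [Fin.zero_eta, Fin.mk_one, Fin.reduceFinMk] at h0 hs ⊢
  · rw [h0, Pav_zero, Pav_zero]
  · rw [Pav_comm (i := Fin.succ 1) (j := Fin.succ 0) hs, h0, Pav_zero, Pav_zero]
  · rw [Pav_comm (i := Fin.succ 1) (j := Fin.succ 0) hs,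
      Pav_comm (i := Fin.succ 2) (j := Fin.succ 0) (hs.Pav _),
      Pav_comm (i := Fin.succ 2) (j := Fin.succ 1) hs, h0, Pav_zero, Pav_zero]
end zz

def dl (i j : Fin 3) : ℝ := if i = j then 1 else 0
lemma dl_abs (i j : Fin 3) : |dl i j| ≤ 1 := by unfold dl; split_ifs <;> simp
lemma dl_comm (i j : Fin 3) : dl i j = dl j i := by unfold dl; simp [eq_comm]

abbrev VF : Type := Fin 3 → ZF
abbrev TF : Type := Fin 3 → Fin 3 → ZF

/-- divergence of a tensor field -/
def dv (T : TF) (i : Fin 3) : ZF := fun z => ∑ j : Fin 3, pD j.succ (T i j) z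

lemma dv_add {T T' : TF} (h : ∀ i j, Sm (T i j)) (h' : ∀ i j, Sm (T' i j)) (i) :
    dv (fun i j z => T i j z + T' i j z) i = fun z => dv T i z + dv T' i z := by
  funext z
  simp only [dv, pD_add (h _ _) (h' _ _), Finset.sum_add_distrib]

lemma dv_sub {T T' : TF} (h : ∀ i j, Sm (T i j)) (h' : ∀ i j, Sm (T' i j)) (i) :
    dv (fun i j z => T i j z - T' i j z) i = fun z => dv T i z - dv T' i z := by
  funext z
  simp only [dv, pD_sub (h _ _) (h' _ _), Finset.sum_sub_distrib]

lemma Sm.dv {T : TF} (h : ∀ i j, Sm (T i j)) (i) : Sm (dv T i) := Sm.sum fun j _ => (h i j).pD _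

lemma mn_dv {S : Set ℝ} {T : TF} (h : ∀ i j, GZ S (T i j)) (i) : mn (dv T i) = fun _ => 0 := by
  unfold dv
  rw [mn_sum (fun j _ => (h i j).sm.pD _)]
  simp [mn_pDx (h i _)]

/-- one-directional symmetric antidivergence -/
def Rd (d : Fin 3) (g : VF) : TF := fun i j z =>
  dl j d * Ian d.succ (g i) z + dl i d * Ian d.succ (g j) z
    - (dl i d * dl j d) * Ian d.succ (fun y => ∑ l : Fin 3, pD l.succ (Ian d.succ (g l)) y) z

lemma Rd_symm (d g i j) : Rd d g i j = Rd d g j i := by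
  funext z; unfold Rd; ring

lemma GZ.Rd {S : Set ℝ} (hS : IsOpen S) {g : VF} (hg : ∀ l, GZ S (g l)) (d i j) : GZ S (Rd d g i j) :=
  ((((hg i).Ix d).cmul _).add (((hg j).Ix d).cmul _)).sub
    ((GZ.Ix (Gd.sum fun l _ => ((hg l).Ix d).pD (US_open hS) l.succ) d).cmul _)

lemma sum_dl (d : Fin 3) (F : Fin 3 → ℝ) : ∑ j, dl j d * F j = F d := by
  simp [dl]

lemma dv_Rd {S : Set ℝ} (hS : IsOpen S) {g : VF} (hg : ∀ l, GZ S (g l)) (d i) :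
    dv (Rd d g) i = fun z => g i z - Pav d.succ (g i) z := by
  have hI : ∀ l, GZ S (Ian d.succ (g l)) := fun l => (hg l).Ix d
  have hQ : GZ S (fun y => ∑ l : Fin 3, pD l.succ (Ian d.succ (g l)) y) :=
    Gd.sum fun l _ => (hI l).pD (US_open hS) l.succ
  have hJ := GZ.Ix hQ d
  funext z
  have e1 : ∀ j : Fin 3, pD j.succ (Rd d g i j) z =
      dl j d * pD j.succ (Ian d.succ (g i)) z + dl i d * pD j.succ (Ian d.succ (g j)) z
       - dl i d * (dl j d * pD j.succ (Ian d.succ (fun y => ∑ l : Fin 3, pD l.succ (Ian d.succ (g l)) y)) z) := by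
    intro j
    unfold Rd
    rw [pD_sub (((hI i).sm.cmul _).add ((hI j).sm.cmul _)) (hJ.sm.cmul _),
      pD_add ((hI i).sm.cmul _) ((hI j).sm.cmul _), pD_cmul _ (hI i).sm, pD_cmul _ (hI j).sm,
      pD_cmul _ hJ.sm]
    ring
  have e2 : Pav d.succ (fun y => ∑ l : Fin 3, pD l.succ (Ian d.succ (g l)) y) = fun _ => 0 := by
    unfold Pav
    rw [Kop_sum (fun l _ => (hI l).sm.pD _) continuous_const]
    funext y
    apply Finset.sum_eq_zero
    intro l _
    have : Pav d.succ (pD l.succ (Ian d.succ (g l))) = fun _ => 0 := by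
      rw [← pD_Pav (hI l).sm, Pav_Ian (hg l).sm ((hg l).pr d), pD_const]
    exact congrFun this y
  unfold dv
  simp only [e1, Finset.sum_sub_distrib, Finset.sum_add_distrib, ← Finset.mul_sum, sum_dl]
  rw [pD_Ian_self (hg i).sm ((hg i).pr d), pD_Ian_self hQ.sm (Gd.pr hQ d), e2]
  ring

/-- full antidivergence -/
def Rz (g : VF) : TF := fun i j z =>
  Rd 0 g i j z + Rd 1 (fun l => Pav (Fin.succ (0 : Fin 3)) (g l)) i j z
   + Rd 2 (fun l => Pav (Fin.succ (1 : Fin 3)) (Pav (Fin.succ (0 : Fin 3)) (g l))) i j z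

lemma Rz_symm (g i j) : Rz g i j = Rz g j i := by
  funext z; unfold Rz; rw [Rd_symm 0 g i j, Rd_symm 1 _ i j, Rd_symm 2 _ i j]

lemma GZ.Rz {S : Set ℝ} (hS : IsOpen S) {g : VF} (hg : ∀ l, GZ S (g l)) (i j) : GZ S (Rz g i j) :=
  ((GZ.Rd hS hg 0 i j).add (GZ.Rd hS (fun l => (hg l).Px 0) 1 i j)).add
    (GZ.Rd hS (fun l => ((hg l).Px 0).Px 1) 2 i j)

lemma dv_Rz {S : Set ℝ} (hS : IsOpen S) {g : VF} (hg : ∀ l, GZ S (g l))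
    (hm : ∀ l, mn (g l) = fun _ => 0) (i) : dv (Rz g) i = g i := by
  unfold Rz
  have a0 := fun i j => (GZ.Rd hS hg 0 i j).sm
  have a1 := fun i j => (GZ.Rd hS (fun l => (hg l).Px 0) 1 i j).sm
  have a2 := fun i j => (GZ.Rd hS (fun l => ((hg l).Px 0).Px 1) 2 i j).sm
  rw [dv_add (fun i j => (a0 i j).add (a1 i j)) a2, dv_add a0 a1,
    dv_Rd hS hg, dv_Rd hS (fun l => (hg l).Px 0), dv_Rd hS (fun l => ((hg l).Px 0).Px 1)]
  funext z
  have := congrFun (hm i) z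
  unfold mn at this
  simp only [this]
  ring

section bnd
variable {N : ℕ} {A Λ : ℝ} {L : Fin 4 → ℝ}

lemma Bd.Rd {g : VF} (hg : ∀ l, Sm (g l)) (hb : ∀ l, Bd (N+1) A L (g l)) (hL : ∀ i, 0 ≤ L i)
    (hΛ : ∀ j : Fin 3, L j.succ ≤ Λ) (h1 : 1 ≤ Λ) (d i j) : Bd N (5 * A * Λ) L (Rd d g i j) := by
  have hA := (hb 0).nonneg
  have hI : ∀ l, Sm (CI.Ian d.succ (g l)) := fun l => (hg l).Ian _
  have bI : ∀ l, Bd (N+1) A L (CI.Ian d.succ (g l)) := fun l => (hb l).Ian (hg l) _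
  have sQ : Sm (fun y => ∑ l : Fin 3, CI.pD l.succ (CI.Ian d.succ (g l)) y) := Sm.sum fun l _ => (hI l).pD _
  have bQ : Bd N (∑ l : Fin 3, A * L l.succ) L
      (fun y => ∑ l : Fin 3, CI.pD l.succ (CI.Ian d.succ (g l)) y) :=
    Bd.sum (fun l _ => (bI l).pD _) (fun l _ => (hI l).pD _) hL
  have t1 : ∀ (c : ℝ) (l : Fin 3), |c| ≤ 1 → Bd N A L (fun z => c * CI.Ian d.succ (g l) z) :=
    fun c l hc => ((bI l).down.cmul c (hI l)).monoA (by nlinarith [abs_nonneg c]) hL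
  have hs : ∑ l : Fin 3, A * L l.succ ≤ 3 * A * Λ := by
    have : ∑ l : Fin 3, A * L l.succ ≤ ∑ l : Fin 3, A * Λ :=
      Finset.sum_le_sum fun l _ => mul_le_mul_of_nonneg_left (hΛ l) hA
    simpa [mul_assoc] using this
  have hc : |dl i d * dl j d| ≤ 1 := by
    rw [abs_mul]; exact mul_le_one₀ (dl_abs _ _) (abs_nonneg _) (dl_abs _ _)
  have t2 := ((bQ.monoA hs hL).Ian sQ d.succ).cmul (dl i d * dl j d) (sQ.Ian _)
  refine (((t1 (dl j d) i (dl_abs _ _)).add (t1 (dl i d) j (dl_abs _ _)) ((hI i).cmul _) ((hI j).cmul _)).sub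
    t2 (((hI i).cmul _).add ((hI j).cmul _)) ((sQ.Ian _).cmul _)).monoA ?_ hL
  have h3 : 0 ≤ 3 * A * Λ := by positivity
  nlinarith [abs_nonneg (dl i d * dl j d)]

lemma Bd.Rz {g : VF} (hg : ∀ l, Sm (g l)) (hb : ∀ l, Bd (N+1) A L (g l)) (hL : ∀ i, 0 ≤ L i)
    (hΛ : ∀ j : Fin 3, L j.succ ≤ Λ) (h1 : 1 ≤ Λ) (i j) : Bd N (15 * A * Λ) L (Rz g i j) := by
  have sR : ∀ (g : VF) (hg : ∀ l, Sm (g l)) d, Sm (CI.Rd d g i j) := fun g hg d =>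
    (((hg i).Ian _).cmul _).add (((hg j).Ian _).cmul _) |>.sub
      ((Sm.Ian (Sm.sum fun l _ => ((hg l).Ian _).pD _) _).cmul _)
  have b0 := Bd.Rd hg hb hL hΛ h1 0 i j
  have b1 := Bd.Rd (fun l => (hg l).Pav (Fin.succ (0 : Fin 3))) (fun l => (hb l).Pav (hg l) _) hL hΛ h1 1 i j
  have b2 := Bd.Rd (fun l => ((hg l).Pav (Fin.succ (0 : Fin 3))).Pav (Fin.succ (1 : Fin 3)))
    (fun l => ((hb l).Pav (hg l) _).Pav ((hg l).Pav _) _) hL hΛ h1 2 i j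
  refine (((b0.add b1 (sR _ hg _) (sR _ (fun l => (hg l).Pav _) _)).add b2 ((sR _ hg _).add (sR _ (fun l => (hg l).Pav _) _))
    (sR _ (fun l => ((hg l).Pav _).Pav _) _))).monoA (by linarith) hL
end bnd

end CI

namespace CI
open scoped ContDiff Topology

/-- Steklov average -/
def St (l : ℝ) (i : Fin 4) (f : ZF) : ZF := Kop (fun _ => 1) (l • ee i) f
def Sq (l : ℝ) (f : ZF) : ZF := St l 0 (St l 1 (St l 2 (St l 3 f)))
def mol (N : ℕ) (l : ℝ) (f : ZF) : ZF := (Sq l)^[N] f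

section st
variable {f g : ZF} {l A Λ : ℝ} {L : Fin 4 → ℝ} {N : ℕ}

lemma Sm.St (hf : Sm f) (l i) : Sm (St l i f) := hf.Kop continuous_const _
lemma Sm.Sq (hf : Sm f) (l) : Sm (Sq l f) := (((hf.St l 3).St l 2).St l 1).St l 0
lemma mol_succ : mol (N+1) l f = Sq l (mol N l f) := Function.iterate_succ_apply' _ _ _
lemma Sm.mol (hf : Sm f) (N l) : Sm (mol N l f) := by
  induction N with
  | zero => exact hf
  | succ N ih => rw [mol_succ]; exact ih.Sq l

lemma pD_St (hf : Sm f) (i j) : pD i (St l j f) = St l j (pD i f) := pD_Kop hf continuous_const _ _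
lemma pD_Sq (hf : Sm f) (i) : pD i (Sq l f) = Sq l (pD i f) := by
  unfold Sq
  rw [pD_St (((hf.St l 3).St l 2).St l 1), pD_St ((hf.St l 3).St l 2), pD_St (hf.St l 3), pD_St hf]
lemma pD_mol (hf : Sm f) (i) : pD i (mol N l f) = mol N l (pD i f) := by
  induction N with
  | zero => rfl
  | succ N ih => rw [mol_succ, mol_succ, pD_Sq (hf.mol N l), ih]

lemma Bd.St (hf : Bd N A L f) (sf : Sm f) (i) : Bd N A L (St l i f) :=
  hf.Kop continuous_const (by simp) sf _
lemma Bd.Sq (hf : Bd N A L f) (sf : Sm f) : Bd N A L (Sq l f) :=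
  (((hf.St sf 3).St (sf.St _ _) 2).St ((sf.St _ _).St _ _) 1).St (((sf.St _ _).St _ _).St _ _) 0
lemma Bd.mol (hf : Bd N A L f) (sf : Sm f) (M : ℕ) : Bd N A L (mol M l f) := by
  induction M with
  | zero => exact hf
  | succ M ih => rw [mol_succ]; exact ih.Sq (sf.mol _ _)

lemma Bd.shift (hf : Bd N A L f) (sf : Sm f) (e : Fin 4 → ℝ) : Bd N A L (fun z => f (z + e)) := by
  induction N generalizing f A with
  | zero => exact fun z => hf _
  | succ N ih =>
    refine ⟨fun z => hf.1 _, fun i => ?_⟩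
    rw [pD_shift sf]
    exact ih (hf.2 i) (sf.pD i)

lemma pD_St_self (sf : Sm f) (hl : 0 < l) (i) :
    pD i (St l i f) = fun z => l⁻¹ * (f (z + l • ee i) - f z) := by
  funext z
  rw [pD_St sf]
  have := Kop_fderiv (e := l • ee i) sf z
  have h2 : ∀ s : ℝ, fderiv ℝ f (z + s • (l • ee i)) (l • ee i) = l * pD i f (z + s • (l • ee i)) := by
    intro s; rw [map_smul]; rfl
  simp only [h2] at this
  rw [intervalIntegral.integral_const_mul] at this
  rw [← this]
  simp only [St, Kop, one_mul]
  field_simp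

lemma Bd.St_self (hf : Bd N A (fun _ => 2 / l) f) (sf : Sm f) (hl : 0 < l) (i) :
    Bd N (A * (2 / l)) (fun _ => 2 / l) (CI.pD i (CI.St l i f)) := by
  have h0 : ∀ _ : Fin 4, 0 ≤ 2 / l := fun _ => by positivity
  rw [pD_St_self sf hl]
  refine (((hf.shift sf (l • ee i)).sub hf (sf.shift _) sf).cmul l⁻¹ ((sf.shift _).sub sf)).monoA ?_ h0
  rw [abs_of_pos (inv_pos.2 hl)]
  apply le_of_eq; field_simp; ring

lemma Bd.Sq_gain (hf : Bd N A (fun _ => 2 / l) f) (sf : Sm f) (hl : 0 < l) :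
    Bd (N+1) A (fun _ => 2 / l) (CI.Sq l f) := by
  have h0 : ∀ _ : Fin 4, 0 ≤ 2 / l := fun _ => by positivity
  refine ⟨(hf.Sq sf).le, fun i => ?_⟩
  unfold CI.Sq
  have s3 := sf.St l 3
  have s2 := s3.St l 2
  have s1 := s2.St l 1
  have b3 : Bd N A (fun _ => 2 / l) (CI.St l 3 f) := hf.St sf 3
  have b2 : Bd N A (fun _ => 2 / l) (CI.St l 2 (CI.St l 3 f)) := b3.St s3 2
  have b1 : Bd N A (fun _ => 2 / l) (CI.St l 1 (CI.St l 2 (CI.St l 3 f))) := b2.St s2 1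
  fin_cases i <;> simp only [Fin.zero_eta, Fin.mk_one, Fin.reduceFinMk]
  · exact b1.St_self s1 hl 0
  · rw [pD_St s1]; exact (b2.St_self s2 hl 1).St (s1.pD _) 0
  · rw [pD_St s1, pD_St s2]; exact ((b3.St_self s3 hl 2).St (s2.pD _) 1).St ((s2.pD _).St _ _) 0
  · rw [pD_St s1, pD_St s2, pD_St s3]
    exact (((hf.St_self sf hl 3).St (s3.pD _) 2).St ((s3.pD _).St _ _) 1).St (((s3.pD _).St _ _).St _ _) 0

/-- mollified functions have all bounds -/
lemma Bd.mol_gain (hf : ∀ z, |f z| ≤ A) (sf : Sm f) (hl : 0 < l) (N : ℕ) :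
    Bd N A (fun _ => 2 / l) (CI.mol N l f) := by
  induction N with
  | zero => exact hf
  | succ N ih => rw [mol_succ]; exact ih.Sq_gain (sf.mol _ _) hl

lemma St_err (sf : Sm f) (hl : 0 ≤ l) (i) (hΛ : ∀ z, |pD i f z| ≤ Λ) (z) : |St l i f z - f z| ≤ l * Λ := by
  have hL : 0 ≤ Λ := (abs_nonneg _).trans (hΛ 0)
  have e : St l i f z - f z = ∫ s in (0:ℝ)..1, (f (z + s • (l • ee i)) - f z) := by
    unfold St Kop
    rw [intervalIntegral.integral_sub]
    · simp
    · have := Sm.ii sf (continuous_const (y := (1:ℝ))) z (l • ee i); simpa using this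
    · simp
  rw [e, ← Real.norm_eq_abs]
  have := intervalIntegral.norm_integral_le_of_norm_le_const (a := (0:ℝ)) (b := 1) (C := l * Λ)
    (f := fun s => f (z + s • (l • ee i)) - f z) ?_
  · simpa using this
  intro s hs
  rw [Set.uIoc_of_le zero_le_one] at hs
  rw [← Kop_fderiv (e := s • (l • ee i)) sf z, Real.norm_eq_abs, ← Real.norm_eq_abs]
  have h3 := intervalIntegral.norm_integral_le_of_norm_le_const (a := (0:ℝ)) (b := 1) (C := l * Λ)
    (f := fun r => fderiv ℝ f (z + r • s • l • ee i) (s • l • ee i)) ?_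
  · simpa using h3
  intro r _
  rw [map_smul, map_smul, norm_smul, norm_smul, Real.norm_of_nonneg hs.1.le, Real.norm_of_nonneg hl]
  have := hΛ (z + r • s • l • ee i)
  unfold pD at this
  rw [Real.norm_eq_abs]
  calc s * (l * _) ≤ 1 * (l * Λ) := by
        apply mul_le_mul hs.2 (mul_le_mul_of_nonneg_left this hl) (by positivity) (by norm_num)
    _ = _ := one_mul _

lemma Sq_err (sf : Sm f) (hl : 0 ≤ l) (hΛ : ∀ i z, |pD i f z| ≤ Λ) (z) : |Sq l f z - f z| ≤ 4 * l * Λ := by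
  have s3 := sf.St l 3
  have s2 := s3.St l 2
  have s1 := s2.St l 1
  have p3 : ∀ i z, |pD i (St l 3 f) z| ≤ Λ := fun i z => by
    rw [pD_St sf]; exact Kop_bound (by simp) (hΛ i) z
  have p2 : ∀ i z, |pD i (St l 2 (St l 3 f)) z| ≤ Λ := fun i z => by
    rw [pD_St s3]; exact Kop_bound (by simp) (p3 i) z
  have p1 : ∀ i z, |pD i (St l 1 (St l 2 (St l 3 f))) z| ≤ Λ := fun i z => by
    rw [pD_St s2]; exact Kop_bound (by simp) (p2 i) z
  have e0 := abs_le.1 (St_err s1 hl 0 (p1 0) z)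
  have e1 := abs_le.1 (St_err s2 hl 1 (p2 1) z)
  have e2 := abs_le.1 (St_err s3 hl 2 (p3 2) z)
  have e3 := abs_le.1 (St_err sf hl 3 (hΛ 3) z)
  unfold Sq
  rw [abs_le]
  constructor <;> linarith [e0.1, e0.2, e1.1, e1.2, e2.1, e2.2, e3.1, e3.2]

lemma Kop_pDle (sf : Sm f) (hΛ : ∀ i z, |pD i f z| ≤ Λ) (N : ℕ) (i z) : |pD i (mol N l f) z| ≤ Λ := by
  rw [pD_mol sf]
  exact (Bd.mol (N := 0) (L := fun _ => 0) (show Bd 0 Λ (fun _ => 0) (pD i f) from hΛ i) (sf.pD i) N) z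

lemma mol_err (sf : Sm f) (hl : 0 ≤ l) (hΛ : ∀ i z, |pD i f z| ≤ Λ) (N : ℕ) (z) :
    |mol N l f z - f z| ≤ 4 * N * l * Λ := by
  induction N with
  | zero => simp [mol]
  | succ N ih =>
    rw [mol_succ]
    have h1 := abs_le.1 (Sq_err (sf.mol N l) hl (Kop_pDle sf hΛ N) z)
    have h2 := abs_le.1 ih
    push_cast
    rw [abs_le]
    constructor <;> nlinarith [h1.1, h1.2, h2.1, h2.2]

lemma mol_sum {ι : Type*} {s : Finset ι} {F : ι → ZF} (h : ∀ a ∈ s, Sm (F a)) :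
    mol N l (fun z => ∑ a ∈ s, F a z) = fun z => ∑ a ∈ s, mol N l (F a) z := by
  induction N with
  | zero => rfl
  | succ N ih =>
    rw [mol_succ, ih]
    simp only [mol_succ]
    have c : Continuous (fun _ : ℝ => (1 : ℝ)) := continuous_const
    unfold Sq St
    rw [Kop_sum (fun a ha => (h a ha).mol N l) c, Kop_sum (fun a ha => ((h a ha).mol N l).Kop c _) c,
      Kop_sum (fun a ha => (((h a ha).mol N l).Kop c _).Kop c _) c,
      Kop_sum (fun a ha => ((((h a ha).mol N l).Kop c _).Kop c _).Kop c _) c]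

lemma mol_zero : mol N l (fun _ => 0) = fun _ => 0 := by
  have := mol_sum (N := N) (l := l) (s := (∅ : Finset ℕ)) (F := fun _ _ => 0) (by simp)
  simpa using this

lemma GZ.St {S : Set ℝ} (h : GZ S f) (j : Fin 3) : GZ S (CI.St l j.succ f) := by
  apply Gd.Kop h continuous_const
  intro z hz s
  rw [smul_smul]
  exact US_inv j z hz _

lemma GZ.St0 {S S' : Set ℝ} (h : GZ S f) (hl : 0 ≤ l) (hS : ∀ t ∈ S', ∀ s ∈ Set.Icc 0 l, t + s ∈ S) :
    GZ S' (CI.St l 0 f) := by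
  refine ⟨h.sm.St _ _, fun p hp z => Kop_periodic (h.per p hp) z, fun z hz => ?_⟩
  unfold CI.St CI.Kop
  rw [intervalIntegral.integral_congr (g := fun _ => 0)]
  · simp
  intro s hs
  rw [Set.uIcc_of_le zero_le_one] at hs
  simp only [one_mul]
  apply h.van
  simp only [US, Set.mem_setOf_eq, Pi.add_apply, Pi.smul_apply, Pi.single_eq_same, smul_eq_mul, mul_one]
  exact hS _ hz _ ⟨mul_nonneg hs.1 hl, by nlinarith [hs.2]⟩

lemma GZ.mol {S S' : Set ℝ} (h : GZ S f) (hl : 0 ≤ l) (hS : ∀ t ∈ S', ∀ s ∈ Set.Icc 0 (N * l), t + s ∈ S) :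
    GZ S' (CI.mol N l f) := by
  induction N generalizing S' with
  | zero =>
    exact ⟨h.sm, h.per, fun z hz => h.van z (by have := hS (z 0) hz 0 (by simp); simpa [US] using this)⟩
  | succ N ih =>
    rw [mol_succ]
    unfold CI.Sq
    have h1 := ih (S' := {t | ∀ s ∈ Set.Icc 0 (N * l), t + s ∈ S}) (fun t ht => ht)
    refine GZ.St0 (GZ.St (j := 0) (GZ.St (j := 1) (GZ.St (j := 2) h1))) hl ?_
    intro t ht s hs r hr
    rw [add_assoc]
    refine hS t ht _ ⟨add_nonneg hs.1 hr.1, ?_⟩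
    push_cast
    linarith [hs.2, hr.2]
end st
end CI

namespace CI
open scoped ContDiff Topology

/-- functions of a fast variable (index 0), time (1) and space -/
abbrev YF : Type := (Fin 5 → ℝ) → ℝ

def PY : Set (Fin 5 → ℝ) := {p | p = ee 0 ∨ ∃ j : Fin 3, p = ee j.succ.succ}
def UY (S : Set ℝ) : Set (Fin 5 → ℝ) := {z | z 1 ∈ S}
abbrev GY (S : Set ℝ) (f : YF) : Prop := Gd PY (UY S) f

lemma UY_open {S : Set ℝ} (hS : IsOpen S) : IsOpen (UY S) := hS.preimage (continuous_apply 1)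
lemma UY_inv {S : Set ℝ} : ∀ z ∈ UY S, ∀ s : ℝ, z + s • ee 0 ∈ UY S := by
  intro z hz s
  simpa [UY] using hz

/-- restriction to `θ = lam * x_k` -/
def rs (lam : ℝ) (k : Fin 3) (u : YF) : ZF := fun z => u (fun a => (Fin.cons (lam * z k.succ) z : Fin 5 → ℝ) a)
/-- lift -/
def lf (f : ZF) : YF := fun y => f (fun i => y i.succ)

section hf
variable {lam : ℝ} {k : Fin 3} {u w : YF} {f : ZF} {S : Set ℝ} {N : ℕ} {A B : ℝ}

lemma Sm.rsφ (lam : ℝ) (k : Fin 3) (a : Fin 5) :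
    Sm (fun z : Fin 4 → ℝ => (Fin.cons (lam * z k.succ) z : Fin 5 → ℝ) a) := by
  refine Fin.cases ?_ (fun i => ?_) a
  · simpa using (Sm.coord k.succ).cmul lam
  · simpa using Sm.coord i
lemma Sm.rs (hu : Sm u) (lam k) : Sm (rs lam k u) := hu.comp' (Sm.rsφ lam k)
lemma Sm.lf (hf : Sm f) : Sm (lf f) := hf.comp' (fun a => Sm.coord _)
lemma rs_lf : rs lam k (lf f) = f := by
  funext z; simp [rs, lf]
lemma pD_lf0 (hf : Sm f) : pD 0 (lf f) = fun _ => 0 := by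
  unfold lf
  rw [pD_comp hf (fun a => Sm.coord _)]
  funext y
  refine Finset.sum_eq_zero fun x _ => ?_
  rw [pD_coord, if_neg (Fin.succ_ne_zero x).symm, mul_zero]
lemma pD_lf (hf : Sm f) (i : Fin 4) : pD i.succ (lf f) = lf (pD i f) := by
  unfold lf
  rw [pD_comp hf (fun a => Sm.coord _)]
  funext y
  simp [pD_coord]

lemma pD_rs (hu : Sm u) (i : Fin 4) : pD i (rs lam k u) =
    fun z => rs lam k (pD i.succ u) z + (if i = k.succ then lam else 0) * rs lam k (pD 0 u) z := by
  unfold rs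
  rw [pD_comp hu (Sm.rsφ lam k)]
  funext z
  rw [Fin.sum_univ_succ]
  have h0 : pD i (fun z : Fin 4 → ℝ => (Fin.cons (lam * z k.succ) z : Fin 5 → ℝ) 0) z = if i = k.succ then lam else 0 := by
    simp only [Fin.cons_zero]
    rw [pD_cmul _ (Sm.coord _), pD_coord]
    simp
  have h1 : ∀ a : Fin 4, pD i (fun z : Fin 4 → ℝ => (Fin.cons (lam * z k.succ) z : Fin 5 → ℝ) a.succ) z
      = if i = a then 1 else 0 := by
    intro a
    simp only [Fin.cons_succ]
    rw [pD_coord]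
  rw [h0]
  simp only [h1]
  simp
  ring

lemma Bd.rs {L : Fin 5 → ℝ} {L' : Fin 4 → ℝ} (hl : 0 ≤ lam) (hu : Bd N A L u) (su : Sm u) (hL : ∀ i, 0 ≤ L i)
    (hL' : ∀ i : Fin 4, L i.succ + lam * L 0 ≤ L' i) : Bd N A L' (rs lam k u) := by
  have hL0 : ∀ i, 0 ≤ L' i := fun i => le_trans (by have := hL i.succ; have := hL 0; positivity) (hL' i)
  induction N generalizing u A with
  | zero => exact fun z => hu _
  | succ N ih =>
    refine ⟨fun z => hu.1 _, fun i => ?_⟩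
    rw [pD_rs su]
    have hA := hu.nonneg
    have h1 := ih (hu.2 i.succ) (su.pD _)
    have h2 := (ih (hu.2 0) (su.pD _)).cmul (if i = k.succ then lam else 0) ((su.pD 0).rs lam k)
    refine (h1.add h2 ((su.pD _).rs lam k) (((su.pD 0).rs lam k).cmul _)).monoA ?_ hL0
    have h3 : |if i = k.succ then lam else 0| ≤ lam := by
      split_ifs
      · rw [abs_of_nonneg hl]
      · simpa using hl
    have h4 : |if i = k.succ then lam else 0| * (A * L 0) ≤ lam * (A * L 0) :=
      mul_le_mul_of_nonneg_right h3 (mul_nonneg hA (hL 0))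
    nlinarith [mul_le_mul_of_nonneg_left (hL' i) hA]

lemma Bd.lf {L : Fin 5 → ℝ} (hf : Bd N A (fun i => L i.succ) f) (sf : Sm f) (hL : ∀ i, 0 ≤ L i) :
    Bd N A L (lf f) := by
  induction N generalizing f A with
  | zero => exact fun z => hf _
  | succ N ih =>
    refine ⟨fun z => hf.1 _, fun i => ?_⟩
    refine Fin.cases ?_ (fun i => ?_) i
    · rw [pD_lf0 sf]; exact Bd.zero (mul_nonneg hf.nonneg (hL _)) hL
    · rw [pD_lf sf]; exact ih (hf.2 i) (sf.pD i)

lemma per_nat {n : ℕ} {f : (Fin n → ℝ) → ℝ} {p : Fin n → ℝ} (h : ∀ z, f (z + p) = f z) (m : ℕ) (z) :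
    f (z + (m : ℝ) • p) = f z := by
  induction m with
  | zero => simp
  | succ m ih => rw [Nat.cast_succ, add_smul, one_smul, ← add_assoc, h, ih]

lemma GZ.rs {m : ℕ} (hu : GY S u) (k : Fin 3) : GZ S (rs (m : ℝ) k u) := by
  refine ⟨hu.sm.rs _ _, ?_, ?_⟩
  · rintro p ⟨j, rfl⟩ z
    simp only [CI.rs]
    have e : (fun a => (Fin.cons ((m:ℝ) * (z + ee j.succ) k.succ) (z + ee j.succ) : Fin 5 → ℝ) a)
       = ((Fin.cons ((m:ℝ) * z k.succ) z : Fin 5 → ℝ) + ((if j = k then m else 0 : ℕ) : ℝ) • ee 0) + ee j.succ.succ := by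
      funext a
      refine Fin.cases ?_ (fun i => ?_) a
      · by_cases h : j = k
        · subst h; simp; ring
        · have h' : k ≠ j := fun e => h e.symm
          simp [h, Pi.single_apply, h']
      · have h0 : (ee 0 : Fin 5 → ℝ) i.succ = 0 := by simp
        simp only [Fin.cons_succ, Pi.add_apply, Pi.smul_apply, h0]
        simp [Pi.single_apply]
    rw [e, hu.per _ (Or.inr ⟨j, rfl⟩), per_nat (hu.per _ (Or.inl rfl))]
  · intro z hz
    exact hu.van _ (by simpa [UY, US] using hz)

lemma GY.lf (hf : GZ S f) : GY S (lf f) := by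
  refine ⟨hf.sm.lf, ?_, fun y hy => hf.van _ (by simpa [UY, US] using hy)⟩
  rintro p (rfl | ⟨j, rfl⟩) y
  · unfold CI.lf; congr 1; funext i; simp
  · have := hf.pr j (fun i => y i.succ)
    unfold CI.lf
    rw [← this]
    congr 1; funext i
    simp [Pi.single_apply]

lemma Gd.pθ (h : GY S u) (z) : u (z + ee 0) = u z := h.per _ (Or.inl rfl) z
lemma GY.I (h : GY S u) : GY S (Ian 0 u) := Gd.Ian h UY_inv

/-- divergence in the slow space variables -/
def dY (T : Fin 3 → Fin 3 → YF) (i : Fin 3) : YF := fun y => ∑ j : Fin 3, pD j.succ.succ (T i j) y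

def Ay (k : Fin 3) (f : Fin 3 → YF) : Fin 3 → Fin 3 → YF := fun i j y =>
  dl j k * f i y + dl i k * f j y - (dl i k * dl j k) * f k y

lemma Ay_symm (k f i j) : Ay k f i j = Ay k f j i := by funext y; unfold Ay; ring

lemma GY.Ay {f : Fin 3 → YF} (hf : ∀ i, GY S (f i)) (k i j) : GY S (Ay k f i j) :=
  (((hf i).cmul _).add ((hf j).cmul _)).sub ((hf k).cmul _)

lemma Bd.Ay {L : Fin 5 → ℝ} {f : Fin 3 → YF} (hf : ∀ i, Bd N A L (f i)) (sf : ∀ i, Sm (f i))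
    (hL : ∀ i, 0 ≤ L i) (k i j) : Bd N (3 * A) L (Ay k f i j) := by
  have hA := (hf 0).nonneg
  have t : ∀ c l, |c| ≤ 1 → Bd N A L (fun y => c * f l y) := fun c l hc =>
    ((hf l).cmul c (sf l)).monoA (by nlinarith [abs_nonneg c]) hL
  have hc : |dl i k * dl j k| ≤ 1 := by
    rw [abs_mul]; exact mul_le_one₀ (dl_abs _ _) (abs_nonneg _) (dl_abs _ _)
  exact (((t _ i (dl_abs j k)).add (t _ j (dl_abs i k)) ((sf _).cmul _) ((sf _).cmul _)).sub (t _ k hc)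
    (((sf _).cmul _).add ((sf _).cmul _)) ((sf _).cmul _)).monoA (by linarith) hL

lemma rs_add : rs lam k (fun y => u y + w y) = fun z => rs lam k u z + rs lam k w z := rfl

lemma dv_rs {T : Fin 3 → Fin 3 → YF} (hT : ∀ i j, Sm (T i j)) (i) :
    dv (fun i j => rs lam k (T i j)) i = fun z => rs lam k (dY T i) z + lam * rs lam k (pD 0 (T i k)) z := by
  funext z
  unfold dv
  simp only [pD_rs (hT i _), Finset.sum_add_distrib]
  congr 1
  simp [Fin.succ_inj]

lemma HF {L : Fin 5 → ℝ} {Λ : ℝ} (hS : IsOpen S) (hL : ∀ i, 0 ≤ L i) (hΛ : ∀ j : Fin 3, L j.succ.succ ≤ Λ)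
    (hlam : 0 < lam) (h9 : 9 * Λ / lam ≤ 1 / 2) (k : Fin 3) (r : ℕ) :
    ∀ (f : Fin 3 → YF) (B : ℝ), (∀ i, GY S (f i)) → (∀ i, Pav 0 (f i) = fun _ => 0) →
      (∀ i, Bd (N + r) B L (f i)) →
    ∃ (T : Fin 3 → Fin 3 → YF) (h : Fin 3 → YF), (∀ i j, GY S (T i j)) ∧ (∀ i j, T i j = T j i) ∧
      (∀ i, GY S (h i)) ∧ (∀ i j, Bd N (6 * B / lam) L (T i j)) ∧ (∀ i, Bd N (B * (9 * Λ / lam) ^ r) L (h i)) ∧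
      ∀ i, rs lam k (f i) = fun z => dv (fun i j => rs lam k (T i j)) i z + rs lam k (h i) z := by
  have hΛ0 : 0 ≤ Λ := (hL _).trans (hΛ 0)
  have hq : 0 ≤ 9 * Λ / lam := by positivity
  induction r with
  | zero =>
    intro f B hf hm hb
    have hB := (hb 0).nonneg
    refine ⟨fun _ _ _ => 0, f, fun _ _ => Gd.zero, fun _ _ => rfl, hf, fun _ _ => Bd.zero (by positivity) hL,
      fun i => by simpa using hb i, fun i => ?_⟩
    funext z
    have : rs lam k (fun _ => (0:ℝ)) = fun _ => 0 := rfl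
    simp [dv, this, pD_const]
  | succ r ih =>
    intro f B hf hm hb
    have hB := (hb 0).nonneg
    have hI := fun i => GY.I (hf i)
    have bI : ∀ i, Bd (N + r + 1) B L (Ian 0 (f i)) := fun i => (hb i).Ian (hf i).sm 0
    have hA := fun i j => GY.Ay hI k i j
    have bA := fun i j => Bd.Ay bI (fun i => (hI i).sm) hL k i j
    set AA := CI.Ay k (fun i => Ian 0 (f i)) with hAA
    have hd : ∀ i, GY S (fun y => -lam⁻¹ * dY AA i y) := fun i =>
      Gd.cmul _ (Gd.sum fun j _ => (hA i j).pD (UY_open hS) _)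
    have bd : ∀ i, Bd (N + r) (B * (9 * Λ / lam)) L (fun y => -lam⁻¹ * dY AA i y) := by
      intro i
      have h1 : Bd (N + r) (∑ j : Fin 3, 3 * B * L j.succ.succ) L (dY AA i) :=
        Bd.sum (fun j _ => (bA i j).pD _) (fun j _ => (hA i j).sm.pD _) hL
      refine (h1.cmul _ (Sm.sum fun j _ => (hA i j).sm.pD _)).monoA ?_ hL
      have : ∑ j : Fin 3, 3 * B * L j.succ.succ ≤ ∑ j : Fin 3, 3 * B * Λ :=
        Finset.sum_le_sum fun j _ => mul_le_mul_of_nonneg_left (hΛ j) (by positivity)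
      rw [abs_neg, abs_of_pos (inv_pos.2 hlam)]
      calc lam⁻¹ * _ ≤ lam⁻¹ * (∑ j : Fin 3, 3 * B * Λ) := by gcongr
        _ = _ := by simp; field_simp; ring
    have hmd : ∀ i, Pav 0 (fun y => -lam⁻¹ * dY AA i y) = fun _ => 0 := by
      intro i
      have hz : ∀ j, Pav 0 (AA i j) = fun _ => 0 := by
        intro j
        have h0 : ∀ l, Pav 0 (Ian 0 (f l)) = fun _ => 0 := fun l => Pav_Ian (hf l).sm (hf l).pθ
        rw [hAA]
        unfold CI.Ay
        unfold Pav at h0 ⊢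
        have c : Continuous (fun _ : ℝ => (1:ℝ)) := continuous_const
        rw [Kop_sub (((hI i).sm.cmul _).add ((hI j).sm.cmul _)) ((hI k).sm.cmul _) c,
          Kop_add ((hI i).sm.cmul _) ((hI j).sm.cmul _) c, Kop_cmul, Kop_cmul, Kop_cmul]
        simp [h0]
      unfold Pav dY
      rw [Kop_cmul, Kop_sum (fun j _ => (hA i j).sm.pD _) continuous_const]
      funext y
      have : ∀ j : Fin 3, Kop (fun _ => 1) (ee 0) (pD j.succ.succ (AA i j)) y = 0 := by
        intro j
        have h1 : Pav 0 (pD j.succ.succ (AA i j)) y = 0 := by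
          rw [← pD_Pav (hA i j).sm, hz, pD_const]
        exact h1
      simp [this]
    obtain ⟨T, h, hT, Ts, hh, bT, bh, he⟩ := ih _ _ hd hmd bd
    refine ⟨fun i j y => lam⁻¹ * AA i j y + T i j y, h, fun i j => ((hA i j).cmul _).add (hT i j), ?_, hh, ?_, ?_, ?_⟩
    · intro i j
      funext y
      simp only [Ts i j, hAA, Ay_symm k _ i j]
    · intro i j
      have h1 := ((bA i j).ord (show N ≤ N + r + 1 by omega)).cmul lam⁻¹ (hA i j).sm
      refine (h1.add (bT i j) ((hA i j).sm.cmul _) (hT i j).sm).monoA ?_ hL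
      rw [abs_of_pos (inv_pos.2 hlam)]
      have h2 : 6 * (B * (9 * Λ / lam)) / lam ≤ 6 * (B * (1/2)) / lam := by gcongr
      calc _ ≤ lam⁻¹ * (3 * B) + 6 * (B * (1/2)) / lam := by linarith
        _ = _ := by field_simp; ring
    · intro i
      have := bh i
      rw [pow_succ]
      rwa [show B * ((9 * Λ / lam) ^ r * (9 * Λ / lam)) = B * (9 * Λ / lam) * (9 * Λ / lam) ^ r by ring]
    · intro i
      have e0 : AA i k = Ian 0 (f i) := by
        funext y; rw [hAA]; unfold CI.Ay; simp [dl]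
      have e1 := dv_add (T := fun i j => rs lam k (fun y => lam⁻¹ * AA i j y)) (T' := fun i j => rs lam k (T i j))
        (fun i j => (((hA i j).cmul _).sm.rs _ _)) (fun i j => (hT i j).sm.rs _ _) i
      funext z
      have e2 : dv (fun i j => rs lam k (fun y => lam⁻¹ * AA i j y + T i j y)) i z = _ := congrFun e1 z
      rw [e2, dv_rs (fun i j => ((hA i j).cmul _).sm)]
      have e3 := congrFun (he i) z
      have e4 : rs lam k (f i) z = lam * rs lam k (pD 0 (fun y => lam⁻¹ * AA i k y)) z := by
        rw [pD_cmul _ (hA i k).sm, e0, pD_Ian_self (hf i).sm (hf i).pθ, hm i]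
        simp only [rs]
        field_simp
        ring
      have e5 : rs lam k (dY (fun i j y => lam⁻¹ * AA i j y) i) z = - rs lam k (fun y => -lam⁻¹ * dY AA i y) z := by
        simp only [rs, dY, pD_cmul _ (hA i _).sm, ← Finset.mul_sum]
        ring
      rw [e4]
      simp only [e5, e3]
      ring
end hf
end CI

namespace CI
open scoped ContDiff Topology

def psi (s : ℝ) : ℝ :=
  Real.sin (Real.pi / 2 * Real.smoothTransition (s + 1)) * Real.cos (Real.pi / 2 * Real.smoothTransition s)

lemma psi_smooth : ContDiff ℝ ∞ psi := by
  have h : ContDiff ℝ ∞ Real.smoothTransition := Real.smoothTransition.contDiff (n := ⊤)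
  unfold psi
  exact (Real.contDiff_sin.comp (contDiff_const.mul (h.comp (contDiff_id.add contDiff_const)))).mul
    (Real.contDiff_cos.comp (contDiff_const.mul h))

lemma psi_zero {s : ℝ} (h : 1 ≤ |s|) : psi s = 0 := by
  unfold psi
  rcases le_abs.1 h with h | h
  · rw [Real.smoothTransition.one_of_one_le h]; simp
  · rw [Real.smoothTransition.zero_of_nonpos (x := s + 1) (by linarith)]; simp

lemma psi_sq {r : ℝ} (h0 : 0 ≤ r) (h1 : r ≤ 1) : psi r ^ 2 + psi (r - 1) ^ 2 = 1 := by
  unfold psi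
  rw [Real.smoothTransition.one_of_one_le (x := r + 1) (by linarith),
    Real.smoothTransition.zero_of_nonpos (x := r - 1) (by linarith)]
  simp

lemma comp_supp {g : ℝ → ℝ} (h : ∀ s, 1 ≤ |s| → g s = 0) : HasCompactSupport g := by
  refine HasCompactSupport.intro (isCompact_Icc (a := (-1:ℝ)) (b := 1)) fun x hx => h x ?_
  by_contra hc
  push Not at hc
  rw [abs_lt] at hc
  exact hx ⟨hc.1.le, hc.2.le⟩

lemma cos_bdd (N : ℕ) (c d : ℝ) : ∃ C, 0 ≤ C ∧ ∀ m ≤ N, ∀ s, |iteratedDeriv m (fun x => d * Real.cos (c * x)) s| ≤ C := by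
  refine ⟨|d| * (1 + |c|) ^ N, by positivity, fun m hm s => ?_⟩
  rw [iteratedDeriv_const_mul_field, iteratedDeriv_comp_const_mul Real.contDiff_cos, abs_mul]
  simp only []
  rw [abs_mul, abs_pow]
  have h1 := Real.abs_iteratedDeriv_cos_le_one m (c * s)
  have h2 : |c| ^ m ≤ (1 + |c|) ^ N :=
    (pow_le_pow_left₀ (abs_nonneg c) (by linarith) m).trans (pow_le_pow_right₀ (by linarith [abs_nonneg c]) hm)
  have h3 : |c| ^ m * |iteratedDeriv m Real.cos (c * s)| ≤ (1 + |c|) ^ N * 1 :=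
    mul_le_mul h2 h1 (abs_nonneg _) (by positivity)
  rw [mul_one] at h3
  gcongr

lemma sin_bdd (N : ℕ) (c d : ℝ) : ∃ C, 0 ≤ C ∧ ∀ m ≤ N, ∀ s, |iteratedDeriv m (fun x => d * Real.sin (c * x)) s| ≤ C := by
  refine ⟨|d| * (1 + |c|) ^ N, by positivity, fun m hm s => ?_⟩
  rw [iteratedDeriv_const_mul_field, iteratedDeriv_comp_const_mul Real.contDiff_sin, abs_mul]
  simp only []
  rw [abs_mul, abs_pow]
  have h1 := Real.abs_iteratedDeriv_sin_le_one m (c * s)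
  have h2 : |c| ^ m ≤ (1 + |c|) ^ N :=
    (pow_le_pow_left₀ (abs_nonneg c) (by linarith) m).trans (pow_le_pow_right₀ (by linarith [abs_nonneg c]) hm)
  have h3 : |c| ^ m * |iteratedDeriv m Real.sin (c * s)| ≤ (1 + |c|) ^ N * 1 :=
    mul_le_mul h2 h1 (abs_nonneg _) (by positivity)
  rw [mul_one] at h3
  gcongr

def fr (l : ℤ) : ℝ := if Even l then 1 else 2
def gam (l : ℤ) (x : ℝ) : ℝ := √2 * Real.cos (2 * Real.pi * fr l * x)
def gam' (l : ℤ) (x : ℝ) : ℝ := (-(√2 * (2 * Real.pi * fr l))) * Real.sin (2 * Real.pi * fr l * x)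

lemma gam_smooth (l) : ContDiff ℝ ∞ (gam l) :=
  contDiff_const.mul (Real.contDiff_cos.comp (contDiff_const.mul contDiff_id))
lemma gam'_smooth (l) : ContDiff ℝ ∞ (gam' l) :=
  contDiff_const.mul (Real.contDiff_sin.comp (contDiff_const.mul contDiff_id))
lemma gam_deriv (l) (x : ℝ) : HasDerivAt (gam l) (gam' l x) x := by
  have h := (((hasDerivAt_id x).const_mul (2 * Real.pi * fr l)).cos).const_mul (√2)
  exact h.congr_deriv (by unfold gam'; simp only [id]; ring)

lemma gam_bdd (N : ℕ) : ∃ C, 0 ≤ C ∧ ∀ l, ∀ m ≤ N, ∀ s, |iteratedDeriv m (gam l) s| ≤ C := by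
  obtain ⟨C1, h1, H1⟩ := cos_bdd N (2 * Real.pi * 1) (√2)
  obtain ⟨C2, h2, H2⟩ := cos_bdd N (2 * Real.pi * 2) (√2)
  refine ⟨max C1 C2, le_max_of_le_left h1, fun l m hm s => ?_⟩
  unfold gam fr
  split_ifs
  · exact (H1 m hm s).trans (le_max_left _ _)
  · exact (H2 m hm s).trans (le_max_right _ _)
lemma gam'_bdd (N : ℕ) : ∃ C, 0 ≤ C ∧ ∀ l, ∀ m ≤ N, ∀ s, |iteratedDeriv m (gam' l) s| ≤ C := by
  obtain ⟨C1, h1, H1⟩ := sin_bdd N (2 * Real.pi * 1) (-(√2 * (2 * Real.pi * 1)))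
  obtain ⟨C2, h2, H2⟩ := sin_bdd N (2 * Real.pi * 2) (-(√2 * (2 * Real.pi * 2)))
  refine ⟨max C1 C2, le_max_of_le_left h1, fun l m hm s => ?_⟩
  unfold gam' fr
  split_ifs
  · exact (H1 m hm s).trans (le_max_left _ _)
  · exact (H2 m hm s).trans (le_max_right _ _)

/-- sum of the transported waves -/
def GG (Y : ℕ) (ψ : ℝ → ℝ) (γ : ℤ → ℝ → ℝ) : (Fin 3 → ℝ) → ℝ := fun x =>
  ∑ l ∈ Finset.Icc (-(Y:ℤ)) Y, ψ (x 0 - l) * γ l (x 2 - l * x 1)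

def WG (Y : ℕ) : Fin 3 → ℝ := fun i => 2 * (if i = 1 then (Y : ℝ) else 1)

section gg
variable {Y N : ℕ} {ψ : ℝ → ℝ} {γ : ℤ → ℝ → ℝ} {C C' : ℝ}

lemma tm_sm (sψ : ContDiff ℝ ∞ ψ) (sγ : ∀ l, ContDiff ℝ ∞ (γ l)) (l : ℤ) :
    Sm (fun x : Fin 3 → ℝ => ψ (x 0 - l) * γ l (x 2 - l * x 1)) :=
  (sψ.comp ((Sm.coord 0).sub (Sm.const _))).mul ((sγ l).comp ((Sm.coord 2).sub ((Sm.coord 1).cmul _)))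

lemma GG_sm (sψ : ContDiff ℝ ∞ ψ) (sγ : ∀ l, ContDiff ℝ ∞ (γ l)) : Sm (GG Y ψ γ) :=
  Sm.sum fun l _ => tm_sm sψ sγ l

lemma tm_bd (sψ : ContDiff ℝ ∞ ψ) (sγ : ∀ l, ContDiff ℝ ∞ (γ l))
    (bψ : ∀ m ≤ N, ∀ s, |iteratedDeriv m ψ s| ≤ C) (bγ : ∀ l, ∀ m ≤ N, ∀ s, |iteratedDeriv m (γ l) s| ≤ C')
    (l : ℤ) (hl : |(l : ℝ)| ≤ Y) :
    Bd N (C * C') (WG Y) (fun x : Fin 3 → ℝ => ψ (x 0 - l) * γ l (x 2 - l * x 1)) := by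
  have h1 := Bd.lin (n := 3) (L := fun i => if i = 1 then (Y:ℝ) else 1) bψ sψ ![1, 0, 0] (-l) (by
    intro i; fin_cases i <;> simp)
  have h2 := Bd.lin (n := 3) (L := fun i => if i = 1 then (Y:ℝ) else 1) (bγ l) (sγ l) ![0, -l, 1] 0 (by
    intro i; fin_cases i <;> simp [hl])
  have h3 := h1.mul h2 (sψ.comp (Sm.lin _ _)) ((sγ l).comp (Sm.lin _ _)) (by intro i; split_ifs <;> positivity)
  have e : (fun x : Fin 3 → ℝ => ψ (x 0 - l) * γ l (x 2 - l * x 1)) =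
      fun z => ψ (∑ a, ![1, 0, 0] a * z a + -(l:ℝ)) * γ l (∑ a, ![0, -(l:ℝ), 1] a * z a + 0) := by
    funext x
    simp only [Fin.sum_univ_three]
    congr 2 <;> simp <;> ring
  rw [e]
  exact h3

lemma GG_bd (sψ : ContDiff ℝ ∞ ψ) (sγ : ∀ l, ContDiff ℝ ∞ (γ l)) (zψ : ∀ s, 1 ≤ |s| → ψ s = 0)
    (bψ : ∀ m ≤ N, ∀ s, |iteratedDeriv m ψ s| ≤ C) (bγ : ∀ l, ∀ m ≤ N, ∀ s, |iteratedDeriv m (γ l) s| ≤ C') :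
    Bd N (4 * (C * C')) (WG Y) (GG Y ψ γ) := by
  have hC : 0 ≤ C := (abs_nonneg _).trans (bψ 0 (Nat.zero_le _) 0)
  have hC' : 0 ≤ C' := (abs_nonneg _).trans (bγ 0 0 (Nat.zero_le _) 0)
  have hW : ∀ i, 0 ≤ WG Y i := by intro i; unfold WG; split_ifs <;> positivity
  apply Bd.of_local
  intro z
  classical
  set s := (Finset.Icc (-(Y:ℤ)) Y).filter (fun l => l ∈ Finset.Icc (⌊z 0⌋ - 1) (⌊z 0⌋ + 2)) with hs
  refine ⟨fun x => ∑ l ∈ s, ψ (x 0 - l) * γ l (x 2 - l * x 1), ?_, ?_⟩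
  · have hn : {x : Fin 3 → ℝ | |x 0 - z 0| < 1/2} ∈ 𝓝 z := by
      apply IsOpen.mem_nhds
      · exact isOpen_lt (by fun_prop) continuous_const
      · simp
    filter_upwards [hn] with x hx
    unfold GG
    apply Finset.sum_subset (Finset.filter_subset _ _)
    intro l hl hl'
    rw [zψ, zero_mul]
    have hx' := abs_lt.1 hx
    have hf1 := Int.floor_le (z 0)
    have hf2 := Int.lt_floor_add_one (z 0)
    rw [Finset.mem_filter] at hl'
    have : ¬ (l ∈ Finset.Icc (⌊z 0⌋ - 1) (⌊z 0⌋ + 2)) := fun h => hl' ⟨hl, h⟩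
    rw [Finset.mem_Icc, not_and_or, not_le, not_le] at this
    rcases this with h | h
    · have h' : (l:ℝ) ≤ ⌊z 0⌋ - 2 := by exact_mod_cast (by omega : l ≤ ⌊z 0⌋ - 2)
      rw [le_abs]; left; linarith
    · have h' : (⌊z 0⌋ : ℝ) + 3 ≤ l := by exact_mod_cast (by omega : ⌊z 0⌋ + 3 ≤ l)
      rw [le_abs]; right; linarith
  · have hb := Bd.sum (s := s) (N := N) (A := fun _ => C * C') (fun l hl => tm_bd (Y := Y) sψ sγ bψ bγ l (by
      have := (Finset.mem_filter.1 hl).1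
      rw [Finset.mem_Icc] at this
      rw [abs_le]; exact ⟨by exact_mod_cast this.1, by exact_mod_cast this.2⟩)) (fun l _ => tm_sm sψ sγ l) hW
    refine hb.monoA ?_ hW
    rw [Finset.sum_const, nsmul_eq_mul]
    have hcard : s.card ≤ 4 := by
      calc s.card ≤ (Finset.Icc (⌊z 0⌋ - 1) (⌊z 0⌋ + 2)).card := Finset.card_le_card (by
              intro l hl; exact (Finset.mem_filter.1 hl).2)
        _ = 4 := by rw [Int.card_Icc]; omega
    have : (s.card : ℝ) ≤ 4 := by exact_mod_cast hcard
    gcongr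
end gg

/-- the profile function and its transport derivative -/
def G0 (Y : ℕ) := GG Y psi gam
def G1 (Y : ℕ) := GG Y (fun s => s * psi s) gam'

lemma psi'_smooth : ContDiff ℝ ∞ (fun s => s * psi s) := contDiff_id.mul psi_smooth
lemma G0_sm (Y) : Sm (G0 Y) := GG_sm psi_smooth gam_smooth
lemma G1_sm (Y) : Sm (G1 Y) := GG_sm psi'_smooth gam'_smooth

lemma G_bd (N : ℕ) : ∃ C, 1 ≤ C ∧ ∀ Y, Bd N C (WG Y) (G0 Y) ∧ Bd N C (WG Y) (G1 Y) := by
  obtain ⟨a, ha, Ha⟩ := bdd_of_compact psi_smooth (comp_supp fun s hs => psi_zero hs) N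
  have z1 : ∀ s : ℝ, 1 ≤ |s| → s * psi s = 0 := fun s hs => by rw [psi_zero hs, mul_zero]
  obtain ⟨b, hb, Hb⟩ := bdd_of_compact psi'_smooth (comp_supp z1) N
  obtain ⟨c, hc, Hc⟩ := gam_bdd N
  obtain ⟨d, hd, Hd⟩ := gam'_bdd N
  refine ⟨1 + 4 * (a * c) + 4 * (b * d), by have : 0 ≤ 4 * (a*c) + 4 * (b*d) := by positivity
                                            linarith, fun Y => ?_⟩
  have hW : ∀ i, 0 ≤ WG Y i := by intro i; unfold WG; split_ifs <;> positivity
  constructor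
  · exact (GG_bd psi_smooth gam_smooth (fun s hs => psi_zero hs) Ha Hc).monoA (by nlinarith [mul_nonneg hb hd]) hW
  · exact (GG_bd psi'_smooth gam'_smooth z1 Hb Hd).monoA (by nlinarith [mul_nonneg ha hc]) hW

lemma tm_pD (l : ℤ) (x : Fin 3 → ℝ) :
    pD 1 (fun x : Fin 3 → ℝ => psi (x 0 - l) * gam l (x 2 - l * x 1)) x
      + x 0 * pD 2 (fun x : Fin 3 → ℝ => psi (x 0 - l) * gam l (x 2 - l * x 1)) x
    = (x 0 - l) * psi (x 0 - l) * gam' l (x 2 - l * x 1) := by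
  have s0 : Sm (fun x : Fin 3 → ℝ => x 0 - (l:ℝ)) := (Sm.coord 0).sub (Sm.const _)
  have s1 : Sm (fun x : Fin 3 → ℝ => x 2 - (l:ℝ) * x 1) := (Sm.coord 2).sub ((Sm.coord 1).cmul _)
  have sp : Sm (fun x : Fin 3 → ℝ => psi (x 0 - (l:ℝ))) := psi_smooth.comp s0
  have sg : Sm (fun x : Fin 3 → ℝ => gam l (x 2 - (l:ℝ) * x 1)) := (gam_smooth l).comp s1
  rw [pD_mul sp sg, pD_mul sp sg, pD_comp1 psi_smooth s0, pD_comp1 psi_smooth s0,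
    pD_comp1 (gam_smooth l) s1, pD_comp1 (gam_smooth l) s1, pD_sub (Sm.coord 0) (Sm.const _),
    pD_sub (Sm.coord 0) (Sm.const _), pD_sub (Sm.coord 2) ((Sm.coord 1).cmul _),
    pD_sub (Sm.coord 2) ((Sm.coord 1).cmul _), pD_cmul _ (Sm.coord 1), pD_cmul _ (Sm.coord 1)]
  simp only [pD_coord, pD_const, (gam_deriv l _).deriv]
  simp
  ring

lemma G1_eq (Y) (x : Fin 3 → ℝ) : pD 1 (G0 Y) x + x 0 * pD 2 (G0 Y) x = G1 Y x := by
  unfold G0 G1 GG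
  rw [pD_sum (fun l _ => tm_sm psi_smooth gam_smooth l), pD_sum (fun l _ => tm_sm psi_smooth gam_smooth l)]
  simp only [Finset.mul_sum, ← Finset.sum_add_distrib]
  exact Finset.sum_congr rfl fun l _ => tm_pD l x

lemma fr_cases (l) : fr l = 1 ∨ fr l = 2 := by unfold fr; split_ifs <;> simp

lemma G0_per (Y) (x : Fin 3 → ℝ) : G0 Y (x + ee 2) = G0 Y x := by
  unfold G0 GG
  refine Finset.sum_congr rfl fun l _ => ?_
  congr 1
  · simp
  · simp only [Pi.add_apply, Pi.single_eq_same, gam]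
    rw [show (ee 2 : Fin 3 → ℝ) 1 = 0 by simp, add_zero]
    congr 1
    rcases fr_cases l with h | h <;> rw [h]
    · rw [← Real.cos_add_two_pi (2 * Real.pi * 1 * (x 2 - l * x 1))]; congr 1; ring
    · rw [← Real.cos_add_two_pi (2 * Real.pi * 2 * (x 2 - l * x 1)), ← Real.cos_add_two_pi (2 * Real.pi * 2 * (x 2 - l * x 1) + _)]
      congr 1; ring

lemma int_cos (m : ℤ) (hm : m ≠ 0) (c : ℝ) : ∫ s in (0:ℝ)..1, Real.cos (2 * Real.pi * m * s + c) = 0 := by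
  have h0 : (2 * Real.pi * m : ℝ) ≠ 0 := by
    have : (m:ℝ) ≠ 0 := by exact_mod_cast hm
    have := Real.pi_ne_zero
    positivity
  rw [intervalIntegral.integral_comp_mul_add (fun x => Real.cos x) h0, integral_cos]
  have : Real.sin (2 * Real.pi * m * 1 + c) = Real.sin (2 * Real.pi * m * 0 + c) := by
    rw [← Real.sin_add_int_mul_two_pi (2 * Real.pi * m * 0 + c) m]; congr 1; ring
  rw [this]; simp

lemma fr_int (l) : ∃ m : ℤ, (m : ℝ) = fr l ∧ 0 < m := by
  unfold fr; split_ifs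
  · exact ⟨1, by simp⟩
  · exact ⟨2, by simp⟩

lemma int_gam (l) (c : ℝ) : ∫ s in (0:ℝ)..1, gam l (c + s) = 0 := by
  obtain ⟨m, hm, hm0⟩ := fr_int l
  unfold gam
  rw [intervalIntegral.integral_const_mul]
  have := int_cos m (by omega) (2 * Real.pi * m * c)
  rw [← hm]
  simp only [mul_add]
  simp only [add_comm (2 * Real.pi * m * c)]
  rw [this, mul_zero]

lemma int_gam2 (l l') (c c' : ℝ) (h : l' = l ∧ c = c' ∨ fr l ≠ fr l') :
    ∫ s in (0:ℝ)..1, gam l (c + s) * gam l' (c' + s) = if l = l' then 1 else 0 := by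
  obtain ⟨m, hm, hm0⟩ := fr_int l
  obtain ⟨m', hm', hm0'⟩ := fr_int l'
  have e : ∀ s, gam l (c + s) * gam l' (c' + s) =
      Real.cos (2 * Real.pi * ((m - m' : ℤ)) * s + 2 * Real.pi * (m * c - m' * c'))
       + Real.cos (2 * Real.pi * ((m + m' : ℤ)) * s + 2 * Real.pi * (m * c + m' * c')) := by
    intro s
    have h2 : √2 * √2 = 2 := Real.mul_self_sqrt (by norm_num)
    unfold gam
    rw [← hm, ← hm']
    push_cast
    rw [show 2 * Real.pi * (↑m - ↑m') * s + 2 * Real.pi * (↑m * c - ↑m' * c') = 2 * Real.pi * m * (c + s) - 2 * Real.pi * m' * (c' + s) by ring,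
      show 2 * Real.pi * (↑m + ↑m') * s + 2 * Real.pi * (↑m * c + ↑m' * c') = 2 * Real.pi * m * (c + s) + 2 * Real.pi * m' * (c' + s) by ring,
      Real.cos_sub, Real.cos_add]
    linear_combination (Real.cos (2 * Real.pi * m * (c + s)) * Real.cos (2 * Real.pi * m' * (c' + s))) * h2
  simp only [e]
  rw [intervalIntegral.integral_add (Continuous.intervalIntegrable (by fun_prop) _ _) (Continuous.intervalIntegrable (by fun_prop) _ _),
    int_cos (m + m') (by omega), add_zero]
  rcases h with ⟨rfl, rfl⟩ | h
  · have : m = m' := by exact_mod_cast hm.trans hm'.symm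
    subst this
    simp
  · have h1 : m ≠ m' := by rintro rfl; exact h (hm.symm.trans hm')
    rw [int_cos _ (by omega), if_neg]
    rintro rfl; exact h rfl

lemma G0_mean (Y) : Pav 2 (G0 Y) = fun _ => 0 := by
  funext x
  unfold Pav G0 GG
  rw [Kop_sum (fun l _ => tm_sm psi_smooth gam_smooth l) continuous_const]
  refine Finset.sum_eq_zero fun l _ => ?_
  unfold Kop
  have : ∀ s : ℝ, (1:ℝ) * (psi ((x + s • (ee 2 : Fin 3 → ℝ)) 0 - l) * gam l ((x + s • (ee 2 : Fin 3 → ℝ)) 2 - l * (x + s • (ee 2 : Fin 3 → ℝ)) 1))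
      = psi (x 0 - l) * gam l ((x 2 - l * x 1) + s) := by
    intro s
    simp
    left; congr 1; ring
  simp only [this]
  rw [intervalIntegral.integral_const_mul, int_gam, mul_zero]

lemma psi_prod (s : ℝ) (l l' : ℤ) (h : l ≠ l') (hf : fr l = fr l') : psi (s - l) * psi (s - l') = 0 := by
  have hp : Even l ↔ Even l' := by
    unfold fr at hf
    by_cases h1 : Even l <;> by_cases h2 : Even l' <;> simp only [h1, h2, if_true, if_false] at hf ⊢ <;> norm_num at hf
  have h2 : l + 2 ≤ l' ∨ l' + 2 ≤ l := by
    rcases lt_or_gt_of_ne h with h3 | h3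
    · left
      by_contra hc
      have : l' = l + 1 := by omega
      subst this
      rw [Int.even_add_one] at hp
      tauto
    · right
      by_contra hc
      have : l = l' + 1 := by omega
      subst this
      rw [Int.even_add_one] at hp
      tauto
  by_cases h3 : 1 ≤ |s - l|
  · rw [psi_zero h3, zero_mul]
  · rw [psi_zero (s := s - l'), mul_zero]
    push Not at h3
    rw [abs_lt] at h3
    rw [le_abs]
    rcases h2 with h2 | h2
    · have : (l:ℝ) + 2 ≤ l' := by exact_mod_cast h2
      right; linarith
    · have : (l':ℝ) + 2 ≤ l := by exact_mod_cast h2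
      left; linarith

lemma psi_sum (Y : ℕ) (s : ℝ) (hs : |s| + 2 ≤ Y) : ∑ l ∈ Finset.Icc (-(Y:ℤ)) Y, psi (s - l) ^ 2 = 1 := by
  have hs' := abs_le.1 (show |s| ≤ Y - 2 by linarith)
  have hf1 := Int.floor_le s
  have hf2 := Int.lt_floor_add_one s
  have hsub : ({⌊s⌋, ⌊s⌋ + 1} : Finset ℤ) ⊆ Finset.Icc (-(Y:ℤ)) Y := by
    intro l hl
    have h1 : (-(Y:ℝ)) ≤ ⌊s⌋ := by linarith
    have h2 : (⌊s⌋ : ℝ) + 1 ≤ Y := by linarith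
    have h1' : (-(Y:ℤ)) ≤ ⌊s⌋ := by exact_mod_cast h1
    have h2' : ⌊s⌋ + 1 ≤ (Y:ℤ) := by exact_mod_cast h2
    simp only [Finset.mem_insert, Finset.mem_singleton] at hl
    rw [Finset.mem_Icc]
    omega
  rw [← Finset.sum_subset hsub]
  · rw [Finset.sum_pair (by omega)]
    have := psi_sq (r := s - ⌊s⌋) (by linarith) (by linarith)
    push_cast
    rw [sub_sub] at this
    exact this
  · intro l _ hl
    simp only [Finset.mem_insert, Finset.mem_singleton, not_or] at hl
    rw [psi_zero, zero_pow (by norm_num)]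
    rw [le_abs]
    rcases lt_or_gt_of_ne hl.1 with h | h
    · left
      have : (l:ℝ) + 1 ≤ ⌊s⌋ := by exact_mod_cast h
      linarith
    · right
      have : (⌊s⌋:ℝ) + 2 ≤ l := by exact_mod_cast (by omega : ⌊s⌋ + 2 ≤ l)
      linarith

lemma G0_mean2 (Y : ℕ) (x : Fin 3 → ℝ) (hx : |x 0| + 2 ≤ Y) : Pav 2 (fun x => G0 Y x * G0 Y x) x = 1 := by
  have e : (fun x => G0 Y x * G0 Y x) = fun x => ∑ l ∈ Finset.Icc (-(Y:ℤ)) Y, ∑ l' ∈ Finset.Icc (-(Y:ℤ)) Y,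
     (psi (x 0 - l) * gam l (x 2 - l * x 1)) * (psi (x 0 - l') * gam l' (x 2 - l' * x 1)) := by
    funext x; unfold G0 GG; rw [Finset.sum_mul_sum]
  have sm := fun l l' : ℤ => (tm_sm psi_smooth gam_smooth l).mul (tm_sm psi_smooth gam_smooth l')
  rw [e]
  unfold Pav
  rw [Kop_sum (fun l _ => Sm.sum fun l' _ => sm l l') continuous_const]
  refine Eq.trans ?_ (psi_sum Y (x 0) hx)
  refine Finset.sum_congr rfl fun l hl => ?_
  rw [Kop_sum (fun l' _ => sm l l') continuous_const]
  beta_reduce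
  rw [Finset.sum_eq_single_of_mem l hl]
  all_goals
    unfold Kop
    have : ∀ l' : ℤ, ∀ s : ℝ, (1:ℝ) * (psi ((x + s • (ee 2 : Fin 3 → ℝ)) 0 - l) * gam l ((x + s • (ee 2 : Fin 3 → ℝ)) 2 - l * (x + s • (ee 2 : Fin 3 → ℝ)) 1)
         * (psi ((x + s • (ee 2 : Fin 3 → ℝ)) 0 - l') * gam l' ((x + s • (ee 2 : Fin 3 → ℝ)) 2 - l' * (x + s • (ee 2 : Fin 3 → ℝ)) 1)))
        = (psi (x 0 - l) * psi (x 0 - l')) * (gam l ((x 2 - l * x 1) + s) * gam l' ((x 2 - l' * x 1) + s)) := by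
      intro l' s
      simp
      rw [show x 2 + s - l * x 1 = x 2 - l * x 1 + s by ring, show x 2 + s - l' * x 1 = x 2 - l' * x 1 + s by ring]
      ring
    simp only [this]
  · rw [intervalIntegral.integral_const_mul, int_gam2 l l _ _ (Or.inl ⟨rfl, rfl⟩)]
    simp; ring
  · intro l' _ hne
    rw [intervalIntegral.integral_const_mul]
    by_cases hf : fr l = fr l'
    · rw [psi_prod _ _ _ hne.symm hf, zero_mul]
    · rw [int_gam2 l l' _ _ (Or.inr hf), if_neg hne.symm, mul_zero]
end CI

namespace CI
open scoped ContDiff Topology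

/-- weights in the extended space -/
def WY (κ : ℝ) : Fin 5 → ℝ := Fin.cons 2 (Fin.cons (κ ^ 34) (fun _ => κ ^ 10))

/-- arguments of the profile -/
def phi (μ ν : ℝ) (u : ZF) : Fin 3 → YF := ![fun y => μ * lf u y, fun y => ν * y 1, fun y => y 0]

section h1
variable {μ ν : ℝ} {u : ZF} {G : (Fin 3 → ℝ) → ℝ}

lemma phi_sm (hu : Sm u) (a) : Sm (phi μ ν u a) := by
  fin_cases a
  · exact (Sm.lf hu).cmul μ
  · exact (Sm.coord 1).cmul ν
  · exact Sm.coord 0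

lemma phi_theta (y : Fin 5 → ℝ) (s : ℝ) :
    (fun a => phi μ ν u a (y + s • ee 0)) = (fun a => phi μ ν u a y) + s • ee 2 := by
  have h0 : lf u (y + s • ee 0) = lf u y := by
    unfold lf; congr 1; funext i; simp [Fin.succ_ne_zero]
  funext a
  fin_cases a
  · simp [phi, h0]
  · simp [phi]
  · simp [phi]

lemma phi_x (hu : GZ ∅ u) (y : Fin 5 → ℝ) (j : Fin 3) :
    (fun a => phi μ ν u a (y + ee j.succ.succ)) = (fun a => phi μ ν u a y) := by
  have h0 : lf u (y + ee j.succ.succ) = lf u y := (GY.lf hu).per _ (Or.inr ⟨j, rfl⟩) y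
  funext a
  fin_cases a
  · simp [phi, h0]
  · have : (ee j.succ.succ : Fin 5 → ℝ) 1 = 0 := by
      apply Pi.single_eq_of_ne
      intro h; have := congrArg Fin.val h; simp at this
    simp [phi, this]
  · have : (ee j.succ.succ : Fin 5 → ℝ) 0 = 0 := by
      apply Pi.single_eq_of_ne
      intro h; have := congrArg Fin.val h; simp at this
    simp [phi, this]

lemma phi_GY (hu : GZ ∅ u) (hG : Sm G) (hp : ∀ x, G (x + ee 2) = G x) :
    GY ∅ (fun y => G (fun a => phi μ ν u a y)) := by
  refine ⟨hG.comp' (phi_sm hu.sm), ?_, fun z hz => absurd hz (by simp [UY])⟩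
  rintro p (rfl | ⟨j, rfl⟩) y
  · have := phi_theta (μ := μ) (ν := ν) (u := u) y 1
    simp only [one_smul] at this
    rw [this, hp]
  · rw [phi_x hu]

lemma phi_Pav (y) : Pav 0 (fun y => G (fun a => phi μ ν u a y)) y = Pav 2 G (fun a => phi μ ν u a y) := by
  unfold Pav Kop
  simp only [phi_theta]

lemma phi_Bd {κ : ℝ} (hκ : 1 ≤ κ) (hu : GZ ∅ u) (hG : Sm G) {C : ℝ} {Y N : ℕ} (hb : Bd N C (WG Y) G)
    (hμ : 0 ≤ μ) (hν : 0 ≤ ν) (hub : ∀ i, Bd N κ (fun _ => κ ^ 10) (pD i u))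
    (h1 : 2 * (μ * κ) ≤ κ ^ 10) (h2 : 2 * (μ * κ) + 2 * Y * ν ≤ κ ^ 34) :
    Bd N C (fun i => 2 ^ N * WY κ i) (fun y => G (fun a => phi μ ν u a y)) := by
  have hW : ∀ i, 0 ≤ WY κ i := by
    intro i; refine Fin.cases ?_ (fun i => Fin.cases ?_ (fun i => ?_) i) i <;> simp [WY] <;> positivity
  have hκ0 : (0:ℝ) ≤ κ := by linarith
  have hp : κ ^ 10 ≤ κ ^ 34 := pow_le_pow_right₀ hκ (by norm_num)
  have hlf : ∀ i : Fin 4, Bd N (μ * κ) (WY κ) (pD i.succ (fun y => μ * lf u y)) := by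
    intro i
    rw [pD_cmul _ (Sm.lf hu.sm), pD_lf hu.sm]
    have h := (Bd.lf (L := WY κ) ((hub i).mono le_rfl (fun _ => by positivity) (by
      intro i; refine Fin.cases ?_ (fun i => ?_) i <;> simp [WY, hp])) (hu.sm.pD i) hW).cmul μ (Sm.lf (hu.sm.pD i))
    rwa [abs_of_nonneg hμ] at h
  have hlf0 : Bd N 0 (WY κ) (pD 0 (fun y => μ * lf u y)) := by
    rw [pD_cmul _ (Sm.lf hu.sm), pD_lf0 hu.sm]; simp only [mul_zero]; exact Bd.zero le_rfl hW
  refine Bd.comp (H := ![Fin.cons 0 (fun _ => μ * κ), fun i => if i = 1 then ν else 0, fun i => if i = 0 then 1 else 0])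
    hb hG (phi_sm hu.sm) (fun a => by unfold WG; split_ifs <;> positivity) ?_ ?_ hW
  · intro a i
    fin_cases a
    · refine Fin.cases ?_ (fun i => ?_) i
      · exact hlf0
      · exact hlf i
    · show Bd N (if i = 1 then ν else 0) (WY κ) (pD i (fun y : Fin 5 → ℝ => ν * y 1))
      rw [pD_cmul _ (Sm.coord 1), pD_coord]
      split_ifs
      · exact Bd.const (by rw [mul_one, abs_of_nonneg hν]) hW
      · exact Bd.const (by simp) hW
    · show Bd N (if i = 0 then 1 else 0) (WY κ) (pD i (fun y : Fin 5 → ℝ => y 0))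
      rw [pD_coord]
      split_ifs
      · exact Bd.const (by simp) hW
      · exact Bd.const (by simp) hW
  · intro i
    rw [Fin.sum_univ_three]
    refine Fin.cases ?_ (fun i => Fin.cases ?_ (fun i => ?_) i) i
    · simp [WG, WY]
    · simp [WG, WY, Fin.succ_ne_zero]
      linarith
    · have : ((i.succ.succ : Fin 5) = 1) = False := by
        simp only [eq_iff_iff, iff_false]; intro h; have := congrArg Fin.val h; simp at this
      simp [WG, WY, Fin.succ_ne_zero, this]
      linarith

lemma phi_D (hu : Sm u) (Y : ℕ) {lam : ℝ} (hl : μ * ν = lam) (y) :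
    pD 1 (fun y => G0 Y (fun a => phi μ ν u a y)) y + lam * lf u y * pD 0 (fun y => G0 Y (fun a => phi μ ν u a y)) y
      = ν * G1 Y (fun a => phi μ ν u a y) + μ * lf (pD 0 u) y * pD 0 (G0 Y) (fun a => phi μ ν u a y) := by
  rw [pD_comp (G0_sm Y) (phi_sm hu), pD_comp (G0_sm Y) (phi_sm hu), ← G1_eq]
  simp only [Fin.sum_univ_three]
  have e1 : pD 1 (phi μ ν u 0) y = μ * lf (pD 0 u) y := by
    show pD 1 (fun y => μ * lf u y) y = _
    rw [pD_cmul _ (Sm.lf hu)]; simp only []; rw [show (1 : Fin 5) = Fin.succ 0 from rfl, pD_lf hu]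
  have e2 : pD 1 (phi μ ν u 1) y = ν := by
    show pD 1 (fun y : Fin 5 → ℝ => ν * y 1) y = _
    rw [pD_cmul _ (Sm.coord 1), pD_coord]; simp
  have e3 : pD 1 (phi μ ν u 2) y = 0 := by
    show pD 1 (fun y : Fin 5 → ℝ => y 0) y = _
    rw [pD_coord]; simp
  have e4 : pD 0 (phi μ ν u 0) y = 0 := by
    show pD 0 (fun y => μ * lf u y) y = _
    rw [pD_cmul _ (Sm.lf hu), pD_lf0 hu]; simp
  have e5 : pD 0 (phi μ ν u 1) y = 0 := by
    show pD 0 (fun y : Fin 5 → ℝ => ν * y 1) y = _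
    rw [pD_cmul _ (Sm.coord 1), pD_coord]; simp
  have e6 : pD 0 (phi μ ν u 2) y = 1 := by
    show pD 0 (fun y : Fin 5 → ℝ => y 0) y = _
    rw [pD_coord]; simp
  have e7 : phi μ ν u 0 y = μ * lf u y := rfl
  rw [e1, e2, e3, e4, e5, e6, e7, ← hl]
  ring
end h1

lemma WY_nonneg {κ : ℝ} (hκ : 1 ≤ κ) (i) : 0 ≤ WY κ i := by
  refine Fin.cases ?_ (fun i => Fin.cases ?_ (fun i => ?_) i) i <;> simp [WY] <;> positivity

/-- existence of the oscillating profile adapted to a transport velocity `u` -/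
lemma profile {C : ℝ} (hC1 : 1 ≤ C) (hC : ∀ Y, Bd 11 C (WG Y) (G0 Y) ∧ Bd 11 C (WG Y) (G1 Y)) {κ : ℕ} (hκ : 2 ^ 14 ≤ κ) (hCκ : C ≤ κ)
    {u : ZF} (hu : GZ ∅ u) (hu0 : ∀ z, |u z| ≤ κ) (hub : ∀ i, Bd 10 (κ:ℝ) (fun _ => (κ:ℝ) ^ 10) (pD i u)) :
    ∃ Ψ D : YF, GY ∅ Ψ ∧ Sm D ∧ Pav 0 Ψ = (fun _ => 0) ∧ Pav 0 (fun y => Ψ y * Ψ y) = (fun _ => 1) ∧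
      (∀ y, pD 1 Ψ y + (κ:ℝ) ^ 30 * lf u y * pD 0 Ψ y = D y) ∧
      Bd 10 C (fun i => 2 ^ 10 * WY κ i) Ψ ∧ Bd 10 ((κ:ℝ) ^ 24) (fun i => 2 ^ 11 * WY κ i) D := by
  have hk : ((2:ℝ) ^ 14) ≤ κ := by exact_mod_cast hκ
  have hk1 : (1:ℝ) ≤ κ := le_trans (by norm_num) hk
  have hk0 : (0:ℝ) < κ := by linarith
  set Y : ℕ := κ ^ 9 + 2 with hY
  set μ : ℝ := (κ:ℝ) ^ 8 with hμ
  set ν : ℝ := (κ:ℝ) ^ 22 with hν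
  have hμ0 : 0 ≤ μ := by positivity
  have hν0 : 0 ≤ ν := by positivity
  have hW := WY_nonneg hk1
  have hk9 : (1:ℝ) ≤ (κ:ℝ)^9 := one_le_pow₀ hk1
  have h1 : 2 * (μ * κ) ≤ (κ:ℝ) ^ 10 := by
    have : (κ:ℝ)^10 = κ * κ^9 := by ring
    rw [this, hμ]; nlinarith
  have h2 : 2 * (μ * κ) + 2 * Y * ν ≤ (κ:ℝ) ^ 34 := by
    have hYr : (Y:ℝ) ≤ 3 * (κ:ℝ)^9 := by rw [hY]; push_cast; linarith
    have h3 : 2 * (Y:ℝ) * ν ≤ 6 * κ ^ 31 := by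
      rw [hν]; calc 2 * (Y:ℝ) * (κ:ℝ)^22 ≤ 2 * (3 * (κ:ℝ)^9) * (κ:ℝ)^22 := by gcongr
        _ = _ := by ring
    have h4 : 2 * (μ * κ) ≤ 2 * (κ:ℝ)^31 := by
      rw [hμ, ← pow_succ]; gcongr <;> norm_num
    have h5 : 8 * (κ:ℝ)^31 ≤ κ^34 := by
      calc 8 * (κ:ℝ)^31 ≤ κ^3 * κ^31 := by
            gcongr
            calc (8:ℝ) ≤ κ := le_trans (by norm_num) hk
              _ ≤ κ^3 := le_self_pow₀ hk1 (by norm_num)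
        _ = _ := by ring
    linarith
  have b0 := phi_Bd (N := 10) hk1 hu (G0_sm Y) ((hC Y).1.ord (by norm_num)) hμ0 hν0 hub h1 h2
  have b1 := phi_Bd (N := 10) hk1 hu (G1_sm Y) ((hC Y).2.ord (by norm_num)) hμ0 hν0 hub h1 h2
  have b2 := phi_Bd (N := 10) hk1 hu ((G0_sm Y).pD 0) ((hC Y).1.pD 0) hμ0 hν0 hub h1 h2
  have s2 : Sm (fun y => pD 0 (G0 Y) (fun a => phi μ ν u a y)) := ((G0_sm Y).pD 0).comp' (phi_sm hu.sm)
  have s1 : Sm (fun y => G1 Y (fun a => phi μ ν u a y)) := (G1_sm Y).comp' (phi_sm hu.sm)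
  have hlfs : Sm (lf (pD 0 u)) := Sm.lf (hu.sm.pD 0)
  have hp : (κ:ℝ) ^ 10 ≤ (κ:ℝ) ^ 34 := pow_le_pow_right₀ hk1 (by norm_num)
  have b3 : Bd 10 (κ:ℝ) (fun i => 2 ^ 10 * WY κ i) (lf (pD 0 u)) := by
    refine Bd.lf ((hub 0).mono le_rfl (fun _ => by positivity) ?_) (hu.sm.pD 0) (fun i => mul_nonneg (by norm_num) (hW i))
    have hx : ∀ x : ℝ, 0 ≤ x → x ≤ 2^10 * x := fun x hx => by nlinarith
    intro i; refine Fin.cases ?_ (fun i => ?_) i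
    · simpa [WY] using hp.trans (hx _ (by positivity))
    · simpa [WY] using (hx ((κ:ℝ)^10) (by positivity))
  refine ⟨fun y => G0 Y (fun a => phi μ ν u a y), fun y => ν * G1 Y (fun a => phi μ ν u a y) + μ * (lf (pD 0 u) y * pD 0 (G0 Y) (fun a => phi μ ν u a y)),
    phi_GY hu (G0_sm Y) (G0_per Y), (s1.cmul ν).add ((hlfs.mul s2).cmul μ), ?_, ?_, ?_, b0, ?_⟩
  · funext y; rw [phi_Pav, G0_mean]
  · funext y
    have := phi_Pav (G := fun x => G0 Y x * G0 Y x) (μ := μ) (ν := ν) (u := u) y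
    rw [this, G0_mean2]
    show |μ * u _| + 2 ≤ (Y:ℝ)
    rw [abs_mul, abs_of_nonneg hμ0, hY]; push_cast
    have : μ * |u (fun i => y i.succ)| ≤ κ^8 * κ := by rw [hμ]; gcongr; exact hu0 _
    nlinarith
  · intro y
    rw [phi_D hu.sm Y (lam := (κ:ℝ)^30) (by rw [hμ, hν]; ring)]
    ring
  · have hm := (b3.mul b2 hlfs s2 (fun i => mul_nonneg (by norm_num) (hW i))).cmul μ (hlfs.mul s2)
    have hb1 := b1.cmul ν s1
    have hW' : ∀ i, 0 ≤ 2 ^ 10 * WY κ i := fun i => mul_nonneg (by norm_num) (hW i)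
    have hb1' : Bd 10 (|ν| * C) (fun i => 2 * (2 ^ 10 * WY κ i)) _ := hb1.mono le_rfl hW' (fun i => by linarith [hW' i])
    have := hb1'.add hm (s1.cmul ν) ((hlfs.mul s2).cmul μ)
    have e : (fun i => 2 * (2 ^ 10 * WY (κ:ℝ) i)) = (fun i => 2 ^ 11 * WY κ i) := by funext i; ring
    rw [e] at this
    refine this.monoA ?_ (fun i => mul_nonneg (by norm_num) (hW i))
    rw [abs_of_nonneg hμ0, abs_of_nonneg hν0, hμ, hν]
    have hw : WG Y 0 = 2 := by simp [WG]
    rw [hw]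
    have t1 : (κ:ℝ)^22 * C ≤ κ^23 := by
      calc (κ:ℝ)^22 * C ≤ κ^22 * κ := by gcongr
        _ = _ := by ring
    have t2 : (κ:ℝ)^8 * (κ * (C * 2)) ≤ κ^23 := by
      calc (κ:ℝ)^8 * (κ * (C * 2)) ≤ (κ:ℝ)^8 * (κ * (κ * κ)) := by
              gcongr; exact le_trans (by norm_num) hk
        _ = (κ:ℝ)^11 := by ring
        _ ≤ (κ:ℝ)^23 := pow_le_pow_right₀ hk1 (by norm_num)
    have t3 : (κ:ℝ)^24 = κ * κ^23 := by ring
    have : (2:ℝ) ≤ κ := le_trans (by norm_num) hk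
    rw [t3]
    nlinarith [pow_pos hk0 23]
end CI

namespace CI
open scoped ContDiff Topology

/-- mean zero in the fast variable -/
structure Mz (S : Set ℝ) (f : YF) : Prop where
  gy : GY S f
  mz : Pav 0 f = fun _ => 0

section mz
variable {S : Set ℝ} {f g : YF}
lemma lf_const (h : ZF) (y : Fin 5 → ℝ) (s : ℝ) : lf h (y + s • ee 0) = lf h y := by
  unfold lf; congr 1; funext i; simp [Fin.succ_ne_zero]
lemma Mz.add (hf : Mz S f) (hg : Mz S g) : Mz S (fun y => f y + g y) := by
  refine ⟨hf.gy.add hg.gy, ?_⟩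
  have := Kop_add (w := fun _ => 1) (e := ee 0) hf.gy.sm hg.gy.sm continuous_const
  unfold Pav; rw [this]; have h1 := hf.mz; have h2 := hg.mz; unfold Pav at h1 h2; rw [h1, h2]; simp
lemma Mz.cmul (c : ℝ) (hf : Mz S f) : Mz S (fun y => c * f y) := by
  refine ⟨hf.gy.cmul c, ?_⟩
  unfold Pav; rw [Kop_cmul]; have h1 := hf.mz; unfold Pav at h1; rw [h1]; simp
lemma Mz.sub (hf : Mz S f) (hg : Mz S g) : Mz S (fun y => f y - g y) := by
  have := hf.add (hg.cmul (-1))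
  convert this using 2; ring
lemma Mz.sum {ι : Type*} {s : Finset ι} {F : ι → YF} (h : ∀ a ∈ s, Mz S (F a)) : Mz S (fun y => ∑ a ∈ s, F a y) := by
  refine ⟨Gd.sum fun a ha => (h a ha).gy, ?_⟩
  unfold Pav; rw [Kop_sum (fun a ha => (h a ha).gy.sm) continuous_const]
  funext y
  exact Finset.sum_eq_zero fun a ha => congrFun (h a ha).mz y
lemma Mz.lfL {h : ZF} (hh : GZ S h) (hf : Mz ∅ f) : Mz S (fun y => lf h y * f y) := by
  refine ⟨(GY.lf hh).mulL (by simpa [UY] using hf.gy.e), ?_⟩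
  unfold Pav; rw [Kop_mul_const (lf_const h)]; have h1 := hf.mz; unfold Pav at h1; rw [h1]; simp
lemma GYe {S : Set ℝ} (h : GY S f) : GY ∅ f := ⟨h.sm, h.per, fun z hz => absurd hz (by simp [UY])⟩
lemma GZe {S : Set ℝ} {f : ZF} (h : GZ S f) : GZ ∅ f := ⟨h.sm, h.per, fun z hz => absurd hz (by simp [US])⟩
lemma GY.mulL (hf : GY S f) (hg : GY ∅ g) : GY S (fun y => f y * g y) := Gd.mulL hf hg.e
lemma GY.mulR (hf : GY ∅ f) (hg : GY S g) : GY S (fun y => f y * g y) := Gd.mulR hf.e hg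
lemma GZ.mulL {f g : ZF} (hf : GZ S f) (hg : GZ ∅ g) : GZ S (fun y => f y * g y) := Gd.mulL hf hg.e
lemma GZ.mulR {f g : ZF} (hf : GZ ∅ f) (hg : GZ S g) : GZ S (fun y => f y * g y) := Gd.mulR hf.e hg
lemma Mz.lfR {h : ZF} (hh : GZ ∅ h) (hf : Mz S f) : Mz S (fun y => lf h y * f y) := by
  refine ⟨GY.mulR (GY.lf hh) hf.gy, ?_⟩
  unfold Pav; rw [Kop_mul_const (lf_const h)]; have h1 := hf.mz; unfold Pav at h1; rw [h1]; simp
lemma Mz.pD (hS : IsOpen S) (hf : Mz S f) (i) : Mz S (pD i f) := by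
  refine ⟨hf.gy.pD (UY_open hS) i, ?_⟩
  rw [← pD_Pav hf.gy.sm, hf.mz, pD_const]
lemma Mz.I (hf : Mz S f) : Mz S (Ian 0 f) := ⟨GY.I hf.gy, Pav_Ian hf.gy.sm hf.gy.pθ⟩
end mz

section wave
variable {S : Set ℝ} {lam : ℝ} {m : ℕ} {k : Fin 3} {n : Fin 3 → ℝ} {α Ψ D : YF} {a : ZF} {u : VF}

/-- corrector coefficient -/
def cc (k : Fin 3) (n : Fin 3 → ℝ) (α : YF) (i : Fin 3) : YF := fun y =>
  n i * pD k.succ.succ (Ian 0 α) y - dl i k * ∑ j : Fin 3, n j * pD j.succ.succ (Ian 0 α) y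
/-- perturbation -/
def wv (lam : ℝ) (k : Fin 3) (n : Fin 3 → ℝ) (α : YF) (i : Fin 3) : ZF := fun z =>
  n i * rs lam k α z + lam⁻¹ * rs lam k (cc k n α i) z
/-- potential -/
def wA (lam : ℝ) (k : Fin 3) (n : Fin 3 → ℝ) (α : YF) : TF := fun i j z =>
  (lam⁻¹ * (n i * dl j k - n j * dl i k)) * rs lam k (Ian 0 α) z

lemma cc_Mz (hS : IsOpen S) (hα : Mz S α) (i) : Mz S (cc k n α i) :=
  ((hα.I.pD hS _).cmul _).sub ((Mz.sum fun j _ => (hα.I.pD hS _).cmul _).cmul _)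

lemma wv_GZ (hS : IsOpen S) (hα : Mz S α) (i) : GZ S (wv (m:ℝ) k n α i) :=
  ((GZ.rs hα.gy k).cmul _).add ((GZ.rs (cc_Mz hS hα i).gy k).cmul _)

lemma wA_GZ (hα : Mz S α) (i j) : GZ S (wA (m:ℝ) k n α i j) := (GZ.rs hα.I.gy k).cmul _

lemma n_rs (hn : n k = 0) {f : YF} (hf : Sm f) (j : Fin 3) (z) :
    n j * pD j.succ (rs lam k f) z = n j * rs lam k (pD j.succ.succ f) z := by
  rw [pD_rs hf]
  by_cases h : j = k
  · subst h; simp [hn]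
  · simp [h]

lemma wv_dv (hlam : lam ≠ 0) (hn : n k = 0) (hα : Mz S α) (i) : dv (wA lam k n α) i = wv lam k n α i := by
  funext z
  have sI := hα.I.gy.sm
  have e : pD 0 (Ian 0 α) = α := by
    rw [pD_Ian_self hα.gy.sm hα.gy.pθ, hα.mz]; simp
  unfold dv wA wv
  simp only [pD_cmul _ (sI.rs lam k)]
  have : ∀ j : Fin 3, lam⁻¹ * (n i * dl j k - n j * dl i k) * pD j.succ (rs lam k (Ian 0 α)) z
      = lam⁻¹ * n i * (dl j k * pD j.succ (rs lam k (Ian 0 α)) z) - lam⁻¹ * dl i k * (n j * rs lam k (pD j.succ.succ (Ian 0 α)) z) := by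
    intro j; rw [← n_rs hn sI j z]; ring
  simp only [this]
  rw [Finset.sum_sub_distrib, ← Finset.mul_sum, ← Finset.mul_sum, sum_dl k (fun j => pD j.succ (rs lam k (Ian 0 α)) z), pD_rs sI, e]
  simp only [if_true]
  show _ = n i * rs lam k α z + lam⁻¹ * (n i * rs lam k (pD k.succ.succ (Ian 0 α)) z - dl i k * ∑ j : Fin 3, n j * rs lam k (pD j.succ.succ (Ian 0 α)) z)
  field_simp
  ring

lemma wv_div (hlam : lam ≠ 0) (hn : n k = 0) (hα : Mz S α) (z) : ∑ i : Fin 3, pD i.succ (wv lam k n α i) z = 0 := by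
  have sI := hα.I.gy.sm.rs lam k
  simp only [← wv_dv hlam hn hα]
  have hA : ∀ i j, Sm (wA lam k n α i j) := fun i j => sI.cmul _
  have h1 : ∀ i : Fin 3, pD i.succ (dv (wA lam k n α) i) z =
      ∑ j : Fin 3, (lam⁻¹ * (n i * dl j k - n j * dl i k)) * pD i.succ (pD j.succ (rs lam k (Ian 0 α))) z := by
    intro i
    unfold dv
    rw [pD_sum (fun j _ => (hA i j).pD _)]
    refine Finset.sum_congr rfl fun j _ => ?_
    unfold wA
    rw [pD_cmul _ sI, pD_cmul _ (sI.pD _)]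
  simp only [h1]
  have h2 : ∑ i : Fin 3, ∑ j : Fin 3, (lam⁻¹ * (n i * dl j k - n j * dl i k)) * pD i.succ (pD j.succ (rs lam k (Ian 0 α))) z
     = ∑ i : Fin 3, ∑ j : Fin 3, (lam⁻¹ * (n j * dl i k - n i * dl j k)) * pD i.succ (pD j.succ (rs lam k (Ian 0 α))) z := by
    rw [Finset.sum_comm]
    refine Finset.sum_congr rfl fun i _ => Finset.sum_congr rfl fun j _ => ?_
    rw [pD_comm sI]
  have h3 : ∑ i : Fin 3, ∑ j : Fin 3, (lam⁻¹ * (n j * dl i k - n i * dl j k)) * pD i.succ (pD j.succ (rs lam k (Ian 0 α))) z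
     = - ∑ i : Fin 3, ∑ j : Fin 3, (lam⁻¹ * (n i * dl j k - n j * dl i k)) * pD i.succ (pD j.succ (rs lam k (Ian 0 α))) z := by
    rw [← Finset.sum_neg_distrib]
    refine Finset.sum_congr rfl fun i _ => ?_
    rw [← Finset.sum_neg_distrib]
    refine Finset.sum_congr rfl fun j _ => ?_
    ring
  linarith

lemma wv_mn (hm : (m:ℝ) ≠ 0) (hn : n k = 0) (hα : Mz S α) (i) : mn (wv (m:ℝ) k n α i) = fun _ => 0 := by
  rw [← wv_dv hm hn hα]; exact mn_dv (wA_GZ hα) i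

/-- the source term in the extended space -/
def ff (lam : ℝ) (k : Fin 3) (n : Fin 3 → ℝ) (a : ZF) (Ψ D : YF) (u : VF) (i : Fin 3) : YF := fun y =>
  n i * ((lf (pD 0 a) y * Ψ y + lf a y * D y) + ∑ j : Fin 3, lf (u j) y * pD j.succ.succ (fun y => lf a y * Ψ y) y)
  + lam⁻¹ * pD 1 (cc k n (fun y => lf a y * Ψ y) i) y
  + ∑ j : Fin 3, n j * pD j.succ.succ (fun y => lf (u i) y * (lf a y * Ψ y)) y
  + n i * ∑ j : Fin 3, n j * pD j.succ.succ (fun y => lf (fun z => a z * a z) y * (Ψ y * Ψ y - 1)) y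

lemma ff_Mz (hS : IsOpen S) (ha : GZ S a) (hΨ : Mz ∅ Ψ) (hΨ2 : Pav 0 (fun y => Ψ y * Ψ y) = fun _ => 1)
    (hu : ∀ i, GZ ∅ (u i)) (hD : ∀ y, pD 1 Ψ y + lam * lf (u k) y * pD 0 Ψ y = D y) (i) : Mz S (ff lam k n a Ψ D u i) := by
  have hD' : D = fun y => pD 1 Ψ y + lam * (lf (u k) y * pD 0 Ψ y) := by
    funext y; rw [← hD]; ring
  have hDM : Mz ∅ D := by
    rw [hD']; exact (hΨ.pD isOpen_empty 1).add ((Mz.lfR (hu k) (hΨ.pD isOpen_empty 0)).cmul lam)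
  have hα : Mz S (fun y => lf a y * Ψ y) := Mz.lfL ha hΨ
  have hP : Mz ∅ (fun y => Ψ y * Ψ y - 1) := by
    refine ⟨(GY.mulL hΨ.gy hΨ.gy).sub ⟨Sm.const 1, fun _ _ _ => rfl, fun z hz => absurd hz (by simp [UY])⟩, ?_⟩
    have := Kop_sub (w := fun _ => 1) (e := ee 0) (GY.mulL hΨ.gy hΨ.gy).sm (Sm.const 1) continuous_const
    unfold Pav at hΨ2 ⊢
    rw [this, hΨ2]; simp [Kop]
  unfold ff
  refine (((((Mz.lfL (ha.pD (US_open hS) 0) hΨ).add (Mz.lfL ha hDM)).add (Mz.sum fun j _ => Mz.lfR (hu j) (hα.pD hS _))).cmul _).add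
    (((cc_Mz hS hα i).pD hS 1).cmul _)).add (Mz.sum fun j _ => ((Mz.lfR (hu i) hα).pD hS _).cmul _) |>.add
    ((Mz.sum fun j _ => ((Mz.lfL (ha.mulL (GZe ha).e) hP).pD hS _).cmul _).cmul _)

lemma rs_ff (hn : n k = 0) (hS : IsOpen S) (ha : GZ S a) (hΨ : Mz ∅ Ψ) (hu : ∀ i, GZ ∅ (u i))
    (hD : ∀ y, pD 1 Ψ y + lam * lf (u k) y * pD 0 Ψ y = D y) (hdiv : ∀ z, ∑ j : Fin 3, pD j.succ (u j) z = 0) (i) (z) :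
    pD 0 (wv lam k n (fun y => lf a y * Ψ y) i) z +
      dv (fun i j z => u i z * (n j * rs lam k (fun y => lf a y * Ψ y) z) + (n i * rs lam k (fun y => lf a y * Ψ y) z) * u j z
        + (n i * rs lam k (fun y => lf a y * Ψ y) z) * (n j * rs lam k (fun y => lf a y * Ψ y) z) - a z * a z * (n i * n j)) i z
      = rs lam k (ff lam k n a Ψ D u i) z := by
  have hα : Mz S (fun y => lf a y * Ψ y) := Mz.lfL ha hΨ
  set α : YF := fun y => lf a y * Ψ y with hαd
  have sα : Sm α := hα.gy.sm
  have sr := sα.rs lam k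
  have sa := ha.sm
  have su := fun i => (hu i).sm
  have sΨ := hΨ.gy.sm
  have s1 : Sm (fun y => lf (u i) y * α y) := (Sm.lf (su i)).mul sα
  have sP : Sm (fun y => Ψ y * Ψ y - 1) := (sΨ.mul sΨ).sub (Sm.const 1)
  have s2 : Sm (fun y => lf (fun z => a z * a z) y * (Ψ y * Ψ y - 1)) := (Sm.lf (sa.mul sa)).mul sP
  -- time derivative
  have e0 : pD 0 (wv lam k n α i) z = n i * rs lam k (pD 1 α) z + lam⁻¹ * rs lam k (pD 1 (cc k n α i)) z := by
    have sc := (cc_Mz (k := k) (n := n) hS hα i).gy.sm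
    unfold wv
    rw [pD_add (sr.cmul _) ((sc.rs lam k).cmul _), pD_cmul _ sr, pD_cmul _ (sc.rs lam k), pD_rs sα, pD_rs sc]
    have : ((0 : Fin 4) = k.succ) = False := by simp [(Fin.succ_ne_zero k).symm]
    simp [this]
  -- divergence
  have ed : ∀ j : Fin 3, pD j.succ (fun z => u i z * (n j * rs lam k α z) + (n i * rs lam k α z) * u j z
        + (n i * rs lam k α z) * (n j * rs lam k α z) - a z * a z * (n i * n j)) z
      = n j * rs lam k (pD j.succ.succ (fun y => lf (u i) y * α y)) z
        + n i * (u j z * (rs lam k (pD j.succ.succ α) z + (if j = k then lam else 0) * rs lam k (pD 0 α) z) + rs lam k α z * pD j.succ (u j) z)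
        + n i * (n j * rs lam k (pD j.succ.succ (fun y => lf (fun z => a z * a z) y * (Ψ y * Ψ y - 1))) z) := by
    intro j
    have hfun : (fun z => u i z * (n j * rs lam k α z) + (n i * rs lam k α z) * u j z
        + (n i * rs lam k α z) * (n j * rs lam k α z) - a z * a z * (n i * n j))
       = fun z => n j * rs lam k (fun y => lf (u i) y * α y) z + n i * (rs lam k α z * u j z)
         + n i * (n j * rs lam k (fun y => lf (fun z => a z * a z) y * (Ψ y * Ψ y - 1)) z) := by
      funext z
      have h1 : rs lam k (fun y => lf (u i) y * α y) z = u i z * rs lam k α z := rfl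
      have h2 : rs lam k α z = a z * rs lam k Ψ z := rfl
      have h3 : rs lam k (fun y => lf (fun z => a z * a z) y * (Ψ y * Ψ y - 1)) z = a z * a z * (rs lam k Ψ z * rs lam k Ψ z - 1) := rfl
      rw [h1, h2, h3]; ring
    rw [hfun, pD_add (((s1.rs lam k).cmul _).add ((sr.mul (su j)).cmul _)) (((s2.rs lam k).cmul _).cmul _),
      pD_add ((s1.rs lam k).cmul _) ((sr.mul (su j)).cmul _), pD_cmul _ (s1.rs lam k), pD_cmul _ (sr.mul (su j)),
      pD_cmul _ ((s2.rs lam k).cmul _), pD_cmul _ (s2.rs lam k), pD_mul sr (su j)]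
    beta_reduce
    rw [n_rs hn s1, n_rs hn s2, pD_rs sα]
    simp only [Fin.succ_inj]
    ring
  unfold dv
  rw [e0]
  simp only [ed]
  rw [Finset.sum_add_distrib, Finset.sum_add_distrib, ← Finset.mul_sum, ← Finset.mul_sum]
  have e3 : ∑ j : Fin 3, (u j z * (rs lam k (pD j.succ.succ α) z + (if j = k then lam else 0) * rs lam k (pD 0 α) z) + rs lam k α z * pD j.succ (u j) z)
      = ∑ j : Fin 3, u j z * rs lam k (pD j.succ.succ α) z + lam * u k z * rs lam k (pD 0 α) z := by
    rw [Finset.sum_add_distrib, ← Finset.mul_sum, hdiv, mul_zero, add_zero]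
    simp only [mul_add]
    rw [Finset.sum_add_distrib]
    congr 1
    rw [Finset.sum_eq_single_of_mem k (Finset.mem_univ _)]
    · simp; ring
    · intro j _ hj; simp [hj]
  rw [e3]
  have e4 : rs lam k (pD 1 α) z = pD 0 a z * rs lam k Ψ z + a z * rs lam k (pD 1 Ψ) z := by
    rw [hαd, pD_mul (Sm.lf sa) sΨ, show (1 : Fin 5) = Fin.succ 0 from rfl, pD_lf sa]; rfl
  have e5 : rs lam k (pD 0 α) z = a z * rs lam k (pD 0 Ψ) z := by
    rw [hαd, pD_mul (Sm.lf sa) sΨ, pD_lf0 sa]; simp [rs, lf]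
  have e6 : rs lam k (ff lam k n a Ψ D u i) z = 
    n i * ((pD 0 a z * rs lam k Ψ z + a z * rs lam k D z) + ∑ j : Fin 3, u j z * rs lam k (pD j.succ.succ α) z)
  + lam⁻¹ * rs lam k (pD 1 (cc k n α i)) z
  + ∑ j : Fin 3, n j * rs lam k (pD j.succ.succ (fun y => lf (u i) y * α y)) z
  + n i * ∑ j : Fin 3, n j * rs lam k (pD j.succ.succ (fun y => lf (fun z => a z * a z) y * (Ψ y * Ψ y - 1))) z := rfl
  have e7 : rs lam k D z = rs lam k (pD 1 Ψ) z + lam * u k z * rs lam k (pD 0 Ψ) z := (hD _).symm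
  rw [e4, e5, e6, e7]
  ring
end wave
end CI

namespace CI
open scoped ContDiff Topology

section bds
variable {n : ℕ} {f g : (Fin n → ℝ) → ℝ} {A B X : ℝ} {L : Fin n → ℝ} {N : ℕ}
lemma Bd.cm1 {c : ℝ} (hc : |c| ≤ 1) (hf : Bd N A L f) (sf : Sm f) (hL : ∀ i, 0 ≤ L i) : Bd N A L (fun z => c * f z) :=
  (hf.cmul c sf).monoA (by nlinarith [hf.nonneg]) hL
lemma Bd.sum3 {F : Fin 3 → (Fin n → ℝ) → ℝ} (h : ∀ a, Bd N A L (F a)) (hs : ∀ a, Sm (F a)) (hL : ∀ i, 0 ≤ L i) :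
    Bd N (3 * A) L (fun z => ∑ a, F a z) := by
  have := Bd.sum (s := Finset.univ) (A := fun _ => A) (fun a _ => h a) (fun a _ => hs a) hL
  simpa using this
end bds

/-- weights -/
def Wm (κ : ℝ) (m : ℕ) : Fin 5 → ℝ := fun i => 2 ^ m * WY κ i

lemma Wm_nn {κ : ℝ} (hκ : 1 ≤ κ) (m i) : 0 ≤ Wm κ m i := mul_nonneg (by positivity) (WY_nonneg hκ i)
lemma Wm_le {κ : ℝ} (hκ : 1 ≤ κ) {m m' : ℕ} (h : m ≤ m') (i) : Wm κ m i ≤ Wm κ m' i :=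
  mul_le_mul_of_nonneg_right (pow_le_pow_right₀ (by norm_num) h) (WY_nonneg hκ i)
lemma Bd.up {κ : ℝ} (hκ : 1 ≤ κ) {m m' N : ℕ} {A B : ℝ} {f : YF} (hf : Bd N A (Wm κ m) f) (hA : A ≤ B) (h : m ≤ m') : Bd N B (Wm κ m') f :=
  hf.mono hA (Wm_nn hκ m) (Wm_le hκ h)
lemma Bd.mulm {κ : ℝ} (hκ : 1 ≤ κ) {m N : ℕ} {A B : ℝ} {f g : YF} (hf : Bd N A (Wm κ m) f) (hg : Bd N B (Wm κ m) g) (sf : Sm f) (sg : Sm g) :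
    Bd N (A * B) (Wm κ (m+1)) (fun y => f y * g y) := by
  have := hf.mul hg sf sg (Wm_nn hκ m)
  have e : (fun i => 2 * Wm κ m i) = Wm κ (m+1) := by funext i; unfold Wm; ring
  rwa [e] at this
lemma Wm0 (κ : ℝ) (m) : Wm κ m 0 = 2 ^ m * 2 := rfl
lemma Wm1 (κ : ℝ) (m) : Wm κ m 1 = 2 ^ m * κ ^ 34 := rfl
lemma Wmx (κ : ℝ) (m) (j : Fin 3) : Wm κ m j.succ.succ = 2 ^ m * κ ^ 10 := rfl

lemma lf_Bd {κ X : ℝ} (hκ : 1 ≤ κ) {N : ℕ} {A : ℝ} {f : ZF} (hf : Bd N A (fun _ => X) f) (hX : 0 ≤ X) (hX' : X ≤ κ ^ 10) (sf : Sm f) (m : ℕ) :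
    Bd N A (Wm κ m) (lf f) := by
  refine Bd.lf (hf.mono le_rfl (fun _ => hX) ?_) sf (Wm_nn hκ m)
  intro i
  have h2 : (1:ℝ) ≤ 2 ^ m := one_le_pow₀ (by norm_num)
  have hp : κ ^ 10 ≤ κ ^ 34 := pow_le_pow_right₀ hκ (by norm_num)
  refine Fin.cases ?_ (fun j => ?_) i
  · show X ≤ 2 ^ m * κ ^ 34
    nlinarith [pow_pos (by linarith : 0 < κ) 34]
  · show X ≤ 2 ^ m * κ ^ 10
    nlinarith [pow_pos (by linarith : 0 < κ) 10]

lemma rs_Bd {κ : ℝ} (hκ : 2 ^ 16 ≤ κ) {N : ℕ} {A : ℝ} {f : YF} {k} (hf : Bd N A (Wm κ 12) f) (sf : Sm f) :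
    Bd N A (fun _ => κ ^ 36) (rs (κ ^ 30) k f) := by
  have h1 : 1 ≤ κ := le_trans (by norm_num) hκ
  refine Bd.rs (by positivity) hf sf (Wm_nn h1 12) ?_
  intro i
  have hp : κ ^ 10 ≤ κ ^ 34 := pow_le_pow_right₀ h1 (by norm_num)
  have hi : Wm κ 12 i.succ ≤ 2 ^ 12 * κ ^ 34 := by
    refine Fin.cases le_rfl (fun j => ?_) i
    show 2 ^ 12 * κ ^ 10 ≤ _
    gcongr
  rw [Wm0]
  have hp' : κ ^ 30 ≤ κ ^ 34 := pow_le_pow_right₀ h1 (by norm_num)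
  calc Wm κ 12 i.succ + κ ^ 30 * (2 ^ 12 * 2) ≤ 2 ^ 12 * κ ^ 34 + κ ^ 34 * (2 ^ 12 * 2) := by gcongr
    _ = (2 ^ 12 * 3) * κ ^ 34 := by ring
    _ ≤ κ ^ 2 * κ ^ 34 := by gcongr; nlinarith
    _ = κ ^ 36 := by ring

section sp
variable {S : Set ℝ} {κ : ℝ} {k : Fin 3} {n : Fin 3 → ℝ} {Ψ D : YF} {a : ZF} {u : VF} {A C : ℝ}

lemma al_bd (hκ : 2 ^ 16 ≤ κ) (ha : Sm a) (hab : Bd 10 A (fun _ => κ) a) (sΨ : Sm Ψ) (hΨb : Bd 10 C (Wm κ 10) Ψ) :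
    Bd 10 (A * C) (Wm κ 11) (fun y => lf a y * Ψ y) := by
  have h1 : 1 ≤ κ := le_trans (by norm_num) hκ
  exact Bd.mulm h1 (lf_Bd h1 hab (by linarith) (le_self_pow₀ h1 (by norm_num)) ha 10) hΨb (Sm.lf ha) sΨ

lemma cc_bd (hκ : 2 ^ 16 ≤ κ) (hn1 : ∀ i, |n i| ≤ 1) {α : YF} {X : ℝ} (sα : Sm α) (hα : Bd 10 X (Wm κ 11) α) (i) :
    Bd 9 (X * κ ^ 11) (Wm κ 11) (cc k n α i) ∧ Sm (cc k n α i) := by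
  have h1 : 1 ≤ κ := le_trans (by norm_num) hκ
  have hI := hα.Ian sα 0
  have sI := sα.Ian 0
  have hX := hα.nonneg
  have hp : ∀ j : Fin 3, Bd 9 (X * (2 ^ 11 * κ ^ 10)) (Wm κ 11) (pD j.succ.succ (Ian 0 α)) := fun j => hI.pD _
  have hs := Bd.sum3 (fun j => (hp j).cm1 (hn1 j) (sI.pD _) (Wm_nn h1 11)) (fun j => (sI.pD _).cmul (n j)) (Wm_nn h1 11)
  have ss : Sm (fun y => ∑ j : Fin 3, n j * pD j.succ.succ (Ian 0 α) y) := Sm.sum (s := Finset.univ) fun j _ => (sI.pD _).cmul (n j)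
  have := ((hp k).cm1 (hn1 i) (sI.pD _) (Wm_nn h1 11)).sub (hs.cm1 (dl_abs i k) ss (Wm_nn h1 11)) ((sI.pD _).cmul _) (ss.cmul _)
  refine ⟨this.monoA ?_ (Wm_nn h1 11), ((sI.pD _).cmul _).sub (ss.cmul _)⟩
  have : X * (2 ^ 11 * κ ^ 10) + 3 * (X * (2 ^ 11 * κ ^ 10)) = X * (2 ^ 13 * κ ^ 10) := by ring
  rw [this, pow_succ κ 10, mul_comm (κ ^ 10) κ]
  gcongr
  linarith

lemma ff_bd (hκ : 2 ^ 16 ≤ κ) (hC : C ≤ κ) (hA : A ≤ κ) (hn1 : ∀ i, |n i| ≤ 1) (ha : Sm a)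
    (hab : Bd 10 A (fun _ => κ) a) (sΨ : Sm Ψ) (sD : Sm D) (hΨb : Bd 10 C (Wm κ 10) Ψ)
    (hDb : Bd 10 (κ ^ 24) (Wm κ 11) D) (su : ∀ i, Sm (u i)) (hub : ∀ i, Bd 10 κ (fun _ => κ ^ 10) (u i)) (i) :
    Bd 7 (κ ^ 26) (Wm κ 12) (ff (κ ^ 30) k n a Ψ D u i) := by
  have h1 : 1 ≤ κ := le_trans (by norm_num) hκ
  have h0 : 0 < κ := by linarith
  have hk13 : 2 ^ 12 ≤ κ := le_trans (by norm_num) hκ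
  have hA0 := hab.nonneg
  have hC0 := hΨb.nonneg
  have nn := Wm_nn h1 12
  have k10 : κ ≤ κ ^ 10 := le_self_pow₀ h1 (by norm_num)
  have la : Bd 10 A (Wm κ 10) (lf a) := lf_Bd h1 hab (by linarith) k10 ha 10
  have sla := Sm.lf ha
  have sα : Sm (fun y => lf a y * Ψ y) := sla.mul sΨ
  have hα : Bd 10 (κ ^ 2) (Wm κ 11) (fun y => lf a y * Ψ y) :=
    (al_bd hκ ha hab sΨ hΨb).monoA (by rw [sq]; gcongr) (Wm_nn h1 11)
  have hsp : ∀ (X : ℝ) (p : ℕ), 0 ≤ X → X * (2 ^ 12 * κ ^ 10) ≤ X * κ ^ 11 := by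
    intro X p hX; rw [pow_succ κ 10, mul_comm (κ ^ 10) κ]; gcongr
  have lu : ∀ j, Bd 10 κ (Wm κ 11) (lf (u j)) := fun j => lf_Bd h1 (hub j) (by positivity) le_rfl (su j) 11
  -- first term
  have t1 : Bd 7 (κ ^ 3) (Wm κ 12) (fun y => lf (pD 0 a) y * Ψ y) :=
    ((lf_Bd h1 (hab.pD 0) (by linarith) k10 (ha.pD 0) 10).mulm h1 (hΨb.ord (by norm_num)) (Sm.lf (ha.pD 0)) sΨ).ord
      (by norm_num) |>.up h1 (by calc A * κ * C ≤ κ * κ * κ := by gcongr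
                                  _ = κ ^ 3 := by ring) (by norm_num)
  have t2 : Bd 7 (κ ^ 25) (Wm κ 12) (fun y => lf a y * D y) :=
    ((la.up h1 le_rfl (by norm_num : 10 ≤ 11)).mulm h1 hDb sla sD).ord (by norm_num) |>.up h1 (by
      calc A * κ ^ 24 ≤ κ * κ ^ 24 := by gcongr
        _ = κ ^ 25 := by ring) (by norm_num)
  have t3 : ∀ j : Fin 3, Bd 7 (κ ^ 14) (Wm κ 12) (fun y => lf (u j) y * pD j.succ.succ (fun y => lf a y * Ψ y) y) := by
    intro j
    refine (((lu j).ord (by norm_num : 9 ≤ 10)).mulm h1 (hα.pD j.succ.succ) (Sm.lf (su j)) (sα.pD _)).ord (by norm_num) |>.up h1 ?_ le_rfl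
    rw [Wmx]
    calc κ * (κ ^ 2 * (2 ^ 11 * κ ^ 10)) ≤ κ * (κ ^ 2 * (κ * κ ^ 10)) := by gcongr; linarith
      _ = κ ^ 14 := by ring
  obtain ⟨hc, sc⟩ := cc_bd (k := k) hκ hn1 sα hα i
  have t4 : Bd 7 (κ ^ 18) (Wm κ 12) (fun y => (κ ^ 30)⁻¹ * pD 1 (cc k n (fun y => lf a y * Ψ y) i) y) := by
    refine (((hc.pD 1).cmul _ (sc.pD 1)).ord (by norm_num)).up h1 ?_ (by norm_num)
    rw [Wm1, abs_of_pos (by positivity)]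
    calc (κ ^ 30)⁻¹ * (κ ^ 2 * κ ^ 11 * (2 ^ 11 * κ ^ 34)) ≤ (κ ^ 30)⁻¹ * (κ ^ 2 * κ ^ 11 * (κ * κ ^ 34)) := by gcongr; linarith
      _ = κ ^ 18 := by field_simp
  have s5 : Sm (fun y => lf (u i) y * (lf a y * Ψ y)) := (Sm.lf (su i)).mul sα
  have t5 : ∀ j : Fin 3, Bd 7 (κ ^ 14) (Wm κ 12) (fun y => n j * pD j.succ.succ (fun y => lf (u i) y * (lf a y * Ψ y)) y) := by
    intro j
    have := ((lu i).mulm h1 hα (Sm.lf (su i)) sα).pD j.succ.succ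
    refine ((this.cm1 (hn1 j) (s5.pD _) nn).ord (by norm_num)).up h1 ?_ le_rfl
    rw [Wmx]
    calc κ * κ ^ 2 * (2 ^ 12 * κ ^ 10) ≤ κ * κ ^ 2 * (κ * κ ^ 10) := by gcongr
      _ = κ ^ 14 := by ring
  have sP : Sm (fun y => Ψ y * Ψ y - 1) := (sΨ.mul sΨ).sub (Sm.const 1)
  have saa : Sm (fun z => a z * a z) := ha.mul ha
  have s6 : Sm (fun y => lf (fun z => a z * a z) y * (Ψ y * Ψ y - 1)) := (Sm.lf saa).mul sP
  have baa : Bd 10 (A * A) (Wm κ 11) (lf (fun z => a z * a z)) := by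
    refine lf_Bd h1 (hab.mul hab ha ha (fun _ => by linarith)) (by linarith) ?_ saa 11
    calc 2 * κ ≤ κ * κ := by gcongr; linarith
      _ = κ ^ 2 := by ring
      _ ≤ κ ^ 10 := pow_le_pow_right₀ h1 (by norm_num)
  have bP : Bd 10 (C * C + 1) (Wm κ 11) (fun y => Ψ y * Ψ y - 1) :=
    (hΨb.mulm h1 hΨb sΨ sΨ).sub (Bd.const (by simp) (Wm_nn h1 11)) (sΨ.mul sΨ) (Sm.const 1)
  have t6 : ∀ j : Fin 3, Bd 7 (κ ^ 16) (Wm κ 12) (fun y => n j * pD j.succ.succ (fun y => lf (fun z => a z * a z) y * (Ψ y * Ψ y - 1)) y) := by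
    intro j
    have := (baa.mulm h1 bP (Sm.lf saa) sP).pD j.succ.succ
    refine ((this.cm1 (hn1 j) (s6.pD _) nn).ord (by norm_num)).up h1 ?_ le_rfl
    rw [Wmx]
    have h3 : C * C + 1 ≤ κ ^ 3 := by
      calc C * C + 1 ≤ κ * κ + κ * κ := by gcongr; nlinarith
        _ = 2 * (κ * κ) := by ring
        _ ≤ κ * (κ * κ) := by gcongr; linarith
        _ = κ ^ 3 := by ring
    calc A * A * (C * C + 1) * (2 ^ 12 * κ ^ 10) ≤ κ * κ * κ ^ 3 * (κ * κ ^ 10) := by gcongr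
      _ = κ ^ 16 := by ring
  have st1 : Sm (fun y => lf (pD 0 a) y * Ψ y) := (Sm.lf (ha.pD 0)).mul sΨ
  have st2 : Sm (fun y => lf a y * D y) := sla.mul sD
  have st3 : ∀ j : Fin 3, Sm (fun y => lf (u j) y * pD j.succ.succ (fun y => lf a y * Ψ y) y) := fun j => (Sm.lf (su j)).mul (sα.pD _)
  have b1 := ((t1.add t2 st1 st2).add (Bd.sum3 t3 st3 nn) (st1.add st2) (Sm.sum (s := Finset.univ) fun j _ => st3 j)).cm1 (hn1 i)
     ((st1.add st2).add (Sm.sum (s := Finset.univ) fun j _ => st3 j)) nn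
  have sb1 := ((st1.add st2).add (Sm.sum (s := Finset.univ) fun j _ => st3 j)).cmul (n i)
  have st4 := (sc.pD 1).cmul (κ ^ 30)⁻¹
  have st5 := fun j : Fin 3 => (s5.pD j.succ.succ).cmul (n j)
  have st6 := fun j : Fin 3 => (s6.pD j.succ.succ).cmul (n j)
  have b2 := b1.add t4 sb1 st4
  have b3 := b2.add (Bd.sum3 t5 st5 nn) (sb1.add st4) (Sm.sum (s := Finset.univ) fun j _ => st5 j)
  have b4 := b3.add ((Bd.sum3 t6 st6 nn).cm1 (hn1 i) (Sm.sum (s := Finset.univ) fun j _ => st6 j) nn) ((sb1.add st4).add (Sm.sum fun j _ => st5 j))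
    ((Sm.sum (s := Finset.univ) fun j _ => st6 j).cmul _)
  refine b4.monoA ?_ nn
  have p1 : κ ^ 3 ≤ κ ^ 25 := pow_le_pow_right₀ h1 (by norm_num)
  have p2 : κ ^ 14 ≤ κ ^ 25 := pow_le_pow_right₀ h1 (by norm_num)
  have p3 : κ ^ 18 ≤ κ ^ 25 := pow_le_pow_right₀ h1 (by norm_num)
  have p4 : κ ^ 16 ≤ κ ^ 25 := pow_le_pow_right₀ h1 (by norm_num)
  have p0 : 0 ≤ κ ^ 25 := by positivity
  have p5 : 13 * κ ^ 25 ≤ κ ^ 26 := by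
    rw [pow_succ κ 25, mul_comm (κ ^ 25) κ]; gcongr; linarith
  linarith
end sp
end CI

namespace CI
open scoped ContDiff Topology

lemma pbd {κ X Y Z : ℝ} (hκ : 2 ≤ κ) {N : ℕ} {f g : ZF} (hf : Bd N X (fun _ => κ ^ 36) f) (hg : Bd N Y (fun _ => κ ^ 36) g)
    (sf : Sm f) (sg : Sm g) (h : X * Y ≤ Z) : Bd N Z (fun _ => κ ^ 37) (fun z => f z * g z) := by
  refine (hf.mul hg sf sg (fun _ => by positivity)).mono h (fun _ => by positivity) (fun _ => ?_)
  calc 2 * κ ^ 36 ≤ κ * κ ^ 36 := by gcongr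
    _ = κ ^ 37 := by ring

lemma Bd.b37 {κ X Z : ℝ} (hκ : 2 ≤ κ) {N : ℕ} {f : ZF} (hf : Bd N X (fun _ => κ ^ 36) f) (h : X ≤ Z) : Bd N Z (fun _ => κ ^ 37) f :=
  hf.mono h (fun _ => by positivity) (fun _ => pow_le_pow_right₀ (by linarith) (by norm_num))

/-- interaction error -/
def E1 (v u wp wc : VF) : TF := fun i j z =>
  (v i z - u i z) * (wp j z + wc j z) + (wp i z + wc i z) * (v j z - u j z) + u i z * wc j z + wc i z * u j z
    + wp i z * wc j z + wc i z * wp j z + wc i z * wc j z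

lemma E1_bd {κ : ℝ} (hκ : 2 ^ 16 ≤ κ) {v u wp wc : VF} (sv : ∀ i, Sm (v i)) (su : ∀ i, Sm (u i)) (sp : ∀ i, Sm (wp i)) (sc : ∀ i, Sm (wc i))
    (hvu : ∀ i, Bd 1 (40 * κ⁻¹ ^ 5) (fun _ => κ ^ 36) (fun z => v i z - u i z)) (hu : ∀ i, Bd 1 κ (fun _ => κ ^ 36) (u i))
    (hp : ∀ i, Bd 1 (κ ^ 2) (fun _ => κ ^ 36) (wp i)) (hc : ∀ i, Bd 1 (κ⁻¹ ^ 17) (fun _ => κ ^ 36) (wc i)) (i j) :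
    Bd 1 (9 * κ⁻¹ ^ 2) (fun _ => κ ^ 37) (E1 v u wp wc i j) := by
  have h2 : 2 ≤ κ := le_trans (by norm_num) hκ
  have h0 : 0 < κ := by linarith
  set q := κ⁻¹ with hq
  have hq0 : 0 < q := by positivity
  have hqk : q * κ = 1 := by rw [hq]; field_simp
  have hq1 : q * 2 ^ 16 ≤ 1 := by rw [← hqk]; gcongr
  have hq1' : q ≤ 1 := by linarith
  have hq17 : q ^ 17 ≤ q ^ 3 := pow_le_pow_of_le_one hq0.le hq1' (by norm_num)
  have hk2 : κ ^ 2 ≥ 1 := one_le_pow₀ (by linarith)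
  have hw : ∀ i, Bd 1 (2 * κ ^ 2) (fun _ => κ ^ 36) (fun z => wp i z + wc i z) := fun i => by
    refine ((hp i).add (hc i) (sp i) (sc i)).monoA ?_ (fun _ => by positivity)
    have : q ^ 17 ≤ 1 := pow_le_one₀ hq0.le hq1'
    linarith
  have sw := fun i => (sp i).add (sc i)
  have sd := fun i => (sv i).sub (su i)
  have e1 : 40 * q ^ 5 * (2 * κ ^ 2) ≤ q ^ 2 := by
    calc 40 * q ^ 5 * (2 * κ ^ 2) = (80 * q) * (q * κ) ^ 2 * q ^ 2 := by ring
      _ ≤ 1 * q ^ 2 := by rw [hqk]; gcongr; linarith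
      _ = _ := one_mul _
  have e2 : q ^ 17 * κ ≤ q ^ 2 := by
    calc q ^ 17 * κ ≤ q ^ 3 * κ := by gcongr
      _ = q ^ 2 * (q * κ) := by ring
      _ = _ := by rw [hqk, mul_one]
  have e3 : q ^ 17 * κ ^ 2 ≤ q ^ 2 := by
    have : q ^ 17 ≤ q ^ 4 := pow_le_pow_of_le_one hq0.le hq1' (by norm_num)
    calc q ^ 17 * κ ^ 2 ≤ q ^ 4 * κ ^ 2 := by gcongr
      _ = q ^ 2 * (q * κ) ^ 2 := by ring
      _ = _ := by rw [hqk]; ring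
  have e4 : q ^ 17 * q ^ 17 ≤ q ^ 2 := by
    rw [← pow_add]; exact pow_le_pow_of_le_one hq0.le hq1' (by norm_num)
  have b1 := pbd (Z := q ^ 2) h2 (hvu i) (hw j) (sd i) (sw j) e1
  have b2 := pbd (Z := q ^ 2) h2 (hw i) (hvu j) (sw i) (sd j) (by rw [mul_comm]; exact e1)
  have b3 := pbd (Z := q ^ 2) h2 (hu i) (hc j) (su i) (sc j) (by rw [mul_comm]; exact e2)
  have b4 := pbd (Z := q ^ 2) h2 (hc i) (hu j) (sc i) (su j) e2
  have b5 := pbd (Z := q ^ 2) h2 (hp i) (hc j) (sp i) (sc j) (by rw [mul_comm]; exact e3)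
  have b6 := pbd (Z := q ^ 2) h2 (hc i) (hp j) (sc i) (sp j) e3
  have b7 := pbd (Z := q ^ 2) h2 (hc i) (hc j) (sc i) (sc j) e4
  have s1 := (sd i).mul (sw j)
  have s2 := (sw i).mul (sd j)
  have s3 := (su i).mul (sc j)
  have s4 := (sc i).mul (su j)
  have s5 := (sp i).mul (sc j)
  have s6 := (sc i).mul (sp j)
  have s7 := (sc i).mul (sc j)
  have B2 := b1.add b2 s1 s2
  have B3 := B2.add b3 (s1.add s2) s3
  have B4 := B3.add b4 ((s1.add s2).add s3) s4
  have B5 := B4.add b5 (((s1.add s2).add s3).add s4) s5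
  have B6 := B5.add b6 ((((s1.add s2).add s3).add s4).add s5) s6
  have B7 := B6.add b7 (((((s1.add s2).add s3).add s4).add s5).add s6) s7
  refine Bd.monoA B7 ?_ (fun _ => by positivity)
  have : 0 ≤ q ^ 2 := by positivity
  linarith

lemma E1_GZ {S : Set ℝ} {v u wp wc : VF} (hv : ∀ i, GZ ∅ (v i)) (hu : ∀ i, GZ ∅ (u i)) (hp : ∀ i, GZ S (wp i)) (hc : ∀ i, GZ S (wc i)) (i j) :
    GZ S (E1 v u wp wc i j) := by
  have d := fun i => (hv i).sub (hu i)
  have w := fun i => (hp i).add (hc i)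
  exact ((((((GZ.mulR (d i) (w j)).add (GZ.mulL (w i) (d j))).add (GZ.mulR (hu i) (hc j))).add (GZ.mulL (hc i) (hu j))).add
    (GZ.mulL (hp i) (GZe (hc j)))).add (GZ.mulL (hc i) (GZe (hp j)))).add (GZ.mulL (hc i) (GZe (hc j)))

lemma E1_symm (v u wp wc : VF) (i j) : E1 v u wp wc i j = E1 v u wp wc j i := by
  funext z; simp only [E1]; ring

lemma substep {C : ℝ} (hC1 : 1 ≤ C) (hC : ∀ Y, Bd 11 C (WG Y) (G0 Y) ∧ Bd 11 C (WG Y) (G1 Y)) {κ : ℕ} (hκ : 2 ^ 16 ≤ κ) (hCκ : C ≤ κ)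
    {S : Set ℝ} (hS : IsOpen S) {v : VF} (hv : ∀ i, GZ ∅ (v i)) (hdiv : ∀ z, ∑ i : Fin 3, pD i.succ (v i) z = 0)
    (hv0 : ∀ i z, |v i z| ≤ κ) (hv1 : ∀ j i z, |pD j (v i) z| ≤ κ) {a : ZF} (ha : GZ S a) {A : ℝ} (hA : A ≤ κ)
    (hab : Bd 10 A (fun _ => (κ:ℝ)) a) {n : Fin 3 → ℝ} {k : Fin 3} (hn : n k = 0) (hn1 : ∀ i, |n i| ≤ 1) :
    ∃ (w : VF) (E : TF), (∀ i, GZ S (w i)) ∧ (∀ i j, GZ S (E i j)) ∧ (∀ i j, E i j = E j i) ∧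
      (∀ z, ∑ i : Fin 3, pD i.succ (w i) z = 0) ∧
      (∀ i z, pD 0 (w i) z + dv (fun i j z => v i z * w j z + w i z * v j z + w i z * w j z - a z * a z * (n i * n j)) i z = dv E i z) ∧
      (∀ i, Bd 1 (2 * C * A) (fun _ => (κ:ℝ) ^ 37) (w i)) ∧ (∀ i j, Bd 1 ((κ:ℝ)⁻¹) (fun _ => (κ:ℝ) ^ 37) (E i j)) := by
  have hk : ((2:ℝ) ^ 16) ≤ κ := by exact_mod_cast hκ
  have h2 : (2:ℝ) ≤ κ := le_trans (by norm_num) hk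
  have h1 : (1:ℝ) ≤ κ := by linarith
  have h0 : (0:ℝ) < κ := by linarith
  have hA0 : 0 ≤ A := hab.nonneg
  have nn36 : ∀ i : Fin 4, (0:ℝ) ≤ (fun _ => (κ:ℝ) ^ 36) i := fun _ => by positivity
  set q := (κ:ℝ)⁻¹ with hq
  have hq0 : 0 < q := by positivity
  have hqk : q * κ = 1 := by rw [hq]; field_simp
  have hq16 : q * 2 ^ 16 ≤ 1 := by rw [← hqk]; gcongr
  have hq1' : q ≤ 1 := by linarith
  -- mollification
  set l : ℝ := q ^ 6 with hl
  have hl0 : 0 < l := by positivity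
  have h2l : 2 / l ≤ (κ:ℝ) ^ 10 := by
    have : 2 / l = 2 * (κ:ℝ) ^ 6 := by rw [hl, hq]; field_simp
    rw [this]
    calc 2 * (κ:ℝ) ^ 6 ≤ κ * (κ:ℝ) ^ 6 := by gcongr
      _ = (κ:ℝ) ^ 7 := by ring
      _ ≤ _ := pow_le_pow_right₀ h1 (by norm_num)
  have h2l0 : 0 ≤ 2 / l := by positivity
  set u : VF := fun i => mol 10 l (v i) with hu
  have sv := fun i => (hv i).sm
  have gu : ∀ i, GZ ∅ (u i) := fun i => GZ.mol (hv i) hl0.le (fun t ht => ht.elim)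
  have su := fun i => (gu i).sm
  have ub : ∀ i, Bd 10 (κ:ℝ) (fun _ => (κ:ℝ) ^ 10) (u i) := fun i =>
    (Bd.mol_gain (hv0 i) (sv i) hl0 10).mono le_rfl (fun _ => h2l0) (fun _ => h2l)
  have pub : ∀ j i, Bd 10 (κ:ℝ) (fun _ => (κ:ℝ) ^ 10) (pD j (u i)) := fun j i => by
    rw [hu]; simp only []; rw [pD_mol (sv i)]
    exact (Bd.mol_gain (hv1 j i) ((sv i).pD j) hl0 10).mono le_rfl (fun _ => h2l0) (fun _ => h2l)
  have udiv : ∀ z, ∑ i : Fin 3, pD i.succ (u i) z = 0 := by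
    have e : (fun z => ∑ i : Fin 3, pD i.succ (v i) z) = fun _ => 0 := funext hdiv
    have := mol_sum (N := 10) (l := l) (s := Finset.univ) (F := fun i : Fin 3 => pD i.succ (v i)) (fun i _ => (sv i).pD _)
    rw [e, mol_zero] at this
    intro z
    have := congrFun this z
    simp only [hu]
    rw [Finset.sum_congr rfl (fun i _ => congrFun (pD_mol (sv i) i.succ) z)]
    exact this.symm
  have duv : ∀ i, Bd 1 (40 * q ^ 5) (fun _ => (κ:ℝ) ^ 36) (fun z => v i z - u i z) := by
    intro i
    refine ⟨fun z => ?_, fun j z => ?_⟩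
    · rw [abs_sub_comm]
      refine (mol_err (sv i) hl0.le (fun j => hv1 j i) 10 z).trans (le_of_eq ?_)
      rw [hl]; push_cast
      calc 4 * 10 * q ^ 6 * (κ:ℝ) = 40 * q ^ 5 * (q * κ) := by ring
        _ = _ := by rw [hqk, mul_one]
    · rw [pD_sub (sv i) (su i)]
      refine (abs_sub _ _).trans ?_
      have := hv1 j i z
      have := (pub j i).le z
      calc _ ≤ (κ:ℝ) + κ := by linarith
        _ ≤ 40 * (κ:ℝ) ^ 31 := by
          have := pow_le_pow_right₀ h1 (show 1 ≤ 31 by norm_num)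
          have : (κ:ℝ) ≤ (κ:ℝ)^31 := by simpa using this
          linarith
        _ = 40 * (q * κ) ^ 5 * (κ:ℝ) ^ 31 := by rw [hqk]; ring
        _ = _ := by ring
  obtain ⟨Ψ, D, gΨ, sD, Ψ0, Ψ2, hD, bΨ, bD⟩ := profile hC1 hC (le_trans (by norm_num) hκ) hCκ (gu k) (fun z => (ub k).le z) (fun j => pub j k)
  have mΨ : Mz ∅ Ψ := ⟨gΨ, Ψ0⟩
  have sΨ := gΨ.sm
  set α : YF := fun y => lf a y * Ψ y with hα
  have mα : Mz S α := Mz.lfL ha mΨ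
  have sα := mα.gy.sm
  have bα : Bd 10 (A * C) (Wm κ 11) α := al_bd hk ha.sm hab sΨ bΨ
  have hAC : A * C ≤ (κ:ℝ) ^ 2 := by
    calc A * C ≤ κ * κ := by gcongr
      _ = _ := by ring
  set lam : ℝ := (κ:ℝ) ^ 30 with hlam
  have hlam0 : 0 < lam := by positivity
  have hlm : ((κ ^ 30 : ℕ) : ℝ) = lam := by push_cast; rfl
  set wp : VF := fun i z => n i * rs lam k α z with hwp
  set wc : VF := fun i z => lam⁻¹ * rs lam k (cc k n α i) z with hwc
  have gr : ∀ {f : YF}, GY S f → GZ S (rs lam k f) := fun {f} h => by rw [← hlm]; exact GZ.rs h k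
  have mc := fun i => cc_Mz (k := k) (n := n) hS mα i
  have gp : ∀ i, GZ S (wp i) := fun i => (gr mα.gy).cmul _
  have gc : ∀ i, GZ S (wc i) := fun i => (gr (mc i).gy).cmul _
  have sp := fun i => (gp i).sm
  have sc := fun i => (gc i).sm
  set w : VF := wv lam k n α with hw
  have hwe : ∀ i z, w i z = wp i z + wc i z := fun i z => rfl
  have gw : ∀ i, GZ S (w i) := fun i => (gp i).add (gc i)
  have sw := fun i => (gw i).sm
  have bwp : ∀ i, Bd 1 (A * C) (fun _ => (κ:ℝ) ^ 36) (wp i) := fun i =>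
    ((rs_Bd hk (bα.up h1 le_rfl (by norm_num)) sα).cm1 (hn1 i) (sα.rs _ _) nn36).ord (by norm_num)
  have bwc : ∀ i, Bd 1 ((A * C) * q ^ 19) (fun _ => (κ:ℝ) ^ 36) (wc i) := fun i => by
    have := (rs_Bd (k := k) hk ((cc_bd (k := k) hk hn1 sα bα i).1.up h1 le_rfl (show 11 ≤ 12 by norm_num)) (mc i).gy.sm).cmul lam⁻¹ ((mc i).gy.sm.rs _ _)
    refine (this.ord (by norm_num)).monoA (le_of_eq ?_) nn36
    rw [abs_of_pos (by positivity), hlam, hq]; field_simp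
  have bwc' : ∀ i, Bd 1 (q ^ 17) (fun _ => (κ:ℝ) ^ 36) (wc i) := fun i => (bwc i).monoA (by
    calc A * C * q ^ 19 ≤ (κ:ℝ) ^ 2 * q ^ 19 := by gcongr
      _ = (q * κ) ^ 2 * q ^ 17 := by ring
      _ = _ := by rw [hqk]; ring) nn36
  have bw : ∀ i, Bd 1 (2 * C * A) (fun _ => (κ:ℝ) ^ 37) (w i) := fun i => by
    refine ((bwp i).add (bwc i) (sp i) (sc i)).b37 h2 ?_
    have : q ^ 19 ≤ 1 := pow_le_one₀ hq0.le hq1'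
    have h3 : A * C * q ^ 19 ≤ A * C * 1 := by gcongr
    linarith
  have bE1 := E1_bd hk sv su sp sc duv (fun i => ((ub i).ord (by norm_num : 1 ≤ 10)).mono le_rfl (fun _ => by positivity)
    (fun _ => pow_le_pow_right₀ h1 (by norm_num))) (fun i => (bwp i).monoA hAC nn36) bwc'
  have gE1 := E1_GZ hv gu gp gc
  -- oscillatory part
  have mf := fun i => ff_Mz (k := k) (n := n) hS ha mΨ Ψ2 gu hD i
  have bf := fun i => ff_bd (k := k) (n := n) hk hCκ hA hn1 ha.sm hab sΨ sD bΨ bD su ub i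
  have hW12 : ∀ i, 0 ≤ Wm κ 12 i := Wm_nn h1 12
  have hΛ : ∀ j : Fin 3, Wm κ 12 j.succ.succ ≤ (κ:ℝ) ^ 11 := fun j => by
    rw [Wmx]
    calc 2 ^ 12 * (κ:ℝ) ^ 10 ≤ κ * (κ:ℝ) ^ 10 := by gcongr; exact le_trans (by norm_num) hk
      _ = _ := by ring
  have e9 : 9 * (κ:ℝ) ^ 11 / lam = 9 * q ^ 19 := by rw [hlam, hq]; field_simp
  have q19 : q ^ 19 ≤ q := by simpa using pow_le_pow_of_le_one hq0.le hq1' (show 1 ≤ 19 by norm_num)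
  obtain ⟨T, h, gT, syT, gh, bT, bh, hTh⟩ := HF (N := 2) hS hW12 hΛ hlam0 (by rw [e9]; linarith) k 5 (ff lam k n a Ψ D u) ((κ:ℝ) ^ 26)
    (fun i => (mf i).gy) (fun i => (mf i).mz) bf
  rw [e9] at bh
  have gTz : ∀ i j, GZ S (rs lam k (T i j)) := fun i j => gr (gT i j)
  have ghz : ∀ i, GZ S (rs lam k (h i)) := fun i => gr (gh i)
  have bhz : ∀ i, Bd 2 ((κ:ℝ) ^ 26 * (9 * q ^ 19) ^ 5) (fun _ => (κ:ℝ) ^ 36) (rs lam k (h i)) := fun i => rs_Bd hk (bh i) (gh i).sm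
  have bTz : ∀ i j, Bd 1 (6 * (κ:ℝ) ^ 26 / lam) (fun _ => (κ:ℝ) ^ 36) (rs lam k (T i j)) := fun i j => (rs_Bd hk (bT i j) (gT i j).sm).ord (by norm_num)
  set F : TF := fun i j z => u i z * (n j * rs lam k α z) + (n i * rs lam k α z) * u j z
        + (n i * rs lam k α z) * (n j * rs lam k α z) - a z * a z * (n i * n j) with hF
  have gF : ∀ i j, GZ S (F i j) := fun i j =>
    (((GZ.mulR (gu i) (gp j)).add (GZ.mulL (gp i) (gu j))).add (GZ.mulL (gp i) (GZe (gp j)))).sub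
      (GZ.mulL (GZ.mulL ha (GZe ha)) (Gd.const (n i * n j)))
  have key : ∀ i z, pD 0 (w i) z + dv F i z = rs lam k (ff lam k n a Ψ D u i) z := fun i z =>
    rs_ff hn hS ha mΨ gu hD udiv i z
  have key2 : ∀ i, rs lam k (h i) = fun z => (pD 0 (w i) z + dv F i z) + (- dv (fun i j => rs lam k (T i j)) i z) := fun i => by
    funext z
    rw [key, congrFun (hTh i) z]; ring
  have mw : ∀ i, mn (w i) = fun _ => 0 := fun i => by
    have := wv_mn (m := κ ^ 30) (by rw [hlm]; exact hlam0.ne') hn mα i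
    rw [hlm] at this; exact this
  have mh : ∀ i, mn (rs lam k (h i)) = fun _ => 0 := fun i => by
    rw [key2]
    have sF : Sm (dv F i) := Sm.dv (fun i j => (gF i j).sm) i
    have sT : Sm (dv (fun i j => rs lam k (T i j)) i) := Sm.dv (fun i j => (gTz i j).sm) i
    rw [mn_add (((sw i).pD 0).add sF) sT.neg, mn_add ((sw i).pD 0) sF, mn_neg, mn_dv gF i, mn_dv gTz i, mn_pD (sw i), mw, pD_const]
    simp
  set Z : TF := Rz (fun i => rs lam k (h i)) with hZ
  have gZ : ∀ i j, GZ S (Z i j) := GZ.Rz hS ghz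
  have dZ : ∀ i, dv Z i = rs lam k (h i) := dv_Rz hS ghz mh
  have bZ : ∀ i j, Bd 1 (15 * ((κ:ℝ) ^ 26 * (9 * q ^ 19) ^ 5) * (κ:ℝ) ^ 36) (fun _ => (κ:ℝ) ^ 36) (Z i j) := fun i j =>
    Bd.Rz (fun i => (ghz i).sm) bhz nn36 (fun _ => le_rfl) (one_le_pow₀ h1) i j
  refine ⟨w, fun i j z => E1 v u wp wc i j z + rs lam k (T i j) z + Z i j z, gw,
    fun i j => ((gE1 i j).add (gTz i j)).add (gZ i j), fun i j => ?_, ?_, ?_, bw, fun i j => ?_⟩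
  · funext z
    show E1 v u wp wc i j z + rs lam k (T i j) z + Z i j z = E1 v u wp wc j i z + rs lam k (T j i) z + Z j i z
    rw [E1_symm, syT, hZ, Rz_symm]
  · exact wv_div hlam0.ne' hn mα
  · intro i z
    have e : (fun (i j : Fin 3) (z : Fin 4 → ℝ) => v i z * w j z + w i z * v j z + w i z * w j z - a z * a z * (n i * n j)) =
        fun i j z => F i j z + E1 v u wp wc i j z := by
      funext i j z
      simp only [hwe, hF, E1, hwp]; ring
    have sF := fun i j => (gF i j).sm
    have sE := fun i j => (gE1 i j).sm
    have sT := fun i j => (gTz i j).sm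
    have sZ := fun i j => (gZ i j).sm
    rw [e, dv_add sF sE, dv_add (fun i j => (sE i j).add (sT i j)) sZ, dv_add sE sT, dZ, key2]
    ring
  · have sE := (gE1 i j).sm
    have sT := (gTz i j).sm
    have sZ := (gZ i j).sm
    have d1 : 6 * (κ:ℝ) ^ 26 / lam ≤ q ^ 2 := by
      have : 6 * (κ:ℝ) ^ 26 / lam = 6 * q ^ 4 := by rw [hlam, hq]; field_simp
      rw [this]
      have h6 : 6 * q ^ 2 ≤ 1 := by
        have : q ^ 2 ≤ q := by simpa using pow_le_pow_of_le_one hq0.le hq1' (show 1 ≤ 2 by norm_num)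
        linarith
      calc 6 * q ^ 4 = (6 * q ^ 2) * q ^ 2 := by ring
        _ ≤ 1 * q ^ 2 := by gcongr
        _ = _ := one_mul _
    have d2 : 15 * ((κ:ℝ) ^ 26 * (9 * q ^ 19) ^ 5) * (κ:ℝ) ^ 36 ≤ q ^ 2 := by
      calc 15 * ((κ:ℝ) ^ 26 * (9 * q ^ 19) ^ 5) * (κ:ℝ) ^ 36 = (15 * 9 ^ 5) * q ^ 31 * (q * κ) ^ 62 * q ^ 2 := by ring
        _ ≤ 2 ^ 32 * q ^ 2 * 1 * q ^ 2 := by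
          rw [hqk, one_pow]
          have : q ^ 31 ≤ q ^ 2 := pow_le_pow_of_le_one hq0.le hq1' (by norm_num)
          gcongr; norm_num
        _ = (q * 2 ^ 16) ^ 2 * q ^ 2 := by ring
        _ ≤ 1 ^ 2 * q ^ 2 := by gcongr
        _ = _ := by ring
    refine (((bE1 i j).add ((bTz i j).b37 h2 d1) sE sT).add ((bZ i j).b37 h2 d2) (sE.add sT) sZ).monoA ?_ (fun _ => by positivity)
    calc 9 * q ^ 2 + q ^ 2 + q ^ 2 = (11 * q) * q := by ring
      _ ≤ 1 * q := by gcongr; linarith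
      _ = _ := one_mul _
end CI

namespace CI
open scoped ContDiff Topology

lemma substeps {C : ℝ} (hC1 : 1 ≤ C) (hC : ∀ Y, Bd 11 C (WG Y) (G0 Y) ∧ Bd 11 C (WG Y) (G1 Y)) {κ : ℕ} (hκ : 2 ^ 16 ≤ κ) (hCκ : C ≤ κ)
    {S : Set ℝ} (hS : IsOpen S) {v : VF} (hv : ∀ i, GZ ∅ (v i)) (hdiv : ∀ z, ∑ i : Fin 3, pD i.succ (v i) z = 0)
    (hv0 : ∀ i z, |v i z| ≤ κ) (hv1 : ∀ j i z, |pD j (v i) z| ≤ κ) {a : ℕ → ZF} (ha : ∀ r, GZ S (a r)) {A : ℝ} (hA : 4 * C * A ≤ κ)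
    (hab : ∀ r, Bd 10 A (fun _ => (κ:ℝ)) (a r)) {n : ℕ → Fin 3 → ℝ} {k : ℕ → Fin 3} (hn : ∀ r, n r (k r) = 0) (hn1 : ∀ r i, |n r i| ≤ 1) (m : ℕ) :
    ∃ (v' : VF) (E : TF), (∀ i, GZ ∅ (v' i)) ∧ (∀ z, ∑ i : Fin 3, pD i.succ (v' i) z = 0) ∧
      (∀ i, GZ S (fun z => v' i z - v i z)) ∧ (∀ i j, GZ S (E i j)) ∧ (∀ i j, E i j = E j i) ∧
      (∀ i z, pD 0 (v' i) z + dv (fun i j z => v' i z * v' j z - ∑ r ∈ Finset.range m, a r z * a r z * (n r i * n r j)) i z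
        = pD 0 (v i) z + dv (fun i j z => v i z * v j z) i z + dv E i z) ∧
      (∀ i z, |v' i z - v i z| ≤ m * (2 * C * A)) ∧ (∀ i z, |v' i z| ≤ (κ:ℝ) ^ (38 ^ m)) ∧
      (∀ j i z, |pD j (v' i) z| ≤ (κ:ℝ) ^ (38 ^ m)) ∧ (∀ i j z, |E i j z| ≤ m * (κ:ℝ)⁻¹) ∧
      (∀ l i j z, |pD l (E i j) z| ≤ m * (κ:ℝ) ^ (38 ^ m)) := by
  have hk : ((2:ℝ) ^ 16) ≤ κ := by exact_mod_cast hκ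
  have h1 : (1:ℝ) ≤ κ := le_trans (by norm_num) hk
  have h0 : (0:ℝ) < κ := by linarith
  have hA0 : 0 ≤ A := (hab 0).nonneg
  have hAk : A ≤ κ := by nlinarith
  induction m with
  | zero =>
    refine ⟨v, fun _ _ _ => 0, hv, hdiv, fun i => ?_, fun _ _ => Gd.zero, fun _ _ => rfl, fun i z => ?_, by simp, by simpa using hv0,
      by simpa using hv1, by simp, fun l i j z => ?_⟩
    · simp only [sub_self]; exact Gd.zero
    · simp [dv, pD_const]
    · simp [pD_const]
  | succ m ih =>
    obtain ⟨v1, E1, g1, d1, gd1, gE1, sy1, eq1, b1, bv1, bdv1, bE1, bdE1⟩ := ih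
    set K : ℕ := κ ^ (38 ^ m) with hK
    have hKr : (K:ℝ) = (κ:ℝ) ^ (38 ^ m) := by rw [hK]; push_cast; rfl
    rw [← hKr] at bv1 bdv1 bdE1
    have hκK : κ ≤ K := by rw [hK]; exact Nat.le_self_pow (by positivity) κ
    have hκK' : (κ:ℝ) ≤ K := by exact_mod_cast hκK
    obtain ⟨w, E, gw, gE, sy, dw, eqw, bw, bE⟩ := substep hC1 hC (hκ.trans hκK) (hCκ.trans hκK') hS g1 d1 bv1 bdv1 (ha m) (hAk.trans hκK')
      ((hab m).mono le_rfl (fun _ => h0.le) (fun _ => hκK')) (hn m) (hn1 m)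
    have hK38 : (κ:ℝ) ^ (38 ^ (m+1)) = (K:ℝ) ^ 38 := by rw [hKr, ← pow_mul]; congr 1
    have hK1 : (1:ℝ) ≤ K := h1.trans hκK'
    have hK2 : (2:ℝ) ≤ K := le_trans (by linarith) hκK'
    have h2K : 2 * C * A ≤ K / 2 := by linarith
    have hKp : (K:ℝ) ^ 37 ≥ 1 := one_le_pow₀ hK1
    have hKK : (K:ℝ) + K / 2 ≤ (K:ℝ) ^ 38 := by
      calc (K:ℝ) + K / 2 ≤ K * K := by nlinarith
        _ = (K:ℝ) ^ 2 := by ring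
        _ ≤ _ := pow_le_pow_right₀ hK1 (by norm_num)
    have sv1 := fun i => (g1 i).sm
    have sw := fun i => (gw i).sm
    refine ⟨fun i z => v1 i z + w i z, fun i j z => E1 i j z + E i j z, fun i => (g1 i).add (GZe (gw i)), fun z => ?_, fun i => ?_,
      fun i j => (gE1 i j).add (gE i j), fun i j => ?_, fun i z => ?_, fun i z => ?_, fun i z => ?_, fun j i z => ?_, fun i j z => ?_,
      fun l i j z => ?_⟩
    · rw [Finset.sum_congr rfl fun i _ => congrFun (pD_add (sv1 i) (sw i)) z, Finset.sum_add_distrib, d1, dw, add_zero]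
    · have : (fun z => v1 i z + w i z - v i z) = fun z => (v1 i z - v i z) + w i z := by funext z; ring
      rw [this]; exact (gd1 i).add (gw i)
    · funext z; show E1 i j z + E i j z = E1 j i z + E j i z
      rw [sy1 i j, sy i j]
    · have sa := fun r => (ha r).sm
      have sS : ∀ i j : Fin 3, Sm (fun z => ∑ r ∈ Finset.range m, a r z * a r z * (n r i * n r j)) := fun i j =>
        Sm.sum fun r _ => ((sa r).mul (sa r)).mul (Sm.const _)
      have sP : ∀ i j : Fin 3, Sm (fun z => v1 i z * v1 j z - ∑ r ∈ Finset.range m, a r z * a r z * (n r i * n r j)) := fun i j =>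
        ((sv1 i).mul (sv1 j)).sub (sS i j)
      have sQ : ∀ i j : Fin 3, Sm (fun z => v1 i z * w j z + w i z * v1 j z + w i z * w j z - a m z * a m z * (n m i * n m j)) := fun i j =>
        ((((sv1 i).mul (sw j)).add ((sw i).mul (sv1 j))).add ((sw i).mul (sw j))).sub (((sa m).mul (sa m)).mul (Sm.const _))
      have e : (fun (i j : Fin 3) (z : Fin 4 → ℝ) => (v1 i z + w i z) * (v1 j z + w j z) - ∑ r ∈ Finset.range (m+1), a r z * a r z * (n r i * n r j)) =
          fun i j z => (v1 i z * v1 j z - ∑ r ∈ Finset.range m, a r z * a r z * (n r i * n r j)) +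
            (v1 i z * w j z + w i z * v1 j z + w i z * w j z - a m z * a m z * (n m i * n m j)) := by
        funext i j z
        rw [Finset.sum_range_succ]; ring
      rw [e, dv_add sP sQ, pD_add (sv1 i) (sw i), dv_add (fun i j => (gE1 i j).sm) (fun i j => (gE i j).sm)]
      linarith [eq1 i z, eqw i z]
    · have h3 := (bw i).le z
      have h4 := b1 i z
      have : v1 i z + w i z - v i z = (v1 i z - v i z) + w i z := by ring
      rw [this]; push_cast
      linarith [abs_add_le (v1 i z - v i z) (w i z)]
    · rw [hK38]
      linarith [abs_add_le (v1 i z) (w i z), (bw i).le z, bv1 i z]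
    · rw [hK38, pD_add (sv1 i) (sw i)]
      have h5 := ((bw i).pD j).le z
      have h6 : 2 * C * A * (K:ℝ) ^ 37 ≤ K / 2 * (K:ℝ) ^ 37 := by gcongr
      have h7 : K / 2 * (K:ℝ) ^ 37 = (K:ℝ) ^ 38 / 2 := by ring
      have h8 : (K:ℝ) ≤ (K:ℝ) ^ 38 / 2 := by
        have : (2:ℝ) * K ≤ (K:ℝ) ^ 38 := by
          calc (2:ℝ) * K ≤ K * K := by gcongr
            _ = (K:ℝ) ^ 2 := by ring
            _ ≤ _ := pow_le_pow_right₀ hK1 (by norm_num)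
        linarith
      linarith [abs_add_le (pD j (v1 i) z) (pD j (w i) z), bdv1 j i z]
    · have h3 := (bE i j).le z
      have h4 := bE1 i j z
      have h5 : (K:ℝ)⁻¹ ≤ (κ:ℝ)⁻¹ := by gcongr
      push_cast
      linarith [abs_add_le (E1 i j z) (E i j z)]
    · rw [hK38, pD_add (gE1 i j).sm (gE i j).sm]
      have h5 := ((bE i j).pD l).le z
      have h6 : (K:ℝ)⁻¹ * (K:ℝ) ^ 37 ≤ (K:ℝ) ^ 38 := by
        have : (K:ℝ)⁻¹ ≤ 1 := inv_le_one_of_one_le₀ hK1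
        calc (K:ℝ)⁻¹ * (K:ℝ) ^ 37 ≤ 1 * (K:ℝ) ^ 37 := by gcongr
          _ = (K:ℝ) ^ 37 := one_mul _
          _ ≤ _ := pow_le_pow_right₀ hK1 (by norm_num)
      have h7 : m * (K:ℝ) ≤ m * (K:ℝ) ^ 38 := by
        gcongr
        simpa using pow_le_pow_right₀ hK1 (show 1 ≤ 38 by norm_num)
      push_cast
      linarith [abs_add_le (pD l (E1 i j) z) (pD l (E i j) z), bdE1 l i j z]
end CI

namespace CI
open scoped ContDiff Topology

/-- times away from `|t| = 5/4` -/
def Sτ (τ : ℝ) : Set ℝ := {t | τ < |(|t| - 5/4)|}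
lemma Sτ_open (τ : ℝ) : IsOpen (Sτ τ) :=
  isOpen_lt continuous_const (continuous_abs.comp (continuous_abs.sub continuous_const))

lemma st_bd (N : ℕ) : ∃ C, 1 ≤ C ∧ ∀ m ≤ N, ∀ s, |iteratedDeriv m Real.smoothTransition s| ≤ C := by
  have sm : ContDiff ℝ ∞ Real.smoothTransition := Real.smoothTransition.contDiff
  have sd : ContDiff ℝ ∞ (deriv Real.smoothTransition) := ((contDiff_infty_iff_deriv).1 sm).2
  have hc : HasCompactSupport (deriv Real.smoothTransition) := by
    refine HasCompactSupport.intro (isCompact_Icc (a := (0:ℝ)) (b := 1)) fun s hs => ?_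
    rw [Set.mem_Icc, not_and_or, not_le, not_le] at hs
    rcases hs with hs | hs
    · have : Real.smoothTransition =ᶠ[𝓝 s] fun _ => 0 :=
        Filter.eventually_of_mem (Iio_mem_nhds hs) fun t ht => Real.smoothTransition.zero_of_nonpos (le_of_lt ht)
      rw [this.deriv_eq]; simp
    · have : Real.smoothTransition =ᶠ[𝓝 s] fun _ => 1 :=
        Filter.eventually_of_mem (Ioi_mem_nhds hs) fun t ht => Real.smoothTransition.one_of_one_le (le_of_lt ht)
      rw [this.deriv_eq]; simp
  obtain ⟨C, hC, h⟩ := bdd_of_compact sd hc N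
  refine ⟨C + 1, by linarith, fun m hm s => ?_⟩
  rcases m with _ | m
  · rw [iteratedDeriv_zero, abs_of_nonneg (Real.smoothTransition.nonneg s)]
    linarith [Real.smoothTransition.le_one s]
  · rw [iteratedDeriv_succ']
    linarith [h m (by omega) s]

/-- linear ramp in time -/
def lr (s d : ℝ) : ZF := fun z => Real.smoothTransition (s * z 0 + d)
lemma lr_eq (s d : ℝ) : lr s d = fun z => Real.smoothTransition (∑ a, (if a = 0 then s else 0) * z a + d) := by
  funext z; simp [lr]
lemma lr_GZ (s d : ℝ) : GZ ∅ (lr s d) := by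
  refine ⟨?_, ?_, fun z hz => hz.elim⟩
  · exact Real.smoothTransition.contDiff.comp (((Sm.coord 0).cmul s).add (Sm.const d))
  · rintro p ⟨j, rfl⟩ z
    simp [lr, ee, Fin.succ_ne_zero]
lemma lr_bd {N : ℕ} {C : ℝ} (hC : ∀ m ≤ N, ∀ s, |iteratedDeriv m Real.smoothTransition s| ≤ C) {s d L : ℝ} (hs : |s| ≤ L) :
    Bd N C (fun _ => L) (lr s d) := by
  rw [lr_eq]
  refine Bd.lin hC Real.smoothTransition.contDiff _ _ fun i => ?_
  split_ifs
  · exact hs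
  · simpa using (abs_nonneg s).trans hs

/-- cutoff in time, near `c` -/
def Hc (τ δ c : ℝ) : ZF := fun z => lr (-1/δ) ((τ + δ + c)/δ) z * lr (1/δ) ((τ + δ - c)/δ) z
lemma Hc_one {τ δ c : ℝ} (hδ : 0 < δ) {z : Fin 4 → ℝ} (h : |z 0 - c| ≤ τ) : Hc τ δ c z = 1 := by
  have := abs_le.1 h
  unfold Hc lr
  rw [Real.smoothTransition.one_of_one_le, Real.smoothTransition.one_of_one_le, one_mul]
  · rw [show 1 / δ * z 0 + (τ + δ - c) / δ = (z 0 + τ + δ - c) / δ by ring, le_div_iff₀ hδ]; linarith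
  · rw [show -1 / δ * z 0 + (τ + δ + c) / δ = (- z 0 + τ + δ + c) / δ by ring, le_div_iff₀ hδ]; linarith
lemma Hc_zero {τ δ c : ℝ} (hδ : 0 < δ) {z : Fin 4 → ℝ} (h : τ + δ ≤ |z 0 - c|) : Hc τ δ c z = 0 := by
  unfold Hc lr
  rcases le_abs.1 h with h | h
  · rw [Real.smoothTransition.zero_of_nonpos, zero_mul]
    rw [show -1 / δ * z 0 + (τ + δ + c) / δ = (- z 0 + τ + δ + c) / δ by ring]
    exact div_nonpos_of_nonpos_of_nonneg (by linarith) hδ.le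
  · rw [mul_comm, Real.smoothTransition.zero_of_nonpos, zero_mul]
    rw [show 1 / δ * z 0 + (τ + δ - c) / δ = (z 0 + τ + δ - c) / δ by ring]
    exact div_nonpos_of_nonpos_of_nonneg (by linarith) hδ.le
lemma Hc_GZ (τ δ c : ℝ) : GZ ∅ (Hc τ δ c) := GZ.mulL (lr_GZ _ _) (lr_GZ _ _)
lemma Hc_bd {N : ℕ} {C : ℝ} (hC : ∀ m ≤ N, ∀ s, |iteratedDeriv m Real.smoothTransition s| ≤ C) {τ δ c : ℝ} (hδ : 0 < δ) :
    Bd N (C * C) (fun _ => 2 * (1 / δ)) (Hc τ δ c) :=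
  (lr_bd hC (by rw [abs_div, abs_of_pos hδ]; simp)).mul (lr_bd hC (by rw [abs_div, abs_of_pos hδ]; simp)) (lr_GZ _ _).sm (lr_GZ _ _).sm
    (fun _ => by positivity)

lemma cutoff (N : ℕ) : ∃ C, 1 ≤ C ∧ ∀ τ δ : ℝ, 0 ≤ τ → 0 < δ → τ + δ ≤ 1 → ∃ χ : ZF, GZ (Sτ (τ + δ)) χ ∧ (∀ z, z 0 ∉ Sτ τ → χ z = 1) ∧
    (∀ j : Fin 3, pD j.succ χ = fun _ => 0) ∧ Bd N C (fun _ => 2 * (1 / δ)) χ := by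
  obtain ⟨C, hC1, hC⟩ := st_bd N
  refine ⟨C * C + C * C, by nlinarith, fun τ δ hτ hδ h1 => ⟨fun z => Hc τ δ (5/4) z + Hc τ δ (-(5/4)) z, ⟨?_, ?_, ?_⟩, ?_, ?_, ?_⟩⟩
  · exact (Hc_GZ _ _ _).sm.add (Hc_GZ _ _ _).sm
  · exact ((Hc_GZ _ _ _).add (Hc_GZ _ _ _)).per
  · intro z hz
    have hz : τ + δ < |(|z 0| - 5/4)| := hz
    have a1 : τ + δ ≤ |z 0 - 5/4| := by
      rcases abs_cases (z 0) with ⟨e, _⟩ | ⟨e, _⟩ <;> rw [e] at hz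
      · exact hz.le
      · rw [abs_of_nonpos (by linarith)]; linarith
    have a2 : τ + δ ≤ |z 0 - (-(5/4))| := by
      rcases abs_cases (z 0) with ⟨e, _⟩ | ⟨e, _⟩ <;> rw [e] at hz
      · rw [abs_of_nonneg (by linarith)]; linarith
      · rw [← abs_neg] at hz; refine hz.le.trans (le_of_eq ?_); congr 1; ring
    show _ + _ = _
    rw [Hc_zero hδ a1, Hc_zero hδ a2, add_zero]
  · intro z hz
    have hz : ¬ (τ < |(|z 0| - 5/4)|) := hz
    rw [not_lt] at hz
    show _ + _ = _
    rcases abs_cases (z 0) with ⟨e, h0⟩ | ⟨e, h0⟩ <;> rw [e] at hz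
    · rw [Hc_one hδ hz, Hc_zero hδ, add_zero]
      rw [abs_of_nonneg (by linarith)]; linarith
    · rw [Hc_zero hδ, Hc_one hδ, zero_add]
      · rw [← abs_neg] at hz; refine (le_of_eq ?_).trans hz; congr 1; ring
      · rw [abs_of_nonpos (by linarith)]; linarith
  · intro j
    have hl : ∀ s d, pD j.succ (lr s d) = fun _ => 0 := fun s d => by
      rw [lr_eq, pD_comp1 Real.smoothTransition.contDiff (Sm.lin _ _), pD_lin]
      simp [Fin.succ_ne_zero]
    have hh : ∀ c, pD j.succ (Hc τ δ c) = fun _ => 0 := fun c => by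
      unfold Hc
      rw [pD_mul (lr_GZ _ _).sm (lr_GZ _ _).sm, hl, hl]; simp
    rw [pD_add (Hc_GZ _ _ _).sm (Hc_GZ _ _ _).sm, hh, hh]; simp
  · exact (Hc_bd hC hδ).add (Hc_bd hC hδ) (Hc_GZ _ _ _).sm (Hc_GZ _ _ _).sm

lemma sqrt_fun (N : ℕ) : ∃ (g : ℝ → ℝ) (C : ℝ), 1 ≤ C ∧ ContDiff ℝ ∞ g ∧ (∀ s, 1/8 ≤ s → s ≤ 3/8 → g s * g s = s) ∧
    ∀ m ≤ N, ∀ s, |iteratedDeriv m g s| ≤ C := by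
  let b : ContDiffBump (1/4 : ℝ) := ⟨1/8, 3/16, by norm_num, by norm_num⟩
  have sg : ContDiff ℝ ∞ (fun s => b s * Real.sqrt s) := by
    rw [contDiff_iff_contDiffAt]
    intro s
    rcases eq_or_ne s 0 with rfl | hs
    · have : (fun s => b s * Real.sqrt s) =ᶠ[𝓝 0] fun _ => 0 := by
        refine Filter.eventually_of_mem (Iio_mem_nhds (show (0:ℝ) < 1/16 by norm_num)) fun t ht => ?_
        have : b t = 0 := b.zero_of_le_dist (by
          rw [Real.dist_eq, abs_of_nonpos (by have := Set.mem_Iio.1 ht; linarith)]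
          have := Set.mem_Iio.1 ht
          show (3/16:ℝ) ≤ _
          linarith)
        simp [this]
      exact contDiffAt_const.congr_of_eventuallyEq this
    · exact b.contDiff.contDiffAt.mul (Real.contDiffAt_sqrt hs)
  have hc : HasCompactSupport (fun s => b s * Real.sqrt s) := b.hasCompactSupport.mul_right
  obtain ⟨C, hC, h⟩ := bdd_of_compact sg hc N
  refine ⟨_, C + 1, by linarith, sg, fun s h1 h2 => ?_, fun m hm s => by linarith [h m hm s]⟩
  have : b s = 1 := b.one_of_mem_closedBall (by
    rw [Metric.mem_closedBall, Real.dist_eq]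
    show |s - 1/4| ≤ 1/8
    rw [abs_le]; constructor <;> linarith)
  rw [this, one_mul, Real.mul_self_sqrt (by linarith)]

def nr : ℕ → Fin 3 → ℝ
  | 0 => ![1, 1, 0] | 1 => ![1, -1, 0] | 2 => ![1, 0, 1] | 3 => ![1, 0, -1] | 4 => ![0, 1, 1] | _ => ![0, 1, -1]
def ir : ℕ → Fin 3
  | 0 => 0 | 1 => 0 | 2 => 0 | 3 => 0 | 4 => 1 | _ => 1
def jr : ℕ → Fin 3
  | 0 => 1 | 1 => 1 | 2 => 2 | 3 => 2 | 4 => 2 | _ => 2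
def kr : ℕ → Fin 3
  | 0 => 2 | 1 => 2 | 2 => 1 | 3 => 1 | 4 => 0 | _ => 0
def sr : ℕ → ℝ
  | 0 => -1/2 | 1 => 1/2 | 2 => -1/2 | 3 => 1/2 | 4 => -1/2 | _ => 1/2
lemma nr_k (r) : nr r (kr r) = 0 := by unfold nr kr; split <;> simp
lemma nr_1 (r i) : |nr r i| ≤ 1 := by unfold nr; split <;> fin_cases i <;> simp
lemma sr_1 (r) : |sr r| = 1/2 := by unfold sr; split <;> norm_num [abs_of_pos, abs_of_neg]
/-- coefficients of the decomposition -/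
def gm (r : ℕ) (ρ : Fin 3 → Fin 3 → ℝ) : ℝ :=
  1/4 + ((-1/4) * (ρ (ir r) (ir r) + ρ (jr r) (jr r) - ρ (kr r) (kr r)) + sr r * ρ (ir r) (jr r))
lemma gm_sum (ρ : Fin 3 → Fin 3 → ℝ) (h : ∀ i j, ρ i j = ρ j i) (i j) :
    ∑ r ∈ Finset.range 6, gm r ρ * (nr r i * nr r j) = dl i j - ρ i j := by
  have h1 := h 0 1
  have h2 := h 0 2
  have h3 := h 1 2
  simp only [Finset.sum_range_succ, Finset.sum_range_zero, gm, nr, ir, jr, kr, sr, dl]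
  fin_cases i <;> fin_cases j <;> simp [h1, h2, h3] <;> ring
lemma gm_le {r : ℕ} {ρ : Fin 3 → Fin 3 → ℝ} (h : ∀ i j, |ρ i j| ≤ 1/100) : 1/8 ≤ gm r ρ ∧ gm r ρ ≤ 3/8 := by
  have h1 := abs_le.1 (h (ir r) (ir r))
  have h2 := abs_le.1 (h (jr r) (jr r))
  have h3 := abs_le.1 (h (kr r) (kr r))
  have h4 : |sr r * ρ (ir r) (jr r)| ≤ 1/200 := by
    rw [abs_mul, sr_1]; linarith [h (ir r) (jr r)]
  have h4 := abs_le.1 h4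
  unfold gm
  constructor <;> linarith
end CI

namespace CI
open scoped ContDiff Topology

lemma Sτ_shift {τ δ s t : ℝ} (hs : 0 ≤ s) (hsδ : s ≤ δ) (ht : t ∈ Sτ (τ + δ)) : t + s ∈ Sτ τ := by
  have ht : τ + δ < |(|t| - 5/4)| := ht
  show τ < |(|t + s| - 5/4)|
  have h1 : |(|t| - 5/4)| - |(|t + s| - 5/4)| ≤ |(|t| - 5/4) - (|t + s| - 5/4)| := abs_sub_abs_le_abs_sub _ _
  have h2 : |(|t| - 5/4) - (|t + s| - 5/4)| ≤ s := by
    rw [show (|t| - 5/4) - (|t + s| - 5/4) = |t| - |t + s| by ring]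
    refine (abs_abs_sub_abs_le_abs_sub _ _).trans ?_
    rw [show t - (t + s) = -s by ring, abs_neg, abs_of_nonneg hs]
  linarith

lemma amps : ∃ C, 1 ≤ C ∧ ∀ (K : ℕ) (ε τ δ : ℝ), 2 ^ 16 ≤ K → 0 < ε → 0 ≤ τ → 1 / (K:ℝ) ≤ δ → τ + δ ≤ 1 → ∀ R : TF,
    (∀ i j, GZ (Sτ τ) (R i j)) → (∀ i j, R i j = R j i) → (∀ i j z, |R i j z| ≤ ε ^ 2 / 100) →
    ∃ (a : ℕ → ZF) (ρ : ZF), (∀ r, GZ (Sτ (τ + δ)) (a r)) ∧ (∀ r, Bd 10 (C * ε) (fun _ => (K:ℝ) ^ 5) (a r)) ∧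
      (∀ i j, GZ (Sτ (τ + δ)) (mol 11 (((K:ℝ) ^ 4)⁻¹) (R i j))) ∧ Sm ρ ∧ (∀ j : Fin 3, pD j.succ ρ = fun _ => 0) ∧
      (∀ i j z, ∑ r ∈ Finset.range 6, a r z * a r z * (nr r i * nr r j) = dl i j * ρ z - mol 11 (((K:ℝ) ^ 4)⁻¹) (R i j) z) := by
  obtain ⟨C1, h11, hcut⟩ := cutoff 10
  obtain ⟨g, C2, h21, sg, hg2, hg⟩ := sqrt_fun 10
  refine ⟨C1 * C2, by nlinarith, fun K ε τ δ hK hε hτ hδ hδ1 R gR syR bR => ?_⟩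
  have hk : ((2:ℝ) ^ 16) ≤ K := by exact_mod_cast hK
  have h1 : (1:ℝ) ≤ K := le_trans (by norm_num) hk
  have h0 : (0:ℝ) < K := by linarith
  have hδ0 : 0 < δ := lt_of_lt_of_le (by positivity) hδ
  set l : ℝ := ((K:ℝ) ^ 4)⁻¹ with hl
  have hl0 : 0 < l := by positivity
  have h2l : 2 / l = 2 * (K:ℝ) ^ 4 := by rw [hl]; field_simp
  have h22 : ((11:ℕ):ℝ) * l ≤ δ / 2 := by
    have h3 : l ≤ ((K:ℝ) * 2 ^ 16)⁻¹ := by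
      rw [hl]; gcongr
      calc (K:ℝ) * 2 ^ 16 ≤ K * K := by gcongr
        _ = (K:ℝ) ^ 2 := by ring
        _ ≤ _ := pow_le_pow_right₀ h1 (by norm_num)
    have h4 : ((K:ℝ) * 2 ^ 16)⁻¹ = (1 / (K:ℝ)) / 2 ^ 16 := by field_simp
    rw [h4] at h3
    push_cast
    linarith
  obtain ⟨χ, gχ, χ1, χx, bχ⟩ := hcut (τ + δ / 2) (δ / 2) (by linarith) (by linarith) (by linarith)
  rw [show τ + δ / 2 + δ / 2 = τ + δ by ring] at gχ
  set Q : TF := fun i j => mol 11 l (R i j) with hQ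
  have sR := fun i j => (gR i j).sm
  have gQ2 : ∀ i j, GZ (Sτ (τ + δ / 2)) (Q i j) := fun i j => GZ.mol (gR i j) hl0.le fun t ht s hs =>
    Sτ_shift hs.1 (hs.2.trans h22) ht
  have gQ : ∀ i j, GZ (Sτ (τ + δ)) (Q i j) := fun i j => ⟨(gQ2 i j).sm, (gQ2 i j).per, fun z hz => (gQ2 i j).van z (by
    have hz : τ + δ < _ := hz
    show τ + δ / 2 < _
    linarith)⟩
  have sQ := fun i j => (gQ i j).sm
  have bQ : ∀ i j, Bd 11 (ε ^ 2 / 100) (fun _ => 2 * (K:ℝ) ^ 4) (Q i j) := fun i j => by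
    rw [← h2l]; exact Bd.mol_gain (bR i j) (sR i j) hl0 11
  have hL0 : ∀ i : Fin 4, (0:ℝ) ≤ (fun _ => 2 * (K:ℝ) ^ 4) i := fun _ => by positivity
  set P : TF := fun i j z => (ε ^ 2)⁻¹ * Q i j z with hP
  have sP : ∀ i j, Sm (P i j) := fun i j => (sQ i j).cmul _
  have gP : ∀ i j, GZ ∅ (P i j) := fun i j => (GZe (gQ i j)).cmul _
  have bP : ∀ i j, Bd 11 (1 / 100) (fun _ => 2 * (K:ℝ) ^ 4) (P i j) := fun i j => by
    refine ((bQ i j).cmul _ (sQ i j)).monoA (le_of_eq ?_) hL0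
    rw [abs_of_pos (by positivity)]; field_simp
  set γ : ℕ → ZF := fun r z => gm r (fun i j => P i j z) with hγ
  have s1 : ∀ r, Sm (fun z => P (ir r) (ir r) z + P (jr r) (jr r) z - P (kr r) (kr r) z) := fun r => ((sP _ _).add (sP _ _)).sub (sP _ _)
  have gγ : ∀ r, GZ ∅ (γ r) := fun r =>
    (Gd.const (1/4)).add ((((((gP _ _).add (gP _ _)).sub (gP _ _)).cmul (-1/4))).add ((gP _ _).cmul (sr r)))
  have sγ := fun r => (gγ r).sm
  have bγ : ∀ r, Bd 11 1 (fun _ => 2 * (K:ℝ) ^ 4) (γ r) := fun r => by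
    have b1 := ((((bP (ir r) (ir r)).add (bP (jr r) (jr r)) (sP _ _) (sP _ _)).sub (bP (kr r) (kr r)) ((sP _ _).add (sP _ _)) (sP _ _)).cmul (-1/4) (s1 r)).add
      ((bP (ir r) (jr r)).cmul (sr r) (sP _ _)) ((s1 r).cmul _) ((sP _ _).cmul _)
    have b2 := (Bd.const (c := (1/4:ℝ)) (A := 1/4) (N := 11) (by norm_num [abs_of_pos]) hL0).add b1 (Sm.const _) (((s1 r).cmul _).add ((sP _ _).cmul _))
    refine b2.monoA ?_ hL0
    rw [sr_1]; norm_num [abs_of_pos, abs_of_neg]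
  have bg : ∀ r, Bd 10 C2 (fun _ => 2 ^ 10 * (2 * (K:ℝ) ^ 4)) (fun z => g (γ r z)) := fun r =>
    Bd.comp1 hg sg (sγ r) (fun i => by simpa using (bγ r).pD i) hL0
  have sgg : ∀ r, Sm (fun z => g (γ r z)) := fun r => sg.comp (sγ r)
  have ggg : ∀ r, GZ ∅ (fun z => g (γ r z)) := fun r => ⟨sgg r, fun p hp z => by
    show g (γ r (z + p)) = _
    rw [(gγ r).per p hp z], fun z hz => hz.elim⟩
  have bχ' : Bd 10 C1 (fun _ => 2 ^ 10 * (2 * (K:ℝ) ^ 4)) χ := bχ.mono le_rfl (fun _ => by positivity) (fun _ => by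
    have h3 : 1 / (δ / 2) ≤ 2 * K := by
      rw [div_le_iff₀ (by positivity)]
      have := (div_le_iff₀ h0).1 hδ
      linarith
    have h4 : (K:ℝ) ≤ (K:ℝ) ^ 4 := by simpa using pow_le_pow_right₀ h1 (show 1 ≤ 4 by norm_num)
    linarith)
  refine ⟨fun r z => ε * (χ z * g (γ r z)), fun z => ε ^ 2 * (χ z * χ z), fun r => (GZ.mulL gχ (ggg r)).cmul ε, fun r => ?_, gQ,
    (gχ.sm.mul gχ.sm).cmul _, fun j => ?_, fun i j z => ?_⟩
  · refine ((bχ'.mul (bg r) gχ.sm (sgg r) (fun _ => by positivity)).cmul ε (gχ.sm.mul (sgg r))).mono (le_of_eq ?_) (fun _ => by positivity) (fun _ => ?_)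
    · rw [abs_of_pos hε]; ring
    · calc 2 * (2 ^ 10 * (2 * (K:ℝ) ^ 4)) = 2 ^ 12 * (K:ℝ) ^ 4 := by ring
        _ ≤ K * (K:ℝ) ^ 4 := by gcongr; linarith
        _ = _ := by ring
  · rw [pD_cmul _ (gχ.sm.mul gχ.sm), pD_mul gχ.sm gχ.sm, χx]; simp
  · have hρ : ∀ i j, |P i j z| ≤ 1/100 := fun i j => (bP i j).le z
    have e : ∀ r, ε * (χ z * g (γ r z)) * (ε * (χ z * g (γ r z))) * (nr r i * nr r j) =
        (ε ^ 2 * (χ z * χ z)) * (gm r (fun i j => P i j z) * (nr r i * nr r j)) := fun r => by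
      have h3 := gm_le (r := r) hρ
      have h4 := hg2 _ h3.1 h3.2
      calc _ = (ε ^ 2 * (χ z * χ z)) * ((g (γ r z) * g (γ r z)) * (nr r i * nr r j)) := by ring
        _ = _ := by rw [← h4]
    simp only [e]
    rw [← Finset.mul_sum, gm_sum _ (fun i j => by simp only [hP, hQ]; rw [syR i j])]
    have h5 : χ z * χ z * Q i j z = Q i j z := by
      by_cases h : z 0 ∈ Sτ (τ + δ / 2)
      · rw [(gQ2 i j).van z h, mul_zero]
      · rw [χ1 z h]; ring
    calc ε ^ 2 * (χ z * χ z) * (dl i j - P i j z) = dl i j * (ε ^ 2 * (χ z * χ z)) - (ε ^ 2 * (ε ^ 2)⁻¹) * (χ z * χ z * Q i j z) := by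
          simp only [hP]; ring
      _ = _ := by rw [h5, mul_inv_cancel₀ (by positivity), one_mul]

/-- Euler–Reynolds system with data bounds -/
structure ER (p : ZF) (S : Set ℝ) (v : VF) (R : TF) : Prop where
  gv : ∀ i, GZ ∅ (v i)
  dv0 : ∀ z, ∑ i : Fin 3, pD i.succ (v i) z = 0
  gR : ∀ i j, GZ S (R i j)
  syR : ∀ i j, R i j = R j i
  eq : ∀ i z, pD 0 (v i) z + dv (fun i j z => v i z * v j z) i z + pD i.succ p z = dv R i z

lemma stage : ∃ (C : ℝ) (b : ℕ) (K0 : ℕ), 2 ≤ b ∧ 2 ^ 16 ≤ K0 ∧ ∀ (K : ℕ) (ε τ δ : ℝ) (p : ZF) (v : VF) (R : TF), K0 ≤ K → 0 < ε → ε ≤ K → 0 ≤ τ →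
    1 / (K:ℝ) ≤ δ → τ + δ ≤ 1 → ER p (Sτ τ) v R → (∀ i j z, |R i j z| ≤ ε ^ 2 / 100) → (∀ l i j z, |pD l (R i j) z| ≤ K) →
    (∀ i z, |v i z| ≤ K) → (∀ l i z, |pD l (v i) z| ≤ K) →
    ∃ (v' : VF) (R' : TF), ER p (Sτ (τ + δ)) v' R' ∧ (∀ i, GZ (Sτ (τ + δ)) (fun z => v' i z - v i z)) ∧ (∀ i z, |v' i z - v i z| ≤ C * ε) ∧
      (∀ i j z, |R' i j z| ≤ (1 / (K:ℝ)) ^ 2 / 100) ∧ (∀ l i j z, |pD l (R' i j) z| ≤ (K:ℝ) ^ b) ∧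
      (∀ i z, |v' i z| ≤ (K:ℝ) ^ b) ∧ (∀ l i z, |pD l (v' i) z| ≤ (K:ℝ) ^ b) := by
  obtain ⟨C, hC1, hC⟩ := G_bd 11
  obtain ⟨D, hD1, hD⟩ := amps
  obtain ⟨K1, hK1⟩ := exists_nat_ge (4 * C * D)
  obtain ⟨e, he⟩ : ∃ e : ℕ, e = 38 ^ 6 := ⟨_, rfl⟩
  have he1 : 1 ≤ e := by rw [he]; exact Nat.one_le_pow _ _ (by norm_num)
  refine ⟨6 * (2 * C * D), 5 * e + 1, 2 ^ 16 + K1, by omega, by omega, fun K ε τ δ p v R hK hε hεK hτ hδ hδ1 hER bR bdR bv bdv => ?_⟩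
  have hK16 : 2 ^ 16 ≤ K := by omega
  have hk : ((2:ℝ) ^ 16) ≤ K := by exact_mod_cast hK16
  have hKC : 4 * C * D ≤ K := hK1.trans (by exact_mod_cast (by omega : K1 ≤ K))
  have h1 : (1:ℝ) ≤ K := le_trans (by norm_num) hk
  have h0 : (0:ℝ) < K := by linarith
  obtain ⟨a, ρ, ga, ba, gQ, sρ, ρx, hdec⟩ := hD K ε τ δ hK16 hε hτ hδ hδ1 R hER.gR hER.syR bR
  set l : ℝ := ((K:ℝ) ^ 4)⁻¹ with hl
  have hl0 : 0 < l := by positivity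
  set κ : ℕ := K ^ 5 with hκ
  have hκr : (κ:ℝ) = (K:ℝ) ^ 5 := by rw [hκ]; push_cast; rfl
  have hKκ : K ≤ κ := by rw [hκ]; exact Nat.le_self_pow (by norm_num) K
  have hKκ' : (K:ℝ) ≤ κ := by exact_mod_cast hKκ
  have hCK : C ≤ K := by nlinarith
  rw [← hκr] at ba
  obtain ⟨v', E, gv', dv', gd, gE, syE, eqE, bd, bv', bdv', bE, bdE⟩ := substeps hC1 hC (hK16.trans hKκ) (hCK.trans hKκ') (Sτ_open (τ + δ)) hER.gv
    hER.dv0 (fun i z => (bv i z).trans hKκ') (fun j i z => (bdv j i z).trans hKκ') ga (A := D * ε) (by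
      rw [hκr]
      calc 4 * C * (D * ε) = 4 * C * D * ε := by ring
        _ ≤ K * K := by gcongr
        _ = (K:ℝ) ^ 2 := by ring
        _ ≤ _ := pow_le_pow_right₀ h1 (by norm_num)) ba (n := nr) (k := kr) nr_k nr_1 6
  rw [← he] at bv' bdv' bdE
  set Q : TF := fun i j => mol 11 l (R i j) with hQ
  have sR := fun i j => (hER.gR i j).sm
  have sQ := fun i j => (gQ i j).sm
  have sE := fun i j => (gE i j).sm
  have sv' := fun i => (gv' i).sm
  have hb : (K:ℝ) ^ (5 * e + 1) = (κ:ℝ) ^ e * K := by rw [hκr, ← pow_mul, pow_succ]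
  have hκe : (K:ℝ) ≤ (κ:ℝ) ^ e := hKκ'.trans (by simpa using pow_le_pow_right₀ (h1.trans hKκ') he1)
  have hκe0 : (0:ℝ) ≤ (κ:ℝ) ^ e := by positivity
  have hbb : 8 * (κ:ℝ) ^ e ≤ (K:ℝ) ^ (5 * e + 1) := by rw [hb, mul_comm]; gcongr; linarith
  have S1 : Sτ (τ + δ) ⊆ Sτ τ := fun t ht => by
    have := Sτ_shift le_rfl (hδ.trans' (by positivity)) ht; simpa using this
  have gR' : ∀ i j, GZ (Sτ (τ + δ)) (R i j) := fun i j => ⟨sR i j, (hER.gR i j).per, fun z hz => (hER.gR i j).van z (S1 hz)⟩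
  refine ⟨v', fun i j z => (R i j z - Q i j z) + E i j z, ⟨gv', dv', fun i j => ((gR' i j).sub (gQ i j)).add (gE i j), fun i j => ?_, fun i z => ?_⟩,
    gd, fun i z => ?_, fun i j z => ?_, fun l' i j z => ?_, fun i z => ?_, fun l i z => ?_⟩
  · funext z
    show R i j z - Q i j z + E i j z = R j i z - Q j i z + E j i z
    rw [hQ, syE i j]; simp only []; rw [hER.syR i j]
  · have h3 := eqE i z
    have h4 := hER.eq i z
    have e2 : (fun (i j : Fin 3) (z : Fin 4 → ℝ) => v' i z * v' j z - ∑ r ∈ Finset.range 6, a r z * a r z * (nr r i * nr r j)) =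
        fun i j z => (v' i z * v' j z - dl i j * ρ z) + Q i j z := by
      funext i j z; rw [hdec]; ring
    have sρd : ∀ i j : Fin 3, Sm (fun z => dl i j * ρ z) := fun i j => sρ.cmul _
    have svv : ∀ i j : Fin 3, Sm (fun z => v' i z * v' j z) := fun i j => (sv' i).mul (sv' j)
    have dρ : dv (fun i j z => dl i j * ρ z) i z = 0 := by
      unfold dv
      refine Finset.sum_eq_zero fun j _ => ?_
      rw [pD_cmul _ sρ, ρx]; simp
    rw [e2, dv_add (fun i j => (svv i j).sub (sρd i j)) sQ, dv_sub svv sρd] at h3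
    dsimp only at h3
    rw [dρ] at h3
    rw [dv_add (fun i j => (sR i j).sub (sQ i j)) sE, dv_sub sR sQ]
    linarith
  · refine (bd i z).trans (le_of_eq ?_)
    push_cast; ring
  · have h3 := mol_err (l := l) (sR i j) hl0.le (fun l z => bdR l i j z) 11 z
    have h4 := bE i j z
    have h5 : |R i j z - Q i j z + E i j z| ≤ |Q i j z - R i j z| + |E i j z| := by
      rw [abs_sub_comm (Q i j z)]; exact abs_add_le _ _
    refine h5.trans ((add_le_add h3 h4).trans ?_)
    rw [hκr, hl]; push_cast
    set q := (K:ℝ)⁻¹ with hq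
    have hq0 : 0 < q := by positivity
    have hqk : q * K = 1 := by rw [hq]; field_simp
    have hq16 : q * 2 ^ 16 ≤ 1 := by rw [← hqk]; gcongr
    have hq1' : q ≤ 1 := by linarith
    rw [one_div, ← inv_pow, ← inv_pow, ← hq]
    have h6 : q ^ 5 ≤ q ^ 3 := pow_le_pow_of_le_one hq0.le hq1' (by norm_num)
    have h7 : q ^ 3 * 2 ^ 16 ≤ q ^ 2 := by
      calc q ^ 3 * 2 ^ 16 = q ^ 2 * (q * 2 ^ 16) := by ring
        _ ≤ q ^ 2 * 1 := by gcongr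
        _ = _ := mul_one _
    have h8 : 4 * 11 * q ^ 4 * K = 44 * q ^ 3 := by
      calc 4 * 11 * q ^ 4 * K = 44 * q ^ 3 * (q * K) := by ring
        _ = _ := by rw [hqk, mul_one]
    have : 0 ≤ q ^ 3 := by positivity
    rw [h8]
    linarith
  · rw [pD_add ((sR i j).sub (sQ i j)) (sE i j), pD_sub (sR i j) (sQ i j)]
    have h3 := Kop_pDle (l := l) (sR i j) (fun l z => bdR l i j z) 11 l' z
    have h4 := bdE l' i j z
    have h5 := bdR l' i j z
    push_cast at h4
    have h6 : |pD l' (R i j) z - pD l' (Q i j) z + pD l' (E i j) z| ≤ |pD l' (R i j) z| + |pD l' (Q i j) z| + |pD l' (E i j) z| :=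
      (abs_add_le _ _).trans (by gcongr; exact abs_sub _ _)
    have h7 : |pD l' (Q i j) z| ≤ K := h3
    linarith
  · exact (bv' i z).trans (by linarith)
  · exact (bdv' l i z).trans (by linarith)
end CI

namespace CI
open scoped ContDiff Topology

lemma Sτ_mono {a b : ℝ} (h : a ≤ b) : Sτ b ⊆ Sτ a := fun t ht => lt_of_le_of_lt h ht
lemma GZ_mono {S S' : Set ℝ} (h : S' ⊆ S) {f : ZF} (hf : GZ S f) : GZ S' f := ⟨hf.sm, hf.per, fun z hz => hf.van z (h hz)⟩
lemma ER.mono {p S S' v R} (h : S' ⊆ S) (H : ER p S v R) : ER p S' v R :=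
  ⟨H.gv, H.dv0, fun i j => GZ_mono h (H.gR i j), H.syR, H.eq⟩

/-- sequence of frequencies and of amplitudes -/
def Kq (b K q : ℕ) : ℕ := K ^ b ^ q
def eq' (b K : ℕ) (ε : ℝ) : ℕ → ℝ
  | 0 => ε
  | q+1 => 1 / (Kq b K q : ℝ)

lemma Kq_succ (b K q : ℕ) : Kq b K (q+1) = Kq b K q ^ b := by unfold Kq; rw [← pow_mul, pow_succ]
lemma Kq_ge {b K : ℕ} (hb : 2 ≤ b) (hK : 2 ^ 16 ≤ K) (q : ℕ) : (2 ^ 16) ^ (q+1) ≤ Kq b K q := by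
  unfold Kq
  calc (2 ^ 16) ^ (q+1) ≤ K ^ (q+1) := Nat.pow_le_pow_left hK _
    _ ≤ _ := Nat.pow_le_pow_right (by omega) (Nat.lt_pow_self (by omega))
lemma Kq_ge' {b K : ℕ} (hb : 2 ≤ b) (hK : 2 ^ 16 ≤ K) (q : ℕ) : K ≤ Kq b K q := by
  unfold Kq
  calc K = K ^ 1 := (pow_one _).symm
    _ ≤ _ := Nat.pow_le_pow_right (by omega) (Nat.one_le_pow _ _ (by omega))

lemma iter : ∃ (C : ℝ) (b : ℕ) (K0 : ℕ), 2 ≤ b ∧ 2 ^ 16 ≤ K0 ∧ ∀ (K : ℕ) (ε : ℝ) (p : ZF) (v : VF) (R : TF),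
    K0 ≤ K → 0 < ε → ε ≤ K → ER p (Sτ (1/16)) v R → (∀ i j z, |R i j z| ≤ ε ^ 2 / 100) → (∀ l i j z, |pD l (R i j) z| ≤ K) →
    (∀ i z, |v i z| ≤ K) → (∀ l i z, |pD l (v i) z| ≤ K) →
    ∃ (V : ℕ → VF) (Q : ℕ → TF), V 0 = v ∧ ∀ q, ER p (Sτ (1/8)) (V q) (Q q) ∧
      (∀ i, GZ (Sτ (1/8)) (fun z => V (q+1) i z - V q i z)) ∧ (∀ i z, |V (q+1) i z - V q i z| ≤ C * eq' b K ε q) ∧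
      (∀ i j z, |Q q i j z| ≤ (eq' b K ε q) ^ 2 / 100) ∧ (∀ i z, |V q i z| ≤ Kq b K q) ∧ (∀ l i z, |pD l (V q i) z| ≤ Kq b K q) := by
  obtain ⟨C, b, K0, hb, hK0, hst⟩ := stage
  refine ⟨C, b, K0, hb, hK0, fun K ε p v R hK hε hεK hER h1 h2 h3 h4 => ?_⟩
  let τ : ℕ → ℝ := fun q => 1/8 - (1/2) ^ q / 16
  let P : ℕ → VF × TF → Prop := fun q x => ER p (Sτ (τ q)) x.1 x.2 ∧ (∀ i j z, |x.2 i j z| ≤ (eq' b K ε q) ^ 2 / 100) ∧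
    (∀ l i j z, |pD l (x.2 i j) z| ≤ Kq b K q) ∧ (∀ i z, |x.1 i z| ≤ Kq b K q) ∧ (∀ l i z, |pD l (x.1 i) z| ≤ Kq b K q)
  have hK16 : 2 ^ 16 ≤ K := hK0.trans hK
  have hKp : ∀ q, (0:ℝ) < Kq b K q := fun q => by
    have := Kq_ge' hb hK16 q
    exact_mod_cast (by omega : 0 < Kq b K q)
  have step : ∀ q (s : {x // P q x}), ∃ s' : {x // P (q+1) x}, (∀ i, GZ (Sτ (1/8)) (fun z => s'.1.1 i z - s.1.1 i z)) ∧
      (∀ i z, |s'.1.1 i z - s.1.1 i z| ≤ C * eq' b K ε q) := by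
    rintro q ⟨⟨v, R⟩, hER, g1, g2, g3, g4⟩
    have hq : (0:ℝ) < (1/2) ^ q := by positivity
    have hq1 : ((1:ℝ)/2) ^ q ≤ 1 := pow_le_one₀ (by norm_num) (by norm_num)
    have hKq : (2:ℝ) ^ q * 32 ≤ Kq b K q := by
      have := Kq_ge hb hK16 q
      have h2 : 2 ^ q * 32 ≤ (2 ^ 16) ^ (q+1) := by
        rw [pow_succ]
        exact Nat.mul_le_mul (Nat.pow_le_pow_left (by norm_num) _) (by norm_num)
      exact_mod_cast h2.trans this
    have hep : 0 < eq' b K ε q ∧ eq' b K ε q ≤ Kq b K q := by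
      cases q with
      | zero => exact ⟨hε, by simpa [eq', Kq] using hεK⟩
      | succ q =>
        refine ⟨by have := hKp q; simp only [eq']; positivity, ?_⟩
        have a1 : (1:ℝ) ≤ Kq b K q := by
          have := Kq_ge' hb hK16 q
          exact_mod_cast (by omega : 1 ≤ Kq b K q)
        have a2 : (1:ℝ) ≤ Kq b K (q+1) := by
          have := Kq_ge' hb hK16 (q+1)
          exact_mod_cast (by omega : 1 ≤ Kq b K (q+1))
        refine le_trans ?_ a2
        simp only [eq']
        rw [div_le_one (hKp q)]; exact a1
    have hδ : 1 / (Kq b K q : ℝ) ≤ (1/2) ^ q / 32 := by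
      rw [div_pow, one_pow, div_div]
      exact one_div_le_one_div_of_le (by positivity) hKq
    have hτ : τ (q+1) = τ q + (1/2) ^ q / 32 := by simp only [τ, pow_succ]; ring
    obtain ⟨v', R', k1, k2, k3, k4, k5, k6, k7⟩ := hst (Kq b K q) (eq' b K ε q) (τ q) ((1/2) ^ q / 32) p v R (hK.trans (Kq_ge' hb hK16 q))
      hep.1 hep.2 (by simp only [τ]; linarith) hδ (by simp only [τ]; linarith) hER g1 g2 g3 g4
    rw [← hτ] at k1 k2
    have hc : ((Kq b K (q+1) : ℕ) : ℝ) = (Kq b K q : ℝ) ^ b := by rw [Kq_succ]; push_cast; rfl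
    refine ⟨⟨⟨v', R'⟩, k1, k4, ?_, ?_, ?_⟩, fun i => GZ_mono (Sτ_mono ?_) (k2 i), k3⟩
    · rw [hc]; exact k5
    · rw [hc]; exact k6
    · rw [hc]; exact k7
    · simp only [τ]; have : (0:ℝ) < (1/2) ^ (q+1) := by positivity
      linarith
  choose f hf1 hf2 using step
  have h0 : P 0 (v, R) := by
    refine ⟨?_, h1, ?_, ?_, ?_⟩
    · convert hER using 2; simp only [τ]; norm_num
    · simpa [Kq] using h2
    · simpa [Kq] using h3
    · simpa [Kq] using h4
  let s : ∀ q, {x // P q x} := fun q => Nat.rec ⟨(v, R), h0⟩ (fun q x => f q x) q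
  refine ⟨fun q => (s q).1.1, fun q => (s q).1.2, rfl, fun q => ⟨?_, hf1 q (s q), hf2 q (s q), (s q).2.2.1, (s q).2.2.2.2.1, (s q).2.2.2.2.2⟩⟩
  refine (s q).2.1.mono (Sτ_mono ?_)
  simp only [τ]; have : (0:ℝ) < (1/2) ^ q := by positivity
  linarith

/-- Hölder functions of `Fin n → ℝ` -/
def Hol {n : ℕ} (α : ℝ) (f : (Fin n → ℝ) → ℝ) : Prop := ∃ C, ∀ z z', |f z - f z'| ≤ C * ‖z - z'‖ ^ α

lemma lip_of {n : ℕ} {f : (Fin n → ℝ) → ℝ} (hf : Sm f) {M : ℝ} (hM : ∀ l z, |pD l f z| ≤ M) (z z') :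
    |f z - f z'| ≤ n * M * ‖z - z'‖ := by
  have := Convex.norm_image_sub_le_of_norm_fderiv_le (𝕜 := ℝ) (f := f) (s := Set.univ) (C := n * M) (x := z') (y := z)
    (fun x _ => hf.da x) (fun x _ => ?_) convex_univ trivial trivial
  · simpa [Real.norm_eq_abs] using this
  rcases Nat.eq_zero_or_pos n with h | h
  · subst h; simp [Subsingleton.elim (fderiv ℝ f x) 0]
  have hM0 : 0 ≤ M := (abs_nonneg _).trans (hM ⟨0, h⟩ x)
  refine ContinuousLinearMap.opNorm_le_bound _ (by positivity) fun e => ?_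
  rw [fderiv_eq_sum hf, Real.norm_eq_abs]
  refine (Finset.abs_sum_le_sum_abs _ _).trans ?_
  calc ∑ i, |e i * pD i f x| ≤ ∑ _i : Fin n, ‖e‖ * M := Finset.sum_le_sum fun i _ => by
        rw [abs_mul]; exact mul_le_mul (norm_le_pi_norm e i) (hM i x) (abs_nonneg _) (norm_nonneg _)
    _ = _ := by simp; ring

lemma hol_of {n : ℕ} {f : (Fin n → ℝ) → ℝ} {A B α : ℝ} (h0 : 0 < α) (h1 : α ≤ 1) (hA : 0 ≤ A) (hB : 0 ≤ B) (h : ∀ z, |f z| ≤ A)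
    (hl : ∀ z z', |f z - f z'| ≤ B * ‖z - z'‖) (z z') : |f z - f z'| ≤ (2 * A + B) * ‖z - z'‖ ^ α := by
  set d := ‖z - z'‖
  have hd : 0 ≤ d := norm_nonneg _
  have hp : 0 ≤ d ^ α := by positivity
  rcases le_total d 1 with h2 | h2
  · have : d ≤ d ^ α := by
      rcases hd.eq_or_lt with e | e
      · calc d = 0 := e.symm
          _ ≤ _ := hp
      · calc d = d ^ (1:ℝ) := (Real.rpow_one d).symm
          _ ≤ _ := Real.rpow_le_rpow_of_exponent_ge e h2 h1
    have h3 := hl z z'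
    have : B * d ≤ B * d ^ α := by gcongr
    have : 0 ≤ 2 * A * d ^ α := by positivity
    have h4 : |f z - f z'| ≤ B * d := h3
    linarith
  · have : 1 ≤ d ^ α := Real.one_le_rpow h2 h0.le
    have h3 : |f z - f z'| ≤ A + A := (abs_sub _ _).trans (add_le_add (h z) (h z'))
    nlinarith

lemma hol_term {d C k : ℝ} {m : ℕ} {x : ℝ} (hd : 0 ≤ d) (hk : 1 ≤ k) (hC : 0 ≤ C) (h1 : x ≤ C / k) (h2 : x ≤ k ^ m * d) :
    x ≤ (C + 1) * d ^ (1 / (2 * (m + 1) : ℝ)) * (Real.sqrt k)⁻¹ := by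
  set α := (1 / (2 * (m + 1) : ℝ)) with hα
  set D := d ^ α with hD
  set s := Real.sqrt k with hs
  have hs1 : 1 ≤ s := Real.one_le_sqrt.2 hk
  have hk2 : k = s ^ 2 := (Real.sq_sqrt (by linarith)).symm
  have hD0 : 0 ≤ D := by positivity
  have hs0 : 0 < s := by linarith
  rw [← div_eq_mul_inv, le_div_iff₀ hs0]
  rcases le_total 1 (D * s) with h | h
  · have : x * s ≤ C * D := by
      calc x * s ≤ C / k * s := by gcongr
        _ = C / s := by rw [hk2]; field_simp
        _ ≤ C * (D * s) / s := by gcongr; exact le_mul_of_one_le_right hC h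
        _ = C * D := by field_simp
    linarith
  · have hdD : d = D ^ (2 * m + 1) * D := by
      rw [← pow_succ, hD, ← Real.rpow_mul_natCast hd, hα]
      push_cast
      rw [show (1:ℝ) / (2 * (m + 1)) * (2 * m + 1 + 1) = 1 by field_simp; ring, Real.rpow_one]
    have : x * s ≤ D := by
      calc x * s ≤ k ^ m * d * s := by gcongr
        _ = (D * s) ^ (2 * m + 1) * D := by
          nth_rewrite 1 [hdD]; rw [hk2]; ring
        _ ≤ 1 * D := by gcongr; exact pow_le_one₀ (by positivity) h
        _ = D := one_mul _
    have : 0 ≤ C * D := by positivity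
    linarith

lemma hol_lim {n m : ℕ} {f : ℕ → (Fin n → ℝ) → ℝ} {k : ℕ → ℝ} {C C0 α : ℝ} (hC : 0 ≤ C) (hα : α = 1 / (2 * (m + 1) : ℝ))
    (hk : ∀ q, 4 ^ (q+1) ≤ k q) (hf0 : ∀ z z', |f 0 z - f 0 z'| ≤ C0 * ‖z - z'‖ ^ α)
    (h1 : ∀ q z, |f (q+1) z - f q z| ≤ C / k q) (h2 : ∀ q z z', |(f (q+1) z - f q z) - (f (q+1) z' - f q z')| ≤ k q ^ m * ‖z - z'‖) :
    ∃ F : (Fin n → ℝ) → ℝ, Hol α F ∧ (∀ q z, |F z - f q z| ≤ C * (1/2) ^ q) ∧ (∀ z, Filter.Tendsto (fun q => f q z) Filter.atTop (𝓝 (F z))) := by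
  have hk1 : ∀ q, 1 ≤ k q := fun q => (one_le_pow₀ (by norm_num)).trans (hk q)
  have hk2 : ∀ q, (Real.sqrt (k q))⁻¹ ≤ (1/2) ^ (q+1) := fun q => by
    rw [one_div, inv_pow]
    refine inv_anti₀ (by positivity) (Real.le_sqrt_of_sq_le ?_)
    refine le_trans (le_of_eq ?_) (hk q)
    rw [← pow_mul, mul_comm, pow_mul]; norm_num
  have hg : ∀ z q, dist (f q z) (f (q+1) z) ≤ C / 2 * (1/2) ^ q := fun z q => by
    rw [Real.dist_eq, abs_sub_comm]
    refine (h1 q z).trans ?_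
    have : (1:ℝ) / k q ≤ (1/2) ^ (q+1) := by
      rw [div_pow, one_pow]
      refine one_div_le_one_div_of_le (by positivity) (le_trans ?_ (hk q))
      gcongr; norm_num
    calc C / k q = C * (1 / k q) := by ring
      _ ≤ C * (1/2) ^ (q+1) := by gcongr
      _ = _ := by ring
  have hcau : ∀ z, CauchySeq (fun q => f q z) := fun z => cauchySeq_of_le_geometric (1/2) (C/2) (by norm_num) (hg z)
  choose F hF using fun z => cauchySeq_tendsto_of_complete (hcau z)
  have hq : ∀ q z z', |f q z - f q z'| ≤ (C0 + (2 * C + 1) * (1 - (1/2) ^ q)) * ‖z - z'‖ ^ α := by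
    intro q z z'
    induction q with
    | zero => simpa using hf0 z z'
    | succ q ih =>
      have t := hol_term (d := ‖z - z'‖) (C := 2 * C) (m := m) (norm_nonneg _) (hk1 q) (by positivity)
        (x := |(f (q+1) z - f q z) - (f (q+1) z' - f q z')|) (by
          refine (abs_sub _ _).trans ((add_le_add (h1 q z) (h1 q z')).trans (le_of_eq (by ring)))) (h2 q z z')
      rw [← hα] at t
      have t2 : (2 * C + 1) * ‖z - z'‖ ^ α * (Real.sqrt (k q))⁻¹ ≤ (2 * C + 1) * ‖z - z'‖ ^ α * (1/2) ^ (q+1) := by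
        gcongr; exact hk2 q
      have t3 : |f (q+1) z - f (q+1) z'| ≤ |f q z - f q z'| + |(f (q+1) z - f q z) - (f (q+1) z' - f q z')| := by
        refine le_trans (le_of_eq ?_) (abs_add_le _ _); congr 1; ring
      refine t3.trans ((add_le_add ih (t.trans t2)).trans (le_of_eq ?_))
      rw [pow_succ]; ring
  refine ⟨F, ⟨C0 + (2 * C + 1), fun z z' => ?_⟩, fun q z => ?_, hF⟩
  · refine le_of_tendsto (((hF z).sub (hF z')).abs) (Filter.Eventually.of_forall fun q => (hq q z z').trans ?_)
    gcongr
    have : (0:ℝ) ≤ (1/2) ^ q := by positivity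
    nlinarith
  · have := dist_le_of_le_geometric_of_tendsto (1/2) (C/2) (by norm_num) (hg z) (hF z) q
    rw [dist_comm, Real.dist_eq] at this
    refine this.trans (le_of_eq (by ring))
end CI

namespace CI
open scoped ContDiff Topology

lemma limit : ∃ (α : ℝ) (K0 : ℕ), 0 < α ∧ α ≤ 1 ∧ ∀ (K : ℕ) (ε : ℝ) (p : ZF) (v : VF) (R : TF),
    K0 ≤ K → 0 < ε → ε ≤ K → ER p (Sτ (1/16)) v R → (∀ i j z, |R i j z| ≤ ε ^ 2 / 100) → (∀ l i j z, |pD l (R i j) z| ≤ K) →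
    (∀ i z, |v i z| ≤ K) → (∀ l i z, |pD l (v i) z| ≤ K) →
    ∃ (W : VF) (V : ℕ → VF) (Q : ℕ → TF), (∀ i, Hol α (W i)) ∧ (∀ i z, z 0 ∈ Sτ (1/8) → W i z = v i z) ∧
      (∀ i (j : Fin 3) z, W i (z + ee j.succ) = W i z) ∧
      (∀ q, ER p (Sτ (1/8)) (V q) (Q q)) ∧ ∀ η > 0, ∃ q, (∀ i z, |V q i z - W i z| ≤ η) ∧ ∀ i j z, |Q q i j z| ≤ η := by
  obtain ⟨C, b, K0, hb, hK0, hit⟩ := iter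
  have hm : (0:ℝ) < 2 * ((b ^ 2 + 1 : ℕ) + 1) := by positivity
  refine ⟨1 / (2 * ((b ^ 2 + 1 : ℕ) + 1) : ℝ), K0, by positivity, ?_, fun K ε p v R hK hε hεK hER h1 h2 h3 h4 => ?_⟩
  · rw [div_le_one hm]
    have : (0:ℝ) ≤ (b ^ 2 + 1 : ℕ) := by positivity
    linarith
  set α := 1 / (2 * ((b ^ 2 + 1 : ℕ) + 1) : ℝ) with hα
  have hα0 : 0 < α := by positivity
  have hα1 : α ≤ 1 := by
    rw [hα, div_le_one hm]
    have : (0:ℝ) ≤ (b ^ 2 + 1 : ℕ) := by positivity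
    linarith
  obtain ⟨V, Q, hV0, H⟩ := hit K ε p v R hK hε hεK hER h1 h2 h3 h4
  have hK16 : 2 ^ 16 ≤ K := hK0.trans hK
  have hkge : ∀ q, (8:ℝ) ≤ Kq b K q := fun q => by
    have := Kq_ge' hb hK16 q
    exact_mod_cast (by omega : 8 ≤ Kq b K q)
  have hk4 : ∀ q, (4:ℝ) ^ (q+1) ≤ Kq b K q := fun q => by
    have := Kq_ge hb hK16 q
    have h2 : 4 ^ (q+1) ≤ (2 ^ 16) ^ (q+1) := Nat.pow_le_pow_left (by norm_num) _
    exact_mod_cast h2.trans this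
  have sV : ∀ q i, Sm (V q i) := fun q i => ((H q).1.gv i).sm
  have key : ∀ i, ∃ F : (Fin 4 → ℝ) → ℝ, Hol α F ∧ (∀ q z, |F z - V (q+1) i z| ≤ max C 0 * (1/2) ^ q) ∧
      (∀ z, Filter.Tendsto (fun q => V (q+1) i z) Filter.atTop (𝓝 (F z))) := by
    intro i
    refine hol_lim (m := b ^ 2 + 1) (f := fun q => V (q+1) i) (k := fun q => (Kq b K q : ℝ)) (C := max C 0)
      (C0 := 2 * (Kq b K 1 : ℝ) + 4 * Kq b K 1) (le_max_right _ _) hα hk4 ?_ ?_ ?_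
    · refine hol_of hα0 hα1 (by positivity) (by positivity) (fun z => (H 1).2.2.2.2.1 i z) ?_
      intro z z'
      have := lip_of (sV 1 i) (fun l z => (H 1).2.2.2.2.2 l i z) z z'
      simpa using this
    · intro q z
      refine ((H (q+1)).2.2.1 i z).trans ?_
      simp only [eq']
      rw [div_eq_mul_one_div (max C 0)]
      gcongr
      exact le_max_left _ _
    · intro q z z'
      set k : ℝ := (Kq b K q : ℝ) with hk
      have e1 : ((Kq b K (q+1) : ℕ) : ℝ) = k ^ b := by rw [Kq_succ]; push_cast; rfl
      have e2 : ((Kq b K (q+1+1) : ℕ) : ℝ) = k ^ b ^ 2 := by rw [Kq_succ]; push_cast; rw [e1, ← pow_mul, sq]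
      have hk8 : 8 ≤ k := hkge q
      have hk1 : 1 ≤ k := by linarith
      have e3 : k ^ b ≤ k ^ b ^ 2 := pow_le_pow_right₀ hk1 (by nlinarith)
      have := lip_of (f := fun z => V (q+1+1) i z - V (q+1) i z) ((sV _ i).sub (sV _ i)) (M := k ^ b ^ 2 + k ^ b ^ 2) (fun l z => by
        rw [pD_sub (sV _ i) (sV _ i)]
        have a1 := (H (q+1+1)).2.2.2.2.2 l i z
        have a2 := (H (q+1)).2.2.2.2.2 l i z
        rw [e2] at a1; rw [e1] at a2
        exact (abs_sub _ _).trans (add_le_add a1 (a2.trans e3))) z z'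
      refine this.trans ?_
      have : 0 ≤ k ^ b ^ 2 := by positivity
      refine mul_le_mul_of_nonneg_right ?_ (norm_nonneg _)
      rw [pow_succ k (b ^ 2)]; push_cast
      have := mul_le_mul_of_nonneg_left hk8 this
      linarith
  choose W hW1 hW2 hW3 using key
  have hVz : ∀ q i z, z 0 ∈ Sτ (1/8) → V q i z = v i z := by
    intro q i z hz
    induction q with
    | zero => rw [hV0]
    | succ q ih => have := ((H q).2.1 i).van z hz; linarith
  refine ⟨W, fun q => V (q+1), fun q => Q (q+1), hW1, fun i z hz => ?_, fun i j z => ?_, fun q => (H (q+1)).1, fun η hη => ?_⟩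
  · refine tendsto_nhds_unique (hW3 i z) ?_
    simp only [hVz _ i z hz]; exact tendsto_const_nhds
  · refine tendsto_nhds_unique (hW3 i _) ?_
    simp only [((H _).1.gv i).pr j z]; exact hW3 i z
  · have t : Filter.Tendsto (fun q : ℕ => (max C 0 + 1) * (1/2:ℝ) ^ q) Filter.atTop (𝓝 0) := by
      simpa using (tendsto_pow_atTop_nhds_zero_of_lt_one (r := (1/2:ℝ)) (by norm_num) (by norm_num)).const_mul (max C 0 + 1)
    obtain ⟨q, hq⟩ := (t.eventually (gt_mem_nhds hη)).exists
    have h0 : (0:ℝ) < (1/2) ^ q := by positivity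
    have hM : 0 ≤ max C 0 := le_max_right _ _
    refine ⟨q, fun i z => ?_, fun i j z => ?_⟩
    · rw [abs_sub_comm]; exact (hW2 i q z).trans (by nlinarith)
    · refine ((H (q+1)).2.2.2.1 i j z).trans ?_
      simp only [eq']
      have hk := hk4 q
      have a : (1:ℝ) / (Kq b K q) ≤ (1/2) ^ q := by
        rw [div_pow, one_pow]
        refine one_div_le_one_div_of_le (by positivity) (le_trans ?_ hk)
        calc (2:ℝ) ^ q ≤ 4 ^ q := by gcongr; norm_num
          _ ≤ _ := pow_le_pow_right₀ (by norm_num) (by omega)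
      have a0 : (0:ℝ) ≤ 1 / (Kq b K q) := by positivity
      have a1 : ((1:ℝ)/2) ^ q ≤ 1 := pow_le_one₀ (by norm_num) (by norm_num)
      nlinarith
end CI

namespace CI
open scoped ContDiff Topology

/-- space-time points -/
def cz (t : ℝ) (x : Spc) : Fin 4 → ℝ := Fin.cons t x
@[simp] lemma cz_0 (t x) : cz t x 0 = t := rfl
@[simp] lemma cz_s (t x) (j : Fin 3) : cz t x j.succ = x j := rfl

def bxa (T : ℝ) : Fin 4 → ℝ := Fin.cons (-T) (fun _ => 0)
def bxb (T : ℝ) : Fin 4 → ℝ := Fin.cons T (fun _ => 1)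

lemma cz_cont : Continuous (fun q : ℝ × Spc => cz q.1 q.2) := by
  refine continuous_pi fun i => ?_
  refine Fin.cases ?_ (fun j => ?_) i
  · exact continuous_fst
  · exact (continuous_apply j).comp continuous_snd

lemma int_conv {F : ZF} (hF : Continuous F) {T : ℝ} (h : ∀ z, T < |z 0| → F z = 0) :
    ∫ t : ℝ, ∫ x in Tdom, F (cz t x) = ∫ z in Set.Icc (bxa T) (bxb T), F z := by
  have hmp := (volume_preserving_piFinSuccAbove (fun _ : Fin 4 => ℝ) 0).symm
  have hcs : ∀ q : ℝ × Spc, (MeasurableEquiv.piFinSuccAbove (fun _ : Fin 4 => ℝ) 0).symm q = cz q.1 q.2 := by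
    intro q
    simp [MeasurableEquiv.piFinSuccAbove, Fin.insertNthEquiv, cz]
  have hpre : (MeasurableEquiv.piFinSuccAbove (fun _ : Fin 4 => ℝ) 0).symm ⁻¹' (Set.Icc (bxa T) (bxb T)) =
      (Set.Icc (-T) T) ×ˢ (Set.Icc (fun _ => (0:ℝ)) (fun _ => (1:ℝ)) : Set (Fin 3 → ℝ)) := by
    ext ⟨t, x⟩
    rw [Set.mem_preimage, hcs]
    exact ⟨fun ⟨h1, h2⟩ => ⟨⟨h1 0, h2 0⟩, fun j => h1 j.succ, fun j => h2 j.succ⟩,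
      fun ⟨⟨a, b⟩, c, d⟩ => ⟨fun i => Fin.cases a c i, fun i => Fin.cases b d i⟩⟩
  have hTd : (Set.Icc (fun _ => (0:ℝ)) (fun _ => (1:ℝ)) : Set (Fin 3 → ℝ)) =ᵐ[volume] Tdom :=
    (Measure.univ_pi_Ico_ae_eq_Icc (μ := fun _ : Fin 3 => (volume : Measure ℝ)) (f := fun _ => (0:ℝ)) (g := fun _ => 1)).symm
  rw [← hmp.setIntegral_preimage_emb (MeasurableEquiv.measurableEmbedding _), hpre]
  simp only [hcs]
  have hint : IntegrableOn (fun q : ℝ × Spc => F (cz q.1 q.2)) (Set.Icc (-T) T ×ˢ (Set.Icc (fun _ => (0:ℝ)) (fun _ => (1:ℝ)))) (volume.prod volume) :=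
    ((hF.comp cz_cont).continuousOn).integrableOn_compact (isCompact_Icc.prod isCompact_Icc)
  rw [show (volume : Measure (ℝ × Spc)) = volume.prod volume from rfl, setIntegral_prod _ hint]
  simp only [setIntegral_congr_set hTd]
  refine (setIntegral_eq_integral_of_forall_compl_eq_zero fun t ht => ?_).symm
  have ht : T < |t| := by
    rw [Set.mem_Icc, ← abs_le] at ht; exact not_le.1 ht
  simp [h (cz t _) (by simpa using ht)]

/-- divergence theorem on the time slab -/
lemma int_div {f : Fin 4 → ZF} (hf : ∀ i, GZ ∅ (f i)) {T : ℝ} (hT : 0 ≤ T) (h : ∀ i z, T < |z 0| → f i z = 0) :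
    ∫ z in Set.Icc (bxa (T+1)) (bxb (T+1)), ∑ i, pD i (f i) z = 0 := by
  have hle : bxa (T+1) ≤ bxb (T+1) := by
    intro i
    refine Fin.cases ?_ (fun j => ?_) i
    · simp [bxa, bxb]; linarith
    · simp [bxa, bxb]
  have := integral_divergence_of_hasFDerivAt_off_countable' (bxa (T+1)) (bxb (T+1)) hle f (fun i z => fderiv ℝ (f i) z) ∅ Set.countable_empty
    (fun i => (hf i).sm.cont.continuousOn) (fun x _ i => ((hf i).sm.da x).hasFDerivAt)
    ((Sm.sum (s := Finset.univ) fun j _ => (hf j).sm.pD j).cont.continuousOn.integrableOn_compact isCompact_Icc)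
  refine this.trans (Finset.sum_eq_zero fun i _ => ?_)
  rw [sub_eq_zero]
  congr 1
  funext x
  induction i using Fin.cases with
  | zero =>
    have e1 : T < |(Fin.insertNth (0 : Fin 4) (bxb (T+1) 0) x : Fin 4 → ℝ) 0| := by
      simp [bxb]; rw [abs_of_nonneg] <;> linarith
    have e2 : T < |(Fin.insertNth (0 : Fin 4) (bxa (T+1) 0) x : Fin 4 → ℝ) 0| := by
      simp [bxa]; rw [abs_of_nonpos] <;> linarith
    rw [h _ _ e1, h _ _ e2]
  | succ j =>
    refine Eq.trans ?_ ((hf j.succ).pr j _)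
    congr 1
    funext a
    rcases eq_or_ne a j.succ with rfl | ha
    · simp [bxa, bxb]
    · obtain ⟨b, rfl⟩ := Fin.exists_succAbove_eq ha
      simp
end CI

namespace CI
open scoped ContDiff Topology

/-- integrand of the weak formulation -/
def wf (W : VF) (p : ZF) (φ : VF) : ZF := fun z => (∑ l, W l z * pD 0 (φ l) z) + (∑ j : Fin 3, ∑ l, W j z * W l z * pD j.succ (φ l) z) +
  p z * ∑ j : Fin 3, pD j.succ (φ j) z

lemma wf_id {p : ZF} {S : Set ℝ} {v : VF} {R : TF} (hp : GZ ∅ p) (H : ER p S v R) {φ : VF} (hφ : ∀ l, GZ ∅ (φ l)) {T : ℝ} (hT : 0 ≤ T)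
    (h : ∀ l z, T < |z 0| → φ l z = 0) :
    ∫ z in Set.Icc (bxa (T+1)) (bxb (T+1)), (wf v p φ z - ∑ j : Fin 3, ∑ l, R l j z * pD j.succ (φ l) z) = 0 := by
  have gv := H.gv
  have gR : ∀ i j, GZ ∅ (R i j) := fun i j => GZe (H.gR i j)
  have sv := fun i => (gv i).sm
  have sR := fun i j => (gR i j).sm
  have sφ := fun i => (hφ i).sm
  let f : Fin 4 → ZF := Fin.cons (fun z => ∑ l, v l z * φ l z)
    (fun j z => (∑ l, (v l z * v j z - R l j z) * φ l z) + p z * φ j z)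
  have gf : ∀ i, GZ ∅ (f i) := by
    intro i
    refine Fin.cases ?_ (fun j => ?_) i
    · show GZ ∅ (fun z => ∑ l, v l z * φ l z)
      exact Gd.sum (s := Finset.univ) fun l _ => GZ.mulL (gv l) (hφ l)
    · show GZ ∅ (fun z => (∑ l, (v l z * v j z - R l j z) * φ l z) + p z * φ j z)
      exact (Gd.sum (s := Finset.univ) fun l _ => GZ.mulL ((GZ.mulL (gv l) (gv j)).sub (gR l j)) (hφ l)).add (GZ.mulL hp (hφ j))
  have f0 : ∀ i z, T < |z 0| → f i z = 0 := by
    intro i z hz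
    refine Fin.cases ?_ (fun j => ?_) i
    · simp [f, h _ z hz]
    · simp [f, h _ z hz]
  rw [← int_div gf hT f0]
  congr 1
  funext z
  have d0 : pD 0 (f 0) = fun z => ∑ l, (pD 0 (v l) z * φ l z + v l z * pD 0 (φ l) z) := by
    show pD 0 (fun z => ∑ l, v l z * φ l z) = _
    rw [pD_sum fun l _ => (sv l).mul (sφ l)]
    funext z
    refine Finset.sum_congr rfl fun l _ => ?_
    rw [pD_mul (sv l) (sφ l)]
  have dj : ∀ j : Fin 3, pD j.succ (f j.succ) = fun z => (∑ l, ((pD j.succ (fun z => v l z * v j z) z - pD j.succ (R l j) z) * φ l z +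
      (v l z * v j z - R l j z) * pD j.succ (φ l) z)) + (pD j.succ p z * φ j z + p z * pD j.succ (φ j) z) := by
    intro j
    show pD j.succ (fun z => (∑ l, (v l z * v j z - R l j z) * φ l z) + p z * φ j z) = _
    rw [pD_add (Sm.sum (s := Finset.univ) fun l _ => (((sv l).mul (sv j)).sub (sR l j)).mul (sφ l)) (hp.sm.mul (sφ j)), pD_mul hp.sm (sφ j),
      pD_sum fun l _ => (((sv l).mul (sv j)).sub (sR l j)).mul (sφ l)]
    funext z
    congr 1
    refine Finset.sum_congr rfl fun l _ => ?_
    rw [pD_mul (((sv l).mul (sv j)).sub (sR l j)) (sφ l), pD_sub ((sv l).mul (sv j)) (sR l j)]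
  rw [Fin.sum_univ_succ (fun i => pD i (f i) z), d0]
  simp only [dj]
  have E0 := H.eq 0 z
  have E1 := H.eq 1 z
  have E2 := H.eq 2 z
  simp only [dv, Fin.sum_univ_three] at E0 E1 E2
  simp only [wf, Fin.sum_univ_three]
  linear_combination (-φ 0 z) * E0 - φ 1 z * E1 - φ 2 z * E2

lemma div_id {p : ZF} {S : Set ℝ} {v : VF} {R : TF} (H : ER p S v R) {ψ : ZF} (hψ : GZ ∅ ψ) {T : ℝ} (hT : 0 ≤ T)
    (h : ∀ z, T < |z 0| → ψ z = 0) :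
    ∫ z in Set.Icc (bxa (T+1)) (bxb (T+1)), (∑ j : Fin 3, v j z * pD j.succ ψ z) = 0 := by
  have gv := H.gv
  have sv := fun i => (gv i).sm
  let f : Fin 4 → ZF := Fin.cons (fun _ => 0) (fun j z => v j z * ψ z)
  have gf : ∀ i, GZ ∅ (f i) := by
    intro i
    refine Fin.cases ?_ (fun j => ?_) i
    · exact Gd.zero
    · exact GZ.mulL (gv j) hψ
  have f0 : ∀ i z, T < |z 0| → f i z = 0 := by
    intro i z hz
    refine Fin.cases ?_ (fun j => ?_) i
    · simp [f]
    · simp [f, h z hz]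
  rw [← int_div gf hT f0]
  congr 1
  funext z
  have d0 : pD 0 (f 0) = fun z => 0 := pD_const 0
  have dj : ∀ j : Fin 3, pD j.succ (f j.succ) = fun z => pD j.succ (v j) z * ψ z + v j z * pD j.succ ψ z := by
    intro j
    exact pD_mul (sv j) hψ.sm
  rw [Fin.sum_univ_succ (fun i => pD i (f i) z), d0]
  simp only [dj]
  have E := H.dv0 z
  simp only [Fin.sum_univ_three] at E ⊢
  linear_combination (-ψ z) * E

/-- passing to the limit in integrals over a compact box -/
lemma lim_int {a b : Fin 4 → ℝ} {F : ZF} (hF : Continuous F) {C : ℝ}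
    (h : ∀ η, 0 < η → η ≤ 1 → ∃ G : ZF, Continuous G ∧ (∫ z in Set.Icc a b, G z) = 0 ∧ ∀ z ∈ Set.Icc a b, |F z - G z| ≤ C * η) :
    ∫ z in Set.Icc a b, F z = 0 := by
  set m := (volume.real (Set.Icc a b)) with hm
  have hm0 : 0 ≤ m := measureReal_nonneg
  have key : ∀ η, 0 < η → η ≤ 1 → |∫ z in Set.Icc a b, F z| ≤ (C * m) * η := by
    intro η h0 h1
    obtain ⟨G, hG, hG0, hFG⟩ := h η h0 h1
    have iF : IntegrableOn F (Set.Icc a b) := hF.continuousOn.integrableOn_compact isCompact_Icc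
    have iG : IntegrableOn G (Set.Icc a b) := hG.continuousOn.integrableOn_compact isCompact_Icc
    have e : ∫ z in Set.Icc a b, F z = ∫ z in Set.Icc a b, (F z - G z) := by
      rw [integral_sub iF iG, hG0, sub_zero]
    rw [e]
    have := norm_setIntegral_le_of_norm_le_const (μ := volume) (s := Set.Icc a b) (f := fun z => F z - G z) (C := C * η)
      isCompact_Icc.measure_lt_top hFG
    rw [Real.norm_eq_abs] at this
    refine this.trans (le_of_eq ?_)
    rw [hm]; ring
  rw [← abs_nonpos_iff]
  refine le_of_tendsto_of_tendsto (f := fun _ : ℝ => |∫ z in Set.Icc a b, F z|) (g := fun η => (C * m) * η) (b := 𝓝[>] 0)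
    tendsto_const_nhds ?_ ?_
  · have : Filter.Tendsto (fun η : ℝ => (C * m) * η) (𝓝 0) (𝓝 ((C * m) * 0)) := (continuous_const.mul continuous_id).tendsto 0
    rw [mul_zero] at this
    exact this.mono_left nhdsWithin_le_nhds
  · filter_upwards [Ioo_mem_nhdsGT (show (0:ℝ) < 1 by norm_num)] with η hη
    exact key η hη.1 hη.2.le

lemma Hol.cont {n : ℕ} {α : ℝ} (hα : 0 < α) {f : (Fin n → ℝ) → ℝ} (h : Hol α f) : Continuous f := by
  obtain ⟨C, hC⟩ := h
  refine continuous_iff_continuousAt.2 fun z => ?_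
  rw [ContinuousAt, tendsto_iff_dist_tendsto_zero]
  have : Filter.Tendsto (fun y => C * ‖y - z‖ ^ α) (𝓝 z) (𝓝 0) := by
    have : Continuous (fun y : Fin n → ℝ => C * ‖y - z‖ ^ α) :=
      continuous_const.mul ((continuous_norm.comp (continuous_id.sub continuous_const)).rpow_const fun _ => Or.inr hα.le)
    simpa [Real.zero_rpow hα.ne'] using this.tendsto z
  exact squeeze_zero (fun _ => dist_nonneg) (fun y => hC y z) this

lemma weak_mom {p : ZF} {S : Set ℝ} (hp : GZ ∅ p) {W : VF} (hW : ∀ i, Continuous (W i)) {V : ℕ → VF} {Q : ℕ → TF}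
    (H : ∀ q, ER p S (V q) (Q q)) (hl : ∀ η > 0, ∃ q, (∀ i z, |V q i z - W i z| ≤ η) ∧ ∀ i j z, |Q q i j z| ≤ η)
    {φ : VF} (hφ : ∀ l, GZ ∅ (φ l)) {T : ℝ} (hT : 0 ≤ T) (h : ∀ l z, T < |z 0| → φ l z = 0) :
    ∫ z in Set.Icc (bxa (T+1)) (bxb (T+1)), wf W p φ z = 0 := by
  have sφ := fun i => (hφ i).sm
  have bdc : ∀ f : ZF, Continuous f → ∃ B, ∀ z ∈ Set.Icc (bxa (T+1)) (bxb (T+1)), |f z| ≤ B := fun f hf =>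
    isCompact_Icc.exists_bound_of_continuousOn hf.continuousOn
  choose B hB using fun (a : Fin 4) (l : Fin 3) => bdc (pD a (φ l)) ((sφ l).pD a).cont
  choose M hM using fun (l : Fin 3) => bdc (W l) (hW l)
  have cR : ∀ v : VF, (∀ i, Continuous (v i)) → Continuous (wf v p φ) := fun v hv => by
    unfold wf
    refine ((continuous_finsetSum _ fun l _ => (hv l).mul ((sφ l).pD 0).cont).add
      (continuous_finsetSum _ fun j _ => continuous_finsetSum _ fun l _ => ((hv j).mul (hv l)).mul ((sφ l).pD _).cont)).add
      (hp.sm.cont.mul (continuous_finsetSum _ fun j _ => ((sφ j).pD _).cont))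
  refine lim_int (cR W hW) (C := (∑ l, |B 0 l|) + (∑ j : Fin 3, ∑ l, (|M j| + (|M l| + 1)) * |B j.succ l|) + ∑ j : Fin 3, ∑ l, |B j.succ l|) fun η h0 h1 => ?_
  obtain ⟨q, hq1, hq2⟩ := hl η h0
  refine ⟨_, ?_, wf_id hp (H q) hφ hT h, fun z hz => ?_⟩
  · refine (cR (V q) fun i => ((H q).gv i).sm.cont).sub (continuous_finsetSum _ fun j _ => continuous_finsetSum _ fun l _ =>
      ((H q).gR l j).sm.cont.mul ((sφ l).pD _).cont)
  have e : wf W p φ z - (wf (V q) p φ z - ∑ j : Fin 3, ∑ l, Q q l j z * pD j.succ (φ l) z) =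
      (∑ l, (W l z - V q l z) * pD 0 (φ l) z) + (∑ j : Fin 3, ∑ l, (W j z * W l z - V q j z * V q l z) * pD j.succ (φ l) z) +
      ∑ j : Fin 3, ∑ l, Q q l j z * pD j.succ (φ l) z := by
    simp only [wf, sub_mul, Finset.sum_sub_distrib]; ring
  rw [e]
  have b1 : ∀ a l, |pD a (φ l) z| ≤ |B a l| := fun a l => (hB a l z hz).trans (le_abs_self _)
  have m1 : ∀ l, |W l z| ≤ |M l| := fun l => (hM l z hz).trans (le_abs_self _)
  have d1 : ∀ l, |W l z - V q l z| ≤ η := fun l => by rw [abs_sub_comm]; exact hq1 l z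
  refine (abs_add_le _ _).trans ((add_le_add ((abs_add_le _ _).trans (add_le_add ((Finset.abs_sum_le_sum_abs _ _).trans
    (Finset.sum_le_sum (g := fun l => |B 0 l| * η) fun l _ => ?_)) ((Finset.abs_sum_le_sum_abs _ _).trans
    (Finset.sum_le_sum (g := fun j => ∑ l, ((|M j| + (|M l| + 1)) * |B j.succ l|) * η) fun j _ => (Finset.abs_sum_le_sum_abs _ _).trans (Finset.sum_le_sum fun l _ => ?_)))))
    ((Finset.abs_sum_le_sum_abs _ _).trans
    (Finset.sum_le_sum (g := fun j => ∑ l, |B j.succ l| * η) fun j _ => (Finset.abs_sum_le_sum_abs _ _).trans (Finset.sum_le_sum fun l _ => ?_)))).trans (le_of_eq ?_))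
  · rw [abs_mul, mul_comm]
    exact mul_le_mul (b1 0 l) (d1 l) (abs_nonneg _) (abs_nonneg _)
  · rw [abs_mul, mul_right_comm]
    refine mul_le_mul ?_ (b1 _ l) (abs_nonneg _) (by positivity)
    have vl : |V q l z| ≤ |M l| + 1 := by
      have : |V q l z| ≤ |W l z| + |V q l z - W l z| := by
        refine le_trans (le_of_eq ?_) (abs_add_le _ _); congr 1; ring
      linarith [m1 l, hq1 l z]
    calc |W j z * W l z - V q j z * V q l z| = |W j z * (W l z - V q l z) + (W j z - V q j z) * V q l z| := by congr 1; ring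
      _ ≤ |W j z| * |W l z - V q l z| + |W j z - V q j z| * |V q l z| := by rw [← abs_mul, ← abs_mul]; exact abs_add_le _ _
      _ ≤ |M j| * η + η * (|M l| + 1) := by
        exact add_le_add (mul_le_mul (m1 j) (d1 l) (abs_nonneg _) (abs_nonneg _)) (mul_le_mul (d1 j) vl (abs_nonneg _) h0.le)
      _ = _ := by ring
  · rw [abs_mul, mul_comm]
    exact mul_le_mul (b1 _ l) (hq2 _ _ z) (abs_nonneg _) (abs_nonneg _)
  · simp only [add_mul, Finset.sum_mul]

lemma weak_div {p : ZF} {S : Set ℝ} {W : VF} (hW : ∀ i, Continuous (W i)) {V : ℕ → VF} {Q : ℕ → TF}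
    (H : ∀ q, ER p S (V q) (Q q)) (hl : ∀ η > 0, ∃ q, (∀ i z, |V q i z - W i z| ≤ η) ∧ ∀ i j z, |Q q i j z| ≤ η)
    {ψ : ZF} (hψ : GZ ∅ ψ) {T : ℝ} (hT : 0 ≤ T) (h : ∀ z, T < |z 0| → ψ z = 0) :
    ∫ z in Set.Icc (bxa (T+1)) (bxb (T+1)), (∑ j : Fin 3, W j z * pD j.succ ψ z) = 0 := by
  have bdc : ∀ f : ZF, Continuous f → ∃ B, ∀ z ∈ Set.Icc (bxa (T+1)) (bxb (T+1)), |f z| ≤ B := fun f hf =>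
    isCompact_Icc.exists_bound_of_continuousOn hf.continuousOn
  choose B hB using fun (a : Fin 4) => bdc (pD a ψ) (hψ.sm.pD a).cont
  have cR : ∀ v : VF, (∀ i, Continuous (v i)) → Continuous (fun z => ∑ j : Fin 3, v j z * pD j.succ ψ z) := fun v hv =>
    continuous_finsetSum _ fun l _ => (hv l).mul (hψ.sm.pD _).cont
  refine lim_int (cR W hW) (C := ∑ j : Fin 3, |B j.succ|) fun η h0 h1 => ?_
  obtain ⟨q, hq1, hq2⟩ := hl η h0
  refine ⟨_, cR (V q) fun i => ((H q).gv i).sm.cont, div_id (H q) hψ hT h, fun z hz => ?_⟩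
  rw [← Finset.sum_sub_distrib, Finset.sum_mul]
  refine (Finset.abs_sum_le_sum_abs _ _).trans (Finset.sum_le_sum fun j _ => ?_)
  rw [← sub_mul, abs_mul, mul_comm, abs_sub_comm (W j z)]
  exact mul_le_mul ((hB _ z hz).trans (le_abs_self _)) (hq1 j z) (abs_nonneg _) (abs_nonneg _)
end CI

namespace CI
open scoped ContDiff Topology

/-- functions on space-time as functions of four variables -/
def tz (f : ℝ → Spc → ℝ) : ZF := fun z => f (z 0) (fun j => z j.succ)
lemma tz_cz (f : ℝ → Spc → ℝ) (t x) : tz f (cz t x) = f t x := rfl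
lemma cz_eta (z : Fin 4 → ℝ) : cz (z 0) (fun j => z j.succ) = z := by
  funext i; refine Fin.cases rfl (fun j => rfl) i

/-- the linear map `x ↦ (0,x)` -/
def czL : Spc →L[ℝ] (Fin 4 → ℝ) := ContinuousLinearMap.pi (fun i => Fin.cases (0 : Spc →L[ℝ] ℝ) (fun j => ContinuousLinearMap.proj j) i)
lemma czL_apply (x : Spc) : czL x = cz 0 x := by
  funext i; refine Fin.cases rfl (fun j => rfl) i
lemma czL_single (j : Fin 3) : czL (Pi.single j 1) = ee j.succ := by
  rw [czL_apply]
  funext i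
  refine Fin.cases ?_ (fun k => ?_) i
  · simp [ee]
  · by_cases h : k = j
    · subst h; simp [ee]
    · simp [ee, h]
lemma cz_add (t : ℝ) (x : Spc) : cz t x = t • ee 0 + czL x := by
  rw [czL_apply]
  funext i
  refine Fin.cases ?_ (fun k => ?_) i <;> simp [ee]

lemma bridge_x {f : ℝ → Spc → ℝ} {t : ℝ} {x : Spc} (h : DifferentiableAt ℝ (tz f) (cz t x)) (j : Fin 3) :
    pd j (f t) x = pD j.succ (tz f) (cz t x) := by
  have h1 : HasFDerivAt (fun y => cz t y) czL x := by
    have : (fun y => cz t y) = fun y => t • ee 0 + czL y := by funext y; exact cz_add t y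
    rw [this]
    exact czL.hasFDerivAt.const_add _
  have h2 : HasFDerivAt (f t) ((fderiv ℝ (tz f) (cz t x)).comp czL) x := h.hasFDerivAt.comp x h1
  unfold pd pD
  rw [h2.fderiv, ContinuousLinearMap.comp_apply, czL_single]

lemma bridge_t {f : ℝ → Spc → ℝ} {t : ℝ} {x : Spc} (h : DifferentiableAt ℝ (tz f) (cz t x)) :
    pt f t x = pD 0 (tz f) (cz t x) := by
  have h1 : HasDerivAt (fun s => cz s x) (ee 0) t := by
    have : (fun s => cz s x) = fun s => s • ee 0 + czL x := by funext y; exact cz_add y x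
    rw [this]
    simpa using ((hasDerivAt_id t).smul_const (ee 0 : Fin 4 → ℝ)).add_const (czL x)
  have h2 : HasDerivAt (fun s => f s x) (fderiv ℝ (tz f) (cz t x) (ee 0)) t :=
    HasFDerivAt.comp_hasDerivAt (l := tz f) (f := fun s => cz s x) t h.hasFDerivAt h1
  exact h2.deriv

lemma tz_per {f : ℝ → Spc → ℝ} (h : ∀ t, Per (f t)) : ∀ p ∈ PZ, ∀ z, tz f (z + p) = tz f z := by
  rintro p ⟨j, rfl⟩ z
  have := h (z 0) (fun i => z i.succ) (Pi.single j 1)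
  unfold tz
  rw [← this]
  have e0 : (z + ee j.succ) 0 = z 0 := by simp [ee]
  rw [e0]
  congr 1
  funext i
  by_cases hi : i = j
  · subst hi; simp [ee]
  · simp [ee, hi]

lemma per_int {f : ZF} (h : ∀ (j : Fin 3) z, f (z + ee j.succ) = f z) (j : Fin 3) (n : ℤ) (z) : f (z + (n:ℝ) • ee j.succ) = f z := by
  have : Function.Periodic f (ee j.succ) := fun z => h j z
  have := (this.zsmul n) z
  rw [← this]; congr 2
  exact Int.cast_smul_eq_zsmul ℝ n (ee j.succ : Fin 4 → ℝ)

lemma cz_shift (t : ℝ) (x : Spc) (k : Fin 3 → ℤ) : cz t (fun i => x i + (k i : ℝ)) =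
    ((cz t x + (k 0 : ℝ) • ee (Fin.succ (0 : Fin 3))) + (k 1 : ℝ) • ee (Fin.succ (1 : Fin 3))) + (k 2 : ℝ) • ee (Fin.succ (2 : Fin 3)) := by
  funext i
  refine Fin.cases ?_ (fun j => ?_) i
  · simp [ee]
  · fin_cases j <;> simp [ee, cz] <;> rfl

lemma per_cz {f : ZF} (h : ∀ (j : Fin 3) z, f (z + ee j.succ) = f z) (t) : Per (fun x => f (cz t x)) := by
  intro x k
  show f (cz t _) = f (cz t x)
  rw [cz_shift, per_int h, per_int h, per_int h]

lemma bd_per {f : ZF} (hf : Continuous f) (h : ∀ (j : Fin 3) z, f (z + ee j.succ) = f z) {T : ℝ} (h0 : ∀ z, T < |z 0| → f z = 0) :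
    ∃ M, 0 ≤ M ∧ ∀ z, |f z| ≤ M := by
  obtain ⟨M, hM⟩ := (isCompact_Icc (a := bxa T) (b := bxb T)).exists_bound_of_continuousOn hf.continuousOn
  refine ⟨|M|, abs_nonneg _, fun z => ?_⟩
  rcases lt_or_ge T |z 0| with hz | hz
  · rw [h0 z hz, abs_zero]; exact abs_nonneg _
  have e : f z = f (cz (z 0) (fun j => z j.succ + ((-⌊z j.succ⌋ : ℤ) : ℝ))) := by
    have := per_cz h (z 0) (fun j => z j.succ) (fun j => -⌊z j.succ⌋)
    dsimp only at this
    rw [this, cz_eta]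
  rw [e]
  refine (hM _ ⟨fun i => ?_, fun i => ?_⟩).trans (le_abs_self _)
  · refine Fin.cases ?_ (fun j => ?_) i
    · exact (abs_le.1 hz).1
    · show (0:ℝ) ≤ z j.succ + ((-⌊z j.succ⌋ : ℤ) : ℝ)
      push_cast
      linarith [Int.floor_le (z j.succ)]
  · refine Fin.cases ?_ (fun j => ?_) i
    · exact (abs_le.1 hz).2
    · show z j.succ + ((-⌊z j.succ⌋ : ℤ) : ℝ) ≤ 1
      push_cast
      linarith [Int.lt_floor_add_one (z j.succ)]

lemma split_sm : ContDiff ℝ ∞ (fun z : Fin 4 → ℝ => ((z 0, fun j => z j.succ) : ℝ × Spc)) := by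
  refine ContDiff.prodMk (contDiff_apply ℝ ℝ 0) (contDiff_pi.2 fun j => contDiff_apply ℝ ℝ j.succ)

lemma tz_sm {f : ℝ → Spc → ℝ} (h : ContDiff ℝ ∞ (fun q : ℝ × Spc => f q.1 q.2)) : Sm (tz f) := h.comp split_sm

lemma test_GZ {f : ℝ → Spc → ℝ} (h : IsTest f) : GZ ∅ (tz f) :=
  ⟨tz_sm h.1, tz_per h.2.1, fun z hz => absurd hz (by simp [US])⟩

lemma test_T {f : ℝ → Spc → ℝ} (h : IsTest f) : ∃ T, 0 ≤ T ∧ ∀ z, T < |z 0| → tz f z = 0 := by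
  obtain ⟨T, hT⟩ := h.2.2
  exact ⟨max T 0, le_max_right _ _, fun z hz => hT _ ((le_max_left _ _).trans_lt hz) _⟩

lemma test_comp {φ : ℝ → Spc → Spc} (h : IsTest φ) (l : Fin 3) : IsTest (fun t x => φ t x l) := by
  obtain ⟨h1, h2, T, hT⟩ := h
  refine ⟨(contDiff_pi.1 h1) l, fun t x k => ?_, T, fun t ht x => ?_⟩
  · show φ t _ l = φ t x l
    rw [h2 t x k]
  · show φ t x l = 0
    rw [hT t ht x]; rfl

lemma weak_of {p : ZF} {S : Set ℝ} (hp : GZ ∅ p) {W : VF} (hW : ∀ i, Continuous (W i)) {V : ℕ → VF} {Q : ℕ → TF}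
    (H : ∀ q, ER p S (V q) (Q q)) (hl : ∀ η > 0, ∃ q, (∀ i z, |V q i z - W i z| ≤ η) ∧ ∀ i j z, |Q q i j z| ≤ η) :
    IsWeakEuler (fun t x i => W i (cz t x)) (fun t x => p (cz t x)) := by
  refine ⟨fun φ hφ => ?_, fun ψ hψ => ?_⟩
  · set Φ : VF := fun l => tz (fun t x => φ t x l) with hΦ
    have gΦ : ∀ l, GZ ∅ (Φ l) := fun l => test_GZ (test_comp hφ l)
    choose T0 hT0 hT using fun l => test_T (test_comp hφ l)
    set T := ∑ l, T0 l with hTd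
    have hT' : ∀ l z, T < |z 0| → Φ l z = 0 := fun l z hz =>
      hT l z ((Finset.single_le_sum (fun i _ => hT0 i) (Finset.mem_univ l)).trans_lt hz)
    have hT0' : 0 ≤ T := Finset.sum_nonneg fun i _ => hT0 i
    have hop : IsOpen {z : Fin 4 → ℝ | T < |z 0|} := isOpen_lt continuous_const (continuous_apply 0).abs
    have hd : ∀ a l z, T < |z 0| → pD a (Φ l) z = 0 := fun a l z hz => pD_zero_of_open hop (hT' l) z hz
    have := weak_mom hp hW H hl gΦ hT0' hT'
    rw [← int_conv] at this
    · rw [← this]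
      congr 1; funext t; congr 1; funext x
      unfold wf
      simp only [bridge_x ((gΦ _).sm.da _), bridge_t ((gΦ _).sm.da _)]
      rfl
    · unfold wf
      refine ((continuous_finsetSum _ fun l _ => (hW l).mul ((gΦ l).sm.pD 0).cont).add
        (continuous_finsetSum _ fun j _ => continuous_finsetSum _ fun l _ => ((hW j).mul (hW l)).mul ((gΦ l).sm.pD _).cont)).add
        (hp.sm.cont.mul (continuous_finsetSum _ fun j _ => ((gΦ j).sm.pD _).cont))
    · intro z hz
      have hz : T < |z 0| := by linarith
      unfold wf
      simp [hd _ _ z hz]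
  · have gΨ := test_GZ hψ
    obtain ⟨T, hT0, hT⟩ := test_T hψ
    have hop : IsOpen {z : Fin 4 → ℝ | T < |z 0|} := isOpen_lt continuous_const (continuous_apply 0).abs
    have hd : ∀ a z, T < |z 0| → pD a (tz ψ) z = 0 := fun a z hz => pD_zero_of_open hop hT z hz
    have := weak_div hW H hl gΨ hT0 hT
    rw [← int_conv] at this
    · rw [← this]
      congr 1; funext t; congr 1; funext x
      simp only [bridge_x (gΨ.sm.da _)]
    · exact continuous_finsetSum _ fun l _ => (hW l).mul (gΨ.sm.pD _).cont
    · intro z hz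
      have hz : T < |z 0| := by linarith
      simp [hd _ z hz]
end CI

namespace CI
open scoped ContDiff Topology

lemma Hc_x (τ δ c : ℝ) (j : Fin 3) : pD j.succ (Hc τ δ c) = fun _ => 0 := by
  have hl : ∀ s d, pD j.succ (lr s d) = fun _ => 0 := fun s d => by
    rw [lr_eq, pD_comp1 Real.smoothTransition.contDiff (Sm.lin _ _), pD_lin]
    simp [Fin.succ_ne_zero]
  unfold Hc
  rw [pD_mul (lr_GZ _ _).sm (lr_GZ _ _).sm, hl, hl]; simp

lemma mn_tmul {θ f : ZF} (hθ : Sm θ) (h : ∀ j : Fin 3, pD j.succ θ = fun _ => 0) :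
    mn (fun z => θ z * f z) = fun z => θ z * mn f z := by
  have hs : ∀ (j : Fin 3) (z : Fin 4 → ℝ) (s : ℝ), θ (z + s • ee j.succ) = θ z := fun j =>
    const_of_fderiv hθ (fun z => congrFun (h j) z)
  unfold mn Pav
  rw [Kop_mul_const (hs 0), Kop_mul_const (hs 1), Kop_mul_const (hs 2)]

lemma mn_const (c : ℝ) : mn (fun _ => c) = fun _ => c := by
  unfold mn Pav
  simp [Kop_const_fun]

lemma mn_sub {f g : ZF} (hf : Sm f) (hg : Sm g) : mn (fun z => f z - g z) = fun z => mn f z - mn g z := by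
  have := mn_add hf hg.neg
  simp only [mn_neg, ← sub_eq_add_neg] at this
  exact this

lemma GZc (c : ℝ) : GZ ∅ (fun _ => c) := ⟨Sm.const c, fun _ _ _ => rfl, fun z hz => absurd hz (by simp [US])⟩
lemma US0 : IsOpen (US ∅) := US_open isOpen_empty

lemma mean_const {u : VF} {P : ZF} (hu : ∀ l, GZ ∅ (u l)) (hP : GZ ∅ P)
    (he : ∀ l z, |z 0| < 3/2 → pD 0 (u l) z + dv (fun i j z => u i z * u j z) l z + pD l.succ P z = 0) (l : Fin 3) (z : Fin 4 → ℝ)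
    (hz : |z 0| < 11/8) : mn (u l) z = mn (u l) 0 := by
  set θ := Hc (11/8) (1/16) 0 with hθ
  have su := fun l => (hu l).sm
  have guu : ∀ i j, GZ ∅ (fun z => u i z * u j z) := fun i j => GZ.mulL (hu i) (hu j)
  have sd : Sm (dv (fun i j z => u i z * u j z) l) := Sm.dv (fun i j => (guu i j).sm) l
  have k0 : (fun z => θ z * (pD 0 (u l) z + dv (fun i j z => u i z * u j z) l z + pD l.succ P z)) = fun _ => 0 := by
    funext z
    rcases lt_or_ge |z 0| (3/2) with h | h
    · rw [he l z h, mul_zero]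
    · rw [hθ, Hc_zero (by norm_num), zero_mul]
      rw [sub_zero]; linarith
  have k1 := mn_tmul (θ := θ) (f := fun z => pD 0 (u l) z + dv (fun i j z => u i z * u j z) l z + pD l.succ P z) (Hc_GZ _ _ _).sm (Hc_x _ _ _)
  rw [k0, mn_zero, mn_add (((su l).pD 0).add sd) (hP.sm.pD _), mn_add ((su l).pD 0) sd, mn_dv guu, mn_pDx hP, mn_pD (su l)] at k1
  have d0 : ∀ z : Fin 4 → ℝ, |z 0| < 11/8 → pD 0 (mn (u l)) z = 0 := fun z hz => by
    have := congrFun k1 z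
    rw [hθ, Hc_one (by norm_num) (by rw [sub_zero]; exact hz.le)] at this
    simpa using this.symm
  have dj : ∀ (j : Fin 3) z, pD j.succ (mn (u l)) z = 0 := fun j z => by
    rw [← mn_pD (su l), mn_pDx (hu l)]
  have sm := (su l).mn
  have hop : IsOpen {z : Fin 4 → ℝ | |z 0| < 11/8} := isOpen_lt (continuous_apply 0).abs continuous_const
  have hcv : Convex ℝ {z : Fin 4 → ℝ | |z 0| < 11/8} := by
    have : {z : Fin 4 → ℝ | |z 0| < 11/8} = (LinearMap.proj 0 : (Fin 4 → ℝ) →ₗ[ℝ] ℝ) ⁻¹' (Set.Ioo (-(11/8)) (11/8)) := by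
      ext z; simp [abs_lt]
    rw [this]
    exact (convex_Ioo _ _).linear_preimage _
  refine hop.is_const_of_fderiv_eq_zero (𝕜 := ℝ) hcv.isPreconnected (fun y _ => (sm.da y).differentiableWithinAt) (fun y hy => ?_) hz
    (show |(0 : Fin 4 → ℝ) 0| < 11/8 by norm_num)
  ext e
  rw [fderiv_eq_sum sm]
  refine Finset.sum_eq_zero fun i _ => ?_
  refine Fin.cases ?_ (fun j => ?_) i
  · rw [d0 y hy, mul_zero]
  · rw [dj j y, mul_zero]

lemma glue0 {u : VF} {P : ZF} (hu : ∀ l, GZ ∅ (u l)) (hP : GZ ∅ P)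
    (he : ∀ l z, |z 0| < 3/2 → pD 0 (u l) z + dv (fun i j z => u i z * u j z) l z + pD l.succ P z = 0)
    (hd : ∀ z, |z 0| < 3/2 → ∑ j : Fin 3, pD j.succ (u j) z = 0) :
    ∃ (c : Fin 3 → ℝ) (R : TF), ER (fun z => Hc (19/16) (1/8) 0 z * P z) (Sτ (1/16))
      (fun l z => c l + Hc (19/16) (1/8) 0 z * (u l z - c l)) R := by
  set χ := Hc (19/16) (1/8) 0 with hχ
  have gχ : GZ ∅ χ := Hc_GZ _ _ _
  have χx : ∀ j : Fin 3, pD j.succ χ = fun _ => 0 := Hc_x _ _ _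
  have χ1 : ∀ z : Fin 4 → ℝ, |z 0| ≤ 19/16 → χ z = 1 := fun z h => Hc_one (by norm_num) (by rwa [sub_zero])
  have χ0 : ∀ z : Fin 4 → ℝ, 21/16 ≤ |z 0| → χ z = 0 := fun z h => Hc_zero (by norm_num) (by rw [sub_zero]; linarith)
  have Sc : ∀ t, t ∈ Sτ (1/16) → |t| < 19/16 ∨ 21/16 < |t| := fun t ht => by
    have ht : 1/16 < |(|t| - 5/4)| := ht
    rcases lt_abs.1 ht with h | h
    · right; linarith
    · left; linarith
  have hSo : IsOpen (Sτ (1/16)) := Sτ_open _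
  have su := fun l => (hu l).sm
  let c : Fin 3 → ℝ := fun l => mn (u l) 0
  have hc : ∀ l z, |z 0| < 11/8 → mn (u l) z = c l := fun l z hz => mean_const hu hP he l z hz
  set v : VF := fun l z => c l + χ z * (u l z - c l) with hv
  have guc : ∀ l, GZ ∅ (fun z => u l z - c l) := fun l => (hu l).sub (GZc (c l))
  have gv : ∀ l, GZ ∅ (v l) := fun l => (GZc (c l)).add (GZ.mulL gχ (guc l))
  -- derivative of the cutoff
  have gχ' : GZ (Sτ (1/16)) (pD 0 χ) := by
    refine ⟨gχ.sm.pD 0, (Gd.pD gχ US0 0).per, fun z hz => ?_⟩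
    rcases Sc _ hz with h | h
    · rw [pD_congr (g := fun _ => 1), pD_const]
      filter_upwards [(isOpen_lt (continuous_apply 0).abs continuous_const).mem_nhds h] with y hy
      exact χ1 y (le_of_lt hy)
    · rw [pD_congr (g := fun _ => 0), pD_const]
      filter_upwards [(isOpen_lt continuous_const (continuous_apply 0).abs).mem_nhds h] with y hy
      exact χ0 y (le_of_lt hy)
  have χ'o : ∀ z, 21/16 < |z 0| → pD 0 χ z = 0 := fun z hz => by
    apply gχ'.van
    show 1/16 < |(|z 0| - 5/4)|
    rw [lt_abs]; left; linarith
  set g : VF := fun l z => pD 0 χ z * (u l z - c l) with hg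
  have gg : ∀ l, GZ (Sτ (1/16)) (g l) := fun l => GZ.mulL gχ' (guc l)
  have mg : ∀ l, mn (g l) = fun _ => 0 := fun l => by
    show mn (fun z => pD 0 χ z * (u l z - c l)) = _
    rw [mn_tmul gχ'.sm (fun j => by rw [pD_comm gχ.sm, χx, pD_const]), mn_sub (su l) (Sm.const _), mn_const]
    funext z
    rcases lt_or_ge |z 0| (11/8) with h | h
    · simp [hc l z h]
    · simp [χ'o z (by linarith)]
  have g2 : ∀ i j, GZ ∅ (fun z => χ z * (u i z * u j z)) := fun i j => GZ.mulL gχ (GZ.mulL (hu i) (hu j))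
  have g3 : ∀ i j, Sm (fun z => (1 - χ z) * (c i * c j)) := fun i j => ((Sm.const 1).sub gχ.sm).mul (Sm.const _)
  have gvv : ∀ i j, GZ ∅ (fun z => v i z * v j z) := fun i j => GZ.mulL (gv i) (gv j)
  have gRz := GZ.Rz hSo gg
  have sR := fun i j => (gRz i j).sm
  refine ⟨c, fun i j z => ((Rz g i j z + v i z * v j z) - χ z * (u i z * u j z)) - (1 - χ z) * (c i * c j), gv, ?_, ?_, ?_, ?_⟩
  · intro z
    have e : ∀ i : Fin 3, pD i.succ (v i) z = χ z * pD i.succ (u i) z := fun i => by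
      show pD i.succ (fun z => c i + χ z * (u i z - c i)) z = _
      rw [pD_add (Sm.const _) (gχ.sm.mul (guc i).sm), pD_mul gχ.sm (guc i).sm, pD_sub (su i) (Sm.const _), pD_const, χx]
      simp
    show ∑ i : Fin 3, pD i.succ (v i) z = 0
    rw [Finset.sum_congr rfl fun i _ => e i, ← Finset.mul_sum]
    rcases lt_or_ge |z 0| (3/2) with h | h
    · rw [hd z h, mul_zero]
    · rw [χ0 z (by linarith), zero_mul]
  · intro i j
    refine ⟨((((sR i j).add (gvv i j).sm).sub (g2 i j).sm).sub (g3 i j)), fun p hp z => ?_, fun z hz => ?_⟩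
    · rw [(gRz i j).per p hp, (gv i).per p hp, (gv j).per p hp, gχ.per p hp, (hu i).per p hp, (hu j).per p hp]
    · rw [(gRz i j).van z hz]
      simp only [hv]
      rcases Sc _ hz with h | h
      · rw [χ1 z h.le]; ring
      · rw [χ0 z h.le]; ring
  · intro i j
    funext z
    rw [Rz_symm]; ring
  · intro i z
    rw [dv_sub (T := fun i j z => (Rz g i j z + v i z * v j z) - χ z * (u i z * u j z)) (T' := fun i j z => (1 - χ z) * (c i * c j))
        (fun i j => ((sR i j).add (gvv i j).sm).sub (g2 i j).sm) g3,
      dv_sub (T := fun i j z => Rz g i j z + v i z * v j z) (T' := fun i j z => χ z * (u i z * u j z)) (fun i j => (sR i j).add (gvv i j).sm) (fun i j => (g2 i j).sm),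
      dv_add (T := Rz g) (T' := fun i j z => v i z * v j z) sR (fun i j => (gvv i j).sm), dv_Rz hSo gg mg]
    have a1 : dv (fun i j z => (1 - χ z) * (c i * c j)) i z = 0 := by
      unfold dv
      refine Finset.sum_eq_zero fun j _ => ?_
      rw [pD_mul ((Sm.const 1).sub gχ.sm) (Sm.const _), pD_sub (Sm.const 1) gχ.sm, pD_const, pD_const, χx]
      simp
    have a2 : dv (fun i j z => χ z * (u i z * u j z)) i z = χ z * dv (fun i j z => u i z * u j z) i z := by
      unfold dv
      rw [Finset.mul_sum]
      refine Finset.sum_congr rfl fun j _ => ?_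
      rw [pD_mul gχ.sm ((su i).mul (su j)), χx]
      simp
    have a3 : pD i.succ (fun z => χ z * P z) z = χ z * pD i.succ P z := by
      rw [pD_mul gχ.sm hP.sm, χx]
      simp
    have a4 : pD 0 (v i) z = g i z + χ z * pD 0 (u i) z := by
      show pD 0 (fun z => c i + χ z * (u i z - c i)) z = _
      rw [pD_add (Sm.const _) (gχ.sm.mul (guc i).sm), pD_mul gχ.sm (guc i).sm, pD_sub (su i) (Sm.const _), pD_const]
      simp [hg]
    dsimp only
    rw [a1, a2, a3, a4]
    have a5 : χ z * (pD 0 (u i) z + dv (fun i j z => u i z * u j z) i z + pD i.succ P z) = 0 := by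
      rcases lt_or_ge |z 0| (3/2) with h | h
      · rw [he i z h, mul_zero]
      · rw [χ0 z (by linarith), zero_mul]
    linear_combination a5
end CI

namespace CI
open scoped ContDiff Topology

lemma tz_cda {f : ℝ → Spc → ℝ} (h : ContDiffOn ℝ ∞ (fun q : ℝ × Spc => f q.1 q.2) ((Set.Ioo (-2 : ℝ) 2) ×ˢ (Set.univ : Set Spc)))
    {z : Fin 4 → ℝ} (hz : |z 0| < 2) : ContDiffAt ℝ ∞ (tz f) z := by
  have h1 : ContDiffAt ℝ ∞ (fun q : ℝ × Spc => f q.1 q.2) (z 0, fun j => z j.succ) :=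
    h.contDiffAt ((isOpen_Ioo.prod isOpen_univ).mem_nhds ⟨⟨(abs_lt.1 hz).1, (abs_lt.1 hz).2⟩, trivial⟩)
  exact ContDiffAt.comp (f := fun z : Fin 4 → ℝ => ((z 0, fun j => z j.succ) : ℝ × Spc)) z h1 split_sm.contDiffAt

/-- cut off near `|t| = 7/4` -/
def cu (f : ℝ → Spc → ℝ) : ZF := fun z => Hc (3/2) (1/4) 0 z * tz f z

lemma cu_eq {f : ℝ → Spc → ℝ} {z : Fin 4 → ℝ} (hz : |z 0| ≤ 3/2) : cu f z = tz f z := by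
  unfold cu
  rw [Hc_one (by norm_num) (by rwa [sub_zero]), one_mul]

lemma cu_pD {f : ℝ → Spc → ℝ} {z : Fin 4 → ℝ} (hz : |z 0| < 3/2) (i) : pD i (cu f) z = pD i (tz f) z := by
  apply pD_congr
  filter_upwards [(isOpen_lt (continuous_apply 0).abs continuous_const).mem_nhds hz] with y hy
  exact cu_eq (le_of_lt hy)

lemma cu_GZ {f : ℝ → Spc → ℝ} (hp : ∀ t, Per (f t))
    (h : ContDiffOn ℝ ∞ (fun q : ℝ × Spc => f q.1 q.2) ((Set.Ioo (-2 : ℝ) 2) ×ˢ (Set.univ : Set Spc))) : GZ ∅ (cu f) := by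
  refine ⟨?_, fun p hpp z => ?_, fun z hz => absurd hz (by simp [US])⟩
  · refine contDiff_iff_contDiffAt.2 fun z => ?_
    rcases lt_or_ge |z 0| 2 with hz | hz
    · exact (Hc_GZ _ _ _).sm.contDiffAt.mul (tz_cda h hz)
    · have : cu f =ᶠ[𝓝 z] fun _ => 0 := by
        filter_upwards [(isOpen_lt continuous_const (continuous_apply 0).abs).mem_nhds (show (7/4:ℝ) < |z 0| by linarith)] with y hy
        have hy : (7/4:ℝ) < |y 0| := hy
        unfold cu
        rw [Hc_zero (by norm_num) (by rw [sub_zero]; linarith), zero_mul]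
      exact contDiffAt_const.congr_of_eventuallyEq this
  · unfold cu
    rw [tz_per hp p hpp, (Hc_GZ _ _ _).per p hpp]

lemma bd_fam {ι : Type*} [Fintype ι] {f : ι → ZF} (h : ∀ i, GZ ∅ (f i)) {T : ℝ} (h0 : ∀ i z, T < |z 0| → f i z = 0) :
    ∃ M, 0 ≤ M ∧ ∀ i z, |f i z| ≤ M := by
  choose M hM0 hM using fun i => bd_per (h i).sm.cont (h i).pr (h0 i)
  exact ⟨∑ i, M i, Finset.sum_nonneg fun i _ => hM0 i, fun i z =>
    (hM i z).trans (Finset.single_le_sum (fun i _ => hM0 i) (Finset.mem_univ i))⟩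

lemma cz_dist (t t' : ℝ) (x x' : Spc) : ‖cz t x - cz t' x'‖ ≤ dist ((t, x) : ℝ × Spc) ((t', x') : ℝ × Spc) := by
  rw [pi_norm_le_iff_of_nonneg dist_nonneg]
  intro i
  refine Fin.cases ?_ (fun j => ?_) i
  · exact (le_max_left (dist t t') (dist x x'))
  · exact (dist_le_pi_dist x x' j).trans (le_max_right (dist t t') (dist x x'))

lemma Hol.cz {α : ℝ} (hα : 0 < α) {f : ZF} (h : Hol α f) : ∃ C, 0 ≤ C ∧ ∀ (t t' : ℝ) (x x' : Spc),
    |f (cz t x) - f (cz t' x')| ≤ C * dist ((t, x) : ℝ × Spc) ((t', x') : ℝ × Spc) ^ α := by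
  obtain ⟨C, hC⟩ := h
  refine ⟨|C|, abs_nonneg _, fun t t' x x' => (hC _ _).trans ?_⟩
  exact mul_le_mul (le_abs_self _) (Real.rpow_le_rpow (norm_nonneg _) (cz_dist _ _ _ _) hα.le) (by positivity) (abs_nonneg _)

lemma main (v : ℝ → Spc → Spc) (p : ℝ → Spc → ℝ)
    (hvper : ∀ t, Per (v t)) (hpper : ∀ t, Per (p t))
    (hvsm : ContDiffOn ℝ ∞ (fun q : ℝ × Spc => v q.1 q.2)
      ((Set.Ioo (-2 : ℝ) 2) ×ˢ (Set.univ : Set Spc)))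
    (hpsm : ContDiffOn ℝ ∞ (fun q : ℝ × Spc => p q.1 q.2)
      ((Set.Ioo (-2 : ℝ) 2) ×ˢ (Set.univ : Set Spc)))
    (heuler : IsClassicalEulerOn (Set.Ioo (-2 : ℝ) 2) v p) :
    ∃ (α : ℝ), 0 < α ∧
    ∃ (vb : ℝ → Spc → Spc) (pb : ℝ → Spc → ℝ),
      (∀ t, Per (vb t)) ∧ (∀ t, Per (pb t)) ∧
      IsWeakEuler vb pb ∧
      HolderTS α vb ∧ HolderTS α pb ∧
      (∀ t ∈ Set.Ioo (-1 : ℝ) 1, ∀ x, vb t x = v t x ∧ pb t x = p t x) ∧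
      (∃ (c : Spc) (c₀ : ℝ), ∀ t : ℝ, 3/2 ≤ |t| → ∀ x, vb t x = c ∧ pb t x = c₀) := by
  have vsm : ∀ l, ContDiffOn ℝ ∞ (fun q : ℝ × Spc => v q.1 q.2 l) ((Set.Ioo (-2 : ℝ) 2) ×ˢ (Set.univ : Set Spc)) :=
    fun l => contDiffOn_pi.1 hvsm l
  have vper : ∀ l t, Per (fun x => v t x l) := fun l t x k => congrFun (hvper t x k) l
  set u : VF := fun l => cu (fun t x => v t x l) with hu
  set P : ZF := cu p with hP
  have gu : ∀ l, GZ ∅ (u l) := fun l => cu_GZ (vper l) (vsm l)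
  have gP : GZ ∅ P := cu_GZ hpper hpsm
  have su := fun l => (gu l).sm
  have dv' : ∀ l (t : ℝ) (x : Spc), |t| < 2 → DifferentiableAt ℝ (tz (fun t x => v t x l)) (cz t x) := fun l t x ht =>
    (tz_cda (vsm l) (z := cz t x) ht).differentiableAt (by simp)
  have dp' : ∀ (t : ℝ) (x : Spc), |t| < 2 → DifferentiableAt ℝ (tz p) (cz t x) := fun t x ht =>
    (tz_cda hpsm (z := cz t x) ht).differentiableAt (by simp)
  have hd : ∀ z : Fin 4 → ℝ, |z 0| < 3/2 → ∑ j : Fin 3, pD j.succ (u j) z = 0 := by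
    intro z hz
    have h2 : |z 0| < 2 := by linarith
    have := (heuler (z 0) ⟨(abs_lt.1 h2).1, (abs_lt.1 h2).2⟩ (fun j => z j.succ)).2
    rw [← this]
    refine Finset.sum_congr rfl fun j _ => ?_
    rw [bridge_x (f := fun t x => v t x j) (dv' j _ _ h2), cz_eta]
    exact cu_pD hz _
  have he : ∀ l (z : Fin 4 → ℝ), |z 0| < 3/2 → pD 0 (u l) z + dv (fun i j z => u i z * u j z) l z + pD l.succ P z = 0 := by
    intro l z hz
    have h2 : |z 0| < 2 := by linarith
    have E := (heuler (z 0) ⟨(abs_lt.1 h2).1, (abs_lt.1 h2).2⟩ (fun j => z j.succ)).1 l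
    rw [bridge_t (f := fun t x => v t x l) (dv' l _ _ h2), bridge_x (f := p) (dp' _ _ h2), cz_eta, ← cu_pD hz, ← cu_pD hz] at E
    rw [← E]
    congr 2
    unfold dv
    have e : ∀ j : Fin 3, pD j.succ (fun z => u l z * u j z) z = v (z 0) (fun j => z j.succ) j * pd j (fun y => v (z 0) y l) (fun j => z j.succ)
        + u l z * pD j.succ (u j) z := by
      intro j
      rw [bridge_x (f := fun t x => v t x l) (dv' l _ _ h2), cz_eta, ← cu_pD hz, pD_mul (su l) (su j)]
      have : u j z = v (z 0) (fun j => z j.succ) j := cu_eq hz.le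
      dsimp only
      rw [this]; ring
    rw [Finset.sum_congr rfl fun j _ => e j, Finset.sum_add_distrib, ← Finset.mul_sum, hd z hz, mul_zero, add_zero]
  obtain ⟨c, R, H⟩ := glue0 gu gP he hd
  set χ := Hc (19/16) (1/8) 0 with hχ
  have gχ : GZ ∅ χ := Hc_GZ _ _ _
  have χ1 : ∀ z : Fin 4 → ℝ, |z 0| ≤ 19/16 → χ z = 1 := fun z h => Hc_one (by norm_num) (by rwa [sub_zero])
  have χ0 : ∀ z : Fin 4 → ℝ, 21/16 ≤ |z 0| → χ z = 0 := fun z h => Hc_zero (by norm_num) (by rw [sub_zero]; linarith)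
  set p0 : ZF := fun z => χ z * P z with hp0
  set v0 : VF := fun l z => c l + χ z * (u l z - c l) with hv0
  have gp0 : GZ ∅ p0 := GZ.mulL gχ gP
  have hop : IsOpen {z : Fin 4 → ℝ | 21/16 < |z 0|} := isOpen_lt continuous_const (continuous_apply 0).abs
  have inS : ∀ z : Fin 4 → ℝ, 21/16 < |z 0| → z ∈ US (Sτ (1/16)) := fun z hz => by
    show 1/16 < |(|z 0| - 5/4)|
    rw [lt_abs]; left; linarith
  obtain ⟨B1, hB1, b1⟩ := bd_fam (ι := Fin 3 × Fin 3) (f := fun q => R q.1 q.2) (T := 21/16) (fun q => GZe (H.gR _ _))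
    (fun q z hz => (H.gR _ _).van z (inS z hz))
  obtain ⟨B2, hB2, b2⟩ := bd_fam (ι := Fin 4 × Fin 3 × Fin 3) (f := fun q => pD q.1 (R q.2.1 q.2.2)) (T := 21/16)
    (fun q => Gd.pD (GZe (H.gR _ _)) US0 _)
    (fun q => pD_zero_of_open hop fun z hz => (H.gR _ _).van z (inS z hz))
  obtain ⟨B3, hB3, b3⟩ := bd_fam (ι := Fin 3) (f := fun l z => χ z * (u l z - c l)) (T := 21/16)
    (fun l => GZ.mulL gχ ((gu l).sub (GZc (c l)))) (fun l z hz => by rw [χ0 z hz.le, zero_mul])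
  obtain ⟨B4, hB4, b4⟩ := bd_fam (ι := Fin 4 × Fin 3) (f := fun q => pD q.1 (v0 q.2)) (T := 21/16)
    (fun q => Gd.pD (H.gv _) US0 _)
    (fun q z hz => by
      rw [pD_congr (g := fun _ => c q.2), pD_const]
      filter_upwards [hop.mem_nhds hz] with y hy
      rw [hv0]; dsimp only
      rw [χ0 y (le_of_lt hy), zero_mul, add_zero])
  obtain ⟨B5, hB5, b5⟩ := bd_fam (ι := Unit) (f := fun _ => p0) (T := 21/16) (fun _ => gp0)
    (fun l z hz => by rw [hp0]; dsimp only; rw [χ0 z hz.le, zero_mul])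
  obtain ⟨B6, hB6, b6⟩ := bd_fam (ι := Fin 4) (f := fun l => pD l p0) (T := 21/16) (fun l => Gd.pD gp0 US0 _)
    (fun l => pD_zero_of_open hop fun z hz => by
      have hz : 21/16 < |z 0| := hz
      rw [hp0]; dsimp only; rw [χ0 z hz.le, zero_mul])
  obtain ⟨α, K0, hα0, hα1, hlim⟩ := limit
  set cs := ∑ l, |c l| with hcs
  have hcs0 : 0 ≤ cs := Finset.sum_nonneg fun _ _ => abs_nonneg _
  set K := K0 + ⌈10 * (B1 + 1) + B2 + (cs + B3) + B4⌉₊ with hK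
  have hKr : 10 * (B1 + 1) + B2 + (cs + B3) + B4 ≤ (K:ℝ) := by
    refine (Nat.le_ceil _).trans ?_
    rw [hK]; push_cast; linarith [(Nat.cast_nonneg K0 : (0:ℝ) ≤ K0)]
  obtain ⟨W, V, Q, hW, hWv, hWp, hER, hl⟩ := hlim K (10 * (B1 + 1)) p0 v0 R (Nat.le_add_right _ _) (by linarith) (by linarith) H
    (fun i j z => (b1 (i, j) z).trans (by nlinarith)) (fun l i j z => (b2 (l, i, j) z).trans (by linarith))
    (fun i z => by
      have h1 : |c i| ≤ cs := Finset.single_le_sum (f := fun l => |c l|) (fun _ _ => abs_nonneg _) (Finset.mem_univ i)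
      have h2 := b3 i z
      refine (abs_add_le _ _).trans ?_
      linarith) (fun l i z => (b4 (l, i) z).trans (by linarith))
  have Wc : ∀ i, Continuous (W i) := fun i => (hW i).cont hα0
  have hp0H : Hol α p0 := ⟨_, hol_of hα0 hα1 hB5 (by positivity) (b5 ()) (lip_of gp0.sm b6)⟩
  refine ⟨α, hα0, fun t x i => W i (cz t x), fun t x => p0 (cz t x), fun t x k => ?_, fun t => per_cz gp0.pr t, weak_of gp0 Wc hER hl, ?_, ?_, ?_, c, 0, ?_⟩
  · funext i
    exact per_cz (hWp i) t x k
  · choose C hC0 hC using fun i => (hW i).cz hα0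
    refine ⟨∑ i, C i, fun t t' x x' => ?_⟩
    rw [pi_norm_le_iff_of_nonneg (by have := Finset.sum_nonneg fun i (_ : i ∈ Finset.univ) => hC0 i; positivity)]
    intro i
    refine (hC i t t' x x').trans ?_
    exact mul_le_mul_of_nonneg_right (Finset.single_le_sum (fun i _ => hC0 i) (Finset.mem_univ i)) (by positivity)
  · obtain ⟨C, -, hC⟩ := hp0H.cz hα0
    exact ⟨C, hC⟩
  · intro t ht x
    have ha : |t| < 1 := abs_lt.2 ht
    have hm : (cz t x) 0 ∈ Sτ (1/8) := by
      show 1/8 < |(|t| - 5/4)|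
      rw [lt_abs]; right; linarith
    have e1 : χ (cz t x) = 1 := χ1 _ (by rw [cz_0]; linarith)
    have h32 : |(cz t x) 0| ≤ 3/2 := by rw [cz_0]; linarith
    refine ⟨?_, ?_⟩
    · funext i
      show W i (cz t x) = v t x i
      rw [hWv i _ hm]
      show c i + χ (cz t x) * (u i (cz t x) - c i) = _
      rw [e1, hu]
      dsimp only
      rw [cu_eq h32, tz_cz]; ring
    · show χ (cz t x) * P (cz t x) = p t x
      rw [e1, one_mul, hP, cu_eq h32, tz_cz]
  · intro t ht x
    have hm : (cz t x) 0 ∈ Sτ (1/8) := by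
      show 1/8 < |(|t| - 5/4)|
      rw [lt_abs]; left; linarith
    have e1 : χ (cz t x) = 0 := χ0 _ (by rw [cz_0]; linarith)
    refine ⟨?_, ?_⟩
    · funext i
      show W i (cz t x) = c i
      rw [hWv i _ hm]
      show c i + χ (cz t x) * (u i (cz t x) - c i) = _
      rw [e1]; ring
    · show χ (cz t x) * P (cz t x) = 0
      rw [e1, zero_mul]
end CI

/-- Every smooth Euler flow on (−2,2)×𝕋³ coincides on (−1,1)×𝕋³ with a Hölder
continuous weak solution on ℝ×𝕋³ which is constant for |t| ≥ 3/2. -/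
theorem glue_smooth_euler
    (v : ℝ → Spc → Spc) (p : ℝ → Spc → ℝ)
    (hvper : ∀ t, Per (v t)) (hpper : ∀ t, Per (p t))
    (hvsm : ContDiffOn ℝ (⊤ : ℕ∞) (fun q : ℝ × Spc => v q.1 q.2)
      ((Set.Ioo (-2 : ℝ) 2) ×ˢ (Set.univ : Set Spc)))
    (hpsm : ContDiffOn ℝ (⊤ : ℕ∞) (fun q : ℝ × Spc => p q.1 q.2)
      ((Set.Ioo (-2 : ℝ) 2) ×ˢ (Set.univ : Set Spc)))
    (heuler : IsClassicalEulerOn (Set.Ioo (-2 : ℝ) 2) v p) :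
    ∃ (α : ℝ), 0 < α ∧
    ∃ (vb : ℝ → Spc → Spc) (pb : ℝ → Spc → ℝ),
      (∀ t, Per (vb t)) ∧ (∀ t, Per (pb t)) ∧
      IsWeakEuler vb pb ∧
      HolderTS α vb ∧ HolderTS α pb ∧
      (∀ t ∈ Set.Ioo (-1 : ℝ) 1, ∀ x, vb t x = v t x ∧ pb t x = p t x) ∧
      (∃ (c : Spc) (c₀ : ℝ), ∀ t : ℝ, 3/2 ≤ |t| → ∀ x, vb t x = c ∧ pb t x = c₀) := by
  exact CI.main v p hvper hpper hvsm hpsm heuler
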